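/- Let M be a compact n-manifold with n ≥ 2. Then ‖M,∂M‖ ≥ ‖∂M‖/(n−1). -/

import Mathlib

open scoped BigOperators
set_option maxSynthPendingDepth 3
noncomputable section

/-! ## The standard topological simplex and singular chains -/

/-- The standard topological `n`-simplex. -/
def TSimplex (n : ℕ) : Type :=
  {x : Fin (n + 1) → ℝ // (∀ i, 0 ≤ x i) ∧ ∑ i, x i = 1}

instance (n : ℕ) : TopologicalSpace (TSimplex n) := instTopologicalSpaceSubtype

/-- The affine inclusion of the `i`-th face of the standard `(n+1)`-simplex. -/
def faceMap {n : ℕ} (i : Fin (n + 2)) : C(TSimplex n, TSimplex (n + 1)) where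
  toFun x := ⟨fun j => ∑ k ∈ Finset.univ.filter (fun k => i.succAbove k = j), x.1 k, by
    constructor
    · intro j
      exact Finset.sum_nonneg fun k _ => x.2.1 k
    · rw [Finset.sum_fiberwise_of_maps_to (fun k _ => Finset.mem_univ (i.succAbove k)), x.2.2]⟩
  continuous_toFun := by
    apply Continuous.subtype_mk
    exact continuous_pi fun j => continuous_finset_sum _ fun k _ =>
      (continuous_apply k).comp continuous_subtype_val

/-- The `j`-th vertex of the standard simplex. -/
def vertexPt {m : ℕ} (j : Fin (m + 1)) : TSimplex m :=
  ⟨fun i => if i = j then 1 else 0, by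
    constructor
    · intro i; dsimp only; split <;> norm_num
    · simp⟩

set_option linter.unnecessarySeqFocus false in
/-- The affine map of the standard `1`-simplex onto the edge of the standard `k`-simplex
joining the vertices `a` and `b`. -/
def segMap {k : ℕ} (a b : Fin (k + 1)) : C(TSimplex 1, TSimplex k) where
  toFun x := ⟨fun j => (if j = a then x.1 0 else 0) + (if j = b then x.1 1 else 0), by
    constructor
    · intro j
      have h0 := x.2.1 0
      have h1 := x.2.1 1
      dsimp only
      split <;> split <;> simp_all <;> positivity
    · have := x.2.2
      rw [Finset.sum_add_distrib]
      simp [Finset.sum_ite_eq', ← this, Fin.sum_univ_two]⟩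
  continuous_toFun := by
    apply Continuous.subtype_mk
    apply continuous_pi
    intro j
    apply Continuous.add
    · split
      · exact (continuous_apply (0 : Fin 2)).comp continuous_subtype_val
      · exact continuous_const
    · split
      · exact (continuous_apply (1 : Fin 2)).comp continuous_subtype_val
      · exact continuous_const

/-- A singular `n`-simplex in `X`. -/
abbrev SingSimplex (n : ℕ) (X : Type) [TopologicalSpace X] : Type := C(TSimplex n, X)

/-- Singular `n`-chains in `X` with coefficients in `R`. -/
abbrev SChain (R : Type) [Zero R] (n : ℕ) (X : Type) [TopologicalSpace X] : Type :=
  SingSimplex n X →₀ R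

/-- The singular boundary operator. -/
def sbdry (R : Type) [CommRing R] {n : ℕ} {X : Type} [TopologicalSpace X] :
    SChain R (n + 1) X →ₗ[R] SChain R n X :=
  Finsupp.lsum R fun σ => LinearMap.toSpanSingleton R _
    (∑ i : Fin (n + 2), ((-1 : ℤ) ^ (i : ℕ)) • Finsupp.single (σ.comp (faceMap i)) (1 : R))

/-- The singular boundary operator, from degree `n` to degree `n - 1`. -/
def sbdryN (R : Type) [CommRing R] (n : ℕ) {X : Type} [TopologicalSpace X] :
    SChain R n X →ₗ[R] SChain R (n - 1) X :=
  match n with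
  | 0 => 0
  | (_ + 1) => sbdry R

/-- The `j`-th face of a singular `n`-simplex. -/
def faceOf {X : Type} [TopologicalSpace X] :
    (n : ℕ) → Fin (n + 1) → SingSimplex n X → SingSimplex (n - 1) X
  | 0, _, σ => σ
  | (_ + 1), k, σ => σ.comp (faceMap k)

/-- The edge of a singular `k`-simplex joining its `a`-th and `b`-th vertices. -/
def edgeOf {X : Type} [TopologicalSpace X] {k : ℕ} (a b : Fin (k + 1))
    (σ : SingSimplex k X) : SingSimplex 1 X :=
  σ.comp (segMap a b)

/-- The submodule of chains supported on a subspace `A`. -/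
def suppOn (R : Type) [CommRing R] (n : ℕ) {X : Type} [TopologicalSpace X] (A : Set X) :
    Submodule R (SChain R n X) :=
  Finsupp.supported R R {σ : SingSimplex n X | Set.range ⇑σ ⊆ A}

/-- `z` is a relative cycle of the pair `(X, A)`. -/
def IsRelCycle (R : Type) [CommRing R] (n : ℕ) {X : Type} [TopologicalSpace X] (A : Set X)
    (z : SChain R n X) : Prop :=
  sbdryN R n z ∈ suppOn R (n - 1) A

/-- Two chains are homologous relative to `A`. -/
def RelHomologous (R : Type) [CommRing R] (n : ℕ) {X : Type} [TopologicalSpace X] (A : Set X)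
    (z z' : SChain R n X) : Prop :=
  ∃ w : SChain R (n + 1) X, z - z' - sbdry R w ∈ suppOn R n A

/-- The ℓ¹-norm of a relative chain: the sum of the norms of the coefficients of the
simplices not contained in `A`. -/
def relNorm {R : Type} [NormedCommRing R] {n : ℕ} {X : Type} [TopologicalSpace X]
    (A : Set X) (z : SChain R n X) : ℝ :=
  letI : DecidablePred fun σ : SingSimplex n X => ¬ Set.range ⇑σ ⊆ A :=
    fun _ => Classical.dec _
  ∑ σ ∈ z.support.filter (fun σ : SingSimplex n X => ¬ Set.range ⇑σ ⊆ A), ‖z σ‖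

/-- `c` is an integral fundamental cycle of the pair `(X, A)` in degree `n`: it is a relative
cycle whose class generates `H_n(X, A; ℤ)`.  For a compact connected oriented `n`-manifold
`X` with boundary `A`, this holds exactly for the representatives of `±[X, A]`. -/
def IsFundCycle (n : ℕ) {X : Type} [TopologicalSpace X] (A : Set X) (c : SChain ℤ n X) : Prop :=
  IsRelCycle ℤ n A c ∧
    ∀ z : SChain ℤ n X, IsRelCycle ℤ n A z → ∃ k : ℤ, RelHomologous ℤ n A z (k • c)

/-- Change of coefficients `ℤ → ℝ` on chains. -/
def intToReal {n : ℕ} {X : Type} [TopologicalSpace X] (c : SChain ℤ n X) : SChain ℝ n X :=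
  Finsupp.mapRange (fun k : ℤ => (k : ℝ)) (by norm_num) c

/-- Change of coefficients `ℤ → ℚ` on chains. -/
def intToRat {n : ℕ} {X : Type} [TopologicalSpace X] (c : SChain ℤ n X) : SChain ℚ n X :=
  Finsupp.mapRange (fun k : ℤ => (k : ℚ)) (by norm_num) c

/-- Change of coefficients `ℚ → ℝ` on chains. -/
def ratToReal {n : ℕ} {X : Type} [TopologicalSpace X] (c : SChain ℚ n X) : SChain ℝ n X :=
  Finsupp.mapRange (fun k : ℚ => (k : ℝ)) (by norm_num) c

/-- The pair `(X, A)` is homologically orientable in degree `n`: the `n`-th relative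
integral homology has a generator which is not trivial. -/
def HomOrientable (n : ℕ) (X : Type) [TopologicalSpace X] (A : Set X) : Prop :=
  ∃ c : SChain ℤ n X, IsFundCycle n A c ∧ ¬ RelHomologous ℤ n A c 0

/-- The simplicial volume of a pair `(X, A)`, where `X` is a compact connected oriented
`n`-manifold with boundary `A`: the infimum of the ℓ¹-norms of the real relative cycles
representing (the real image of) an integral fundamental class. -/
def simVolOr (n : ℕ) (X : Type) [TopologicalSpace X] (A : Set X) : ℝ :=
  sInf {r : ℝ | ∃ z : SChain ℝ n X,
    (∃ c : SChain ℤ n X, IsFundCycle n A c ∧ RelHomologous ℝ n A z (intToReal c)) ∧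
    r = relNorm A z}

/-- Rational version of `simVolOr`. -/
def simVolOrQ (n : ℕ) (X : Type) [TopologicalSpace X] (A : Set X) : ℝ :=
  sInf {r : ℝ | ∃ z : SChain ℚ n X,
    (∃ c : SChain ℤ n X, IsFundCycle n A c ∧ RelHomologous ℚ n A z (intToRat c)) ∧
    r = relNorm A z}

/-- `p` is a two-sheeted covering map. -/
def IsDoubleCover {Y X : Type} [TopologicalSpace Y] [TopologicalSpace X] (p : Y → X) : Prop :=
  IsCoveringMap p ∧ ∀ x : X, Nat.card (p ⁻¹' {x}) = 2

/-- Simplicial volume of a connected pair: the norm of the fundamental class if the pair is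
(homologically) orientable, and one half of the simplicial volume of the orientable double
cover otherwise. -/
def simVolConn (n : ℕ) (X : Type) [TopologicalSpace X] (A : Set X) : ℝ :=
  letI := Classical.propDecidable (HomOrientable n X A)
  if HomOrientable n X A then simVolOr n X A
  else (1 / 2) * sInf {r : ℝ | ∃ (Y : TopCat.{0}) (p : ↥Y → X), IsDoubleCover p ∧
    HomOrientable n ↥Y (p ⁻¹' A) ∧ r = simVolOr n ↥Y (p ⁻¹' A)}

/-- The simplicial volume `‖X, A‖` of a compact manifold `X` with boundary `A`:
the sum over the connected components. -/
def SimVol (n : ℕ) (X : Type) [TopologicalSpace X] (A : Set X) : ℝ :=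
  ∑ᶠ c : ConnectedComponents X,
    simVolConn n {x : X // ConnectedComponents.mk x = c} {x | ↑x ∈ A}

/-- Rational simplicial volume (for orientable manifolds). -/
def SimVolQ (n : ℕ) (X : Type) [TopologicalSpace X] (A : Set X) : ℝ :=
  ∑ᶠ c : ConnectedComponents X,
    simVolOrQ n {x : X // ConnectedComponents.mk x = c} {x | ↑x ∈ A}

/-! ## Topological manifolds with boundary -/

/-- `X` is a topological `n`-manifold, possibly with boundary. -/
def IsManifoldWithBoundary (n : ℕ) (X : Type) [TopologicalSpace X] : Prop :=
  T2Space X ∧ SecondCountableTopology X ∧ ∀ x : X, ∃ U : Set X, x ∈ U ∧ IsOpen U ∧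
    (Nonempty (U ≃ₜ EuclideanSpace ℝ (Fin n)) ∨
      Nonempty (U ≃ₜ {y : EuclideanSpace ℝ (Fin n) // 0 ≤ ∑ i, y i}))

/-- The boundary of a topological `n`-manifold: the points having no neighbourhood
homeomorphic to `ℝⁿ`. -/
def intBoundary (n : ℕ) (X : Type) [TopologicalSpace X] : Set X :=
  {x | ¬ ∃ U : Set X, x ∈ U ∧ IsOpen U ∧ Nonempty (U ≃ₜ EuclideanSpace ℝ (Fin n))}

set_option linter.all false

namespace SV
open Finsupp

section
variable {R : Type} [CommRing R] {X Y Z V W : Type} [TopologicalSpace X] [TopologicalSpace Y]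
  [TopologicalSpace Z] {k m : ℕ}

/-! ### linear algebra of free modules, tuples -/

lemma lext {α M : Type} [AddCommGroup M] [Module R M] {f g : (α →₀ R) →ₗ[R] M}
    (h : ∀ a, f (single a 1) = g (single a 1)) : f = g := by
  refine Finsupp.lhom_ext' fun a => LinearMap.ext_ring ?_
  simpa using h a

abbrev lc {α M : Type} [AddCommGroup M] [Module R M] (f : α → M) : (α →₀ R) →ₗ[R] M :=
  Finsupp.linearCombination R f

lemma lc_single {α M : Type} [AddCommGroup M] [Module R M] (f : α → M) (a : α) :
    lc (R := R) f (single a 1) = f a := by simp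

abbrev Tup (R : Type) [CommRing R] (k : ℕ) (V : Type) : Type := (Fin k → V) →₀ R

def dT : Tup R (k + 1) V →ₗ[R] Tup R k V :=
  lc fun v => ∑ i : Fin (k + 1), ((-1 : ℤ) ^ (i : ℕ)) • single (v ∘ i.succAbove) (1 : R)

lemma dT_single (v : Fin (k + 1) → V) : dT (single v (1 : R)) =
    ∑ i : Fin (k + 1), ((-1 : ℤ) ^ (i : ℕ)) • single (v ∘ i.succAbove) (1 : R) := lc_single _ _

def cone (b : V) : Tup R k V →ₗ[R] Tup R (k + 1) V :=
  Finsupp.lmapDomain R R (fun v => (Fin.cons b v : Fin (k + 1) → V))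

lemma cone_single (b : V) (v : Fin k → V) :
    cone b (single v (1 : R)) = single (Fin.cons b v : Fin (k + 1) → V) 1 := by
  simp [cone, Finsupp.mapDomain_single]

lemma dT_cone_zero (b : V) (x : Tup R 0 V) : dT (cone b x) = x := by
  have : (dT ∘ₗ cone b : Tup R 0 V →ₗ[R] Tup R 0 V) = LinearMap.id := by
    refine lext fun v => ?_
    simp only [LinearMap.comp_apply, cone_single, dT_single, LinearMap.id_apply]
    simp
  exact congrArg (· x) this

lemma dT_cone (b : V) (x : Tup R (k + 1) V) : dT (cone b x) = x - cone b (dT x) := by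
  have : (dT ∘ₗ cone b : Tup R (k + 1) V →ₗ[R] Tup R (k + 1) V) =
      LinearMap.id - cone b ∘ₗ dT := by
    refine lext fun v => ?_
    simp only [LinearMap.comp_apply, cone_single, dT_single, LinearMap.id_apply,
      LinearMap.sub_apply, map_sum, map_zsmul]
    rw [Fin.sum_univ_succ, sub_eq_add_neg, ← Finset.sum_neg_distrib]
    congr 1
    · simp only [Fin.val_zero, pow_zero, one_smul]
      congr 1
    · refine Finset.sum_congr rfl fun i _ => ?_
      rw [Fin.val_succ, pow_succ, mul_neg_one, neg_smul]
      congr 3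
      funext j
      refine Fin.cases ?_ (fun j => ?_) j <;> simp
  exact congrArg (· x) this

lemma dT_dT : ∀ (k : ℕ) (x : Tup R (k + 2) V), dT (dT x) = 0 := by
  have key : ∀ (k : ℕ), (dT ∘ₗ dT : Tup R (k + 2) V →ₗ[R] Tup R k V) = 0 := by
    intro k
    induction k with
    | zero =>
      refine lext fun v => ?_
      rw [← Fin.cons_self_tail v, ← cone_single, LinearMap.comp_apply, dT_cone, map_sub,
        dT_cone_zero, sub_self, LinearMap.zero_apply]
    | succ k ih =>
      refine lext fun v => ?_
      rw [← Fin.cons_self_tail v, ← cone_single, LinearMap.comp_apply, dT_cone, map_sub,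
        dT_cone, ← LinearMap.comp_apply dT dT, ih, LinearMap.zero_apply]
      simp
  exact fun k x => congrArg (· x) (key k)

def mapT (f : V → W) : Tup R k V →ₗ[R] Tup R k W := Finsupp.lmapDomain R R (fun v => f ∘ v)

lemma mapT_single (f : V → W) (v : Fin k → V) : mapT f (single v (1 : R)) = single (f ∘ v) 1 := by
  simp [mapT, Finsupp.mapDomain_single]

lemma mapT_dT (f : V → W) (x : Tup R (k + 1) V) : mapT f (dT x) = dT (mapT f x) := by
  have : (mapT f ∘ₗ dT : Tup R (k + 1) V →ₗ[R] Tup R k W) = dT ∘ₗ mapT f :=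
    lext fun v => by
      simp only [LinearMap.comp_apply, dT_single, mapT_single, Function.comp_assoc, map_sum, map_zsmul]
  exact congrArg (· x) this

lemma mapT_cone (f : V → W) (b : V) (x : Tup R k V) :
    mapT f (cone b x) = cone (f b) (mapT f x) := by
  have : (mapT f ∘ₗ cone b : Tup R k V →ₗ[R] Tup R (k + 1) W) = cone (f b) ∘ₗ mapT f := by
    refine lext fun v => ?_
    simp only [LinearMap.comp_apply, cone_single, mapT_single]
    congr 1
    funext j
    refine Fin.cases ?_ (fun j => ?_) j <;> simp
  exact congrArg (· x) this

/-- subdivision on tuples -/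
def sdT (b : ∀ k, (Fin (k + 1) → V) → V) : ∀ k, Tup R k V →ₗ[R] Tup R k V
  | 0 => LinearMap.id
  | k + 1 => lc fun v => cone (b k v) (sdT b k (dT (single v 1)))

lemma sdT_dT (b : ∀ k, (Fin (k + 1) → V) → V) : ∀ (k : ℕ) (x : Tup R (k + 1) V),
    dT (sdT b (k + 1) x) = sdT b k (dT x) := by
  have key : ∀ k, (dT ∘ₗ sdT b (k + 1) : Tup R (k + 1) V →ₗ[R] _) = sdT b k ∘ₗ dT := by
    intro k
    induction k with
    | zero =>
      refine lext fun v => ?_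
      rw [LinearMap.comp_apply, show (sdT b (0 + 1) : Tup R 1 V →ₗ[R] _) = lc _ from rfl, lc_single,
        dT_cone_zero, LinearMap.comp_apply]
    | succ k ih =>
      refine lext fun v => ?_
      rw [LinearMap.comp_apply, show (sdT b (k + 1 + 1) : Tup R (k + 2) V →ₗ[R] _) = lc _ from rfl,
        lc_single, dT_cone, ← LinearMap.comp_apply dT, ih,
        LinearMap.comp_apply, dT_dT, map_zero, map_zero, sub_zero, LinearMap.comp_apply]
  exact fun k x => congrArg (· x) (key k)

lemma sdT_nat {b : ∀ k, (Fin (k + 1) → V) → V} {b' : ∀ k, (Fin (k + 1) → W) → W} (f : V → W)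
    (hf : ∀ k v, f (b k v) = b' k (f ∘ v)) :
    ∀ (k : ℕ) (x : Tup R k V), mapT f (sdT b k x) = sdT b' k (mapT f x) := by
  intro k
  induction k with
  | zero => intro x; rfl
  | succ k ih =>
    intro x
    have : (mapT f ∘ₗ sdT b (k + 1) : Tup R (k + 1) V →ₗ[R] _) = sdT b' (k + 1) ∘ₗ mapT f := by
      refine lext fun v => ?_
      simp only [LinearMap.comp_apply, sdT, lc_single, mapT_single, mapT_cone, ih, hf, mapT_dT]
    exact congrArg (· x) this

/-- homotopy on tuples -/
def hT (F G : ∀ k, Tup R k V →ₗ[R] Tup R k W) (b : ∀ k, (Fin (k + 1) → V) → W) :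
    ∀ k, Tup R k V →ₗ[R] Tup R (k + 1) W
  | 0 => 0
  | k + 1 => lc fun v => cone (b k v)
      (F _ (single v 1) - G _ (single v 1) - hT F G b k (dT (single v 1)))

lemma hT_dT {F G : ∀ k, Tup R k V →ₗ[R] Tup R k W} (b : ∀ k, (Fin (k + 1) → V) → W)
    (h0 : F 0 = G 0) (hF : ∀ k x, dT (F (k + 1) x) = F k (dT x))
    (hG : ∀ k x, dT (G (k + 1) x) = G k (dT x)) :
    ∀ (k : ℕ) (x : Tup R (k + 1) V),
      dT (hT F G b (k + 1) x) = F _ x - G _ x - hT F G b k (dT x) := by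
  have key : ∀ k, (dT ∘ₗ hT F G b (k + 1) : Tup R (k + 1) V →ₗ[R] _) =
      F _ - G _ - hT F G b k ∘ₗ dT := by
    intro k
    induction k with
    | zero =>
      refine lext fun v => ?_
      rw [LinearMap.comp_apply, show (hT F G b (0 + 1) : Tup R 1 V →ₗ[R] _) = lc _ from rfl, lc_single,
        dT_cone, map_sub (dT (R := R) (k := 0) (V := W)), map_sub (dT (R := R) (k := 0) (V := W)), hF, hG, h0]
      simp [hT]
    | succ k ih =>
      refine lext fun v => ?_
      rw [LinearMap.comp_apply, show (hT F G b (k + 1 + 1) : Tup R (k + 2) V →ₗ[R] _) = lc _ from rfl,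
        lc_single, dT_cone, map_sub (dT (R := R) (k := k + 1) (V := W)), map_sub (dT (R := R) (k := k + 1) (V := W)), hF, hG,
        ← LinearMap.comp_apply dT (hT F G b (k + 1)), ih]
      simp [dT_dT]
  exact fun k x => congrArg (· x) (key k)

lemma hT_nat {V' W' : Type} {F G : ∀ k, Tup R k V →ₗ[R] Tup R k W}
    {F' G' : ∀ k, Tup R k V' →ₗ[R] Tup R k W'} {b : ∀ k, (Fin (k + 1) → V) → W}
    {b' : ∀ k, (Fin (k + 1) → V') → W'} (f : V → V') (g : W → W')
    (hb : ∀ k v, g (b k v) = b' k (f ∘ v)) (hF : ∀ k x, mapT g (F k x) = F' k (mapT f x))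
    (hG : ∀ k x, mapT g (G k x) = G' k (mapT f x)) :
    ∀ (k : ℕ) (x : Tup R k V), mapT g (hT F G b k x) = hT F' G' b' k (mapT f x) := by
  intro k
  induction k with
  | zero => intro x; simp [hT]
  | succ k ih =>
    intro x
    have : (mapT g ∘ₗ hT F G b (k + 1) : Tup R (k + 1) V →ₗ[R] _) =
        hT F' G' b' (k + 1) ∘ₗ mapT f := by
      refine lext fun v => ?_
      simp only [LinearMap.comp_apply, hT, lc_single, mapT_single, mapT_cone, map_sub, ih, hb,
        hF, hG, mapT_dT]
    exact congrArg (· x) this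

/-! ### affine simplices and pushforward -/

def push (f : C(X, Y)) : SChain R k X →ₗ[R] SChain R k Y :=
  Finsupp.lmapDomain R R (fun σ => f.comp σ)

lemma push_single (f : C(X, Y)) (σ : SingSimplex k X) (r : R) :
    push f (single σ r) = single (f.comp σ) r := by
  simp [push, Finsupp.mapDomain_single]

lemma push_push (g : C(Y, Z)) (f : C(X, Y)) (z : SChain R k X) :
    push g (push f z) = push (g.comp f) z := by
  have : (push g ∘ₗ push f : SChain R k X →ₗ[R] _) = push (g.comp f) :=
    lext fun v => by simp [LinearMap.comp_apply, push_single, ContinuousMap.comp_assoc]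
  exact congrArg (· z) this

lemma push_id (z : SChain R k X) : push (ContinuousMap.id X) z = z := by
  have : (push (ContinuousMap.id X) : SChain R k X →ₗ[R] _) = LinearMap.id :=
    lext fun v => by simp [push_single]
  exact congrArg (· z) this

lemma sbdry_single (σ : SingSimplex (k + 1) X) : sbdry R (single σ 1) =
    ∑ i : Fin (k + 2), ((-1 : ℤ) ^ (i : ℕ)) • single (σ.comp (faceMap i)) (1 : R) := by
  simp [sbdry]

lemma push_sbdry (f : C(X, Y)) (z : SChain R (k + 1) X) :
    sbdry R (push f z) = push f (sbdry R z) := by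
  have : (sbdry R ∘ₗ push f : SChain R (k + 1) X →ₗ[R] _) = push f ∘ₗ sbdry R :=
    lext fun v => by
      simp only [LinearMap.comp_apply, push_single, sbdry_single, ContinuousMap.comp_assoc, map_sum,
        map_zsmul]
  exact congrArg (· z) this

lemma push_sbdryN (f : C(X, Y)) (z : SChain R k X) :
    sbdryN R k (push f z) = push f (sbdryN R k z) := by
  cases k with
  | zero => simp [sbdryN]
  | succ k => exact push_sbdry f z

def aff (w : Fin (k + 1) → TSimplex m) : C(TSimplex k, TSimplex m) where
  toFun x := ⟨fun j => ∑ i, x.1 i * (w i).1 j, by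
    refine ⟨fun j => Finset.sum_nonneg fun i _ => mul_nonneg (x.2.1 i) ((w i).2.1 j), ?_⟩
    rw [Finset.sum_comm]
    simp [← Finset.mul_sum, (w _).2.2, x.2.2]⟩
  continuous_toFun := by
    apply Continuous.subtype_mk
    exact continuous_pi fun j => continuous_finsetSum _ fun k _ =>
      ((continuous_apply k).comp continuous_subtype_val).mul continuous_const

lemma aff_val (w : Fin (k + 1) → TSimplex m) (x : TSimplex k) (j : Fin (m + 1)) :
    (aff w x).1 j = ∑ i, x.1 i * (w i).1 j := rfl

lemma aff_vertex (w : Fin (k + 1) → TSimplex m) (j : Fin (k + 1)) : aff w (vertexPt j) = w j := by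
  apply Subtype.ext; funext i
  rw [aff_val]; simp [vertexPt]

lemma aff_id : aff (vertexPt : Fin (m + 1) → TSimplex m) = ContinuousMap.id _ := by
  ext x; apply Subtype.ext; funext i
  rw [aff_val]; simp [vertexPt]

lemma aff_comp {l : ℕ} (u : Fin (m + 1) → TSimplex l) (w : Fin (k + 1) → TSimplex m) :
    aff (aff u ∘ w) = (aff u).comp (aff w) := by
  ext x; apply Subtype.ext; funext i
  simp only [aff_val, Function.comp_apply, ContinuousMap.comp_apply, Finset.mul_sum,
    Finset.sum_mul]
  rw [Finset.sum_comm]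
  simp [mul_assoc]

lemma faceMap_eq (i : Fin (k + 2)) : faceMap i = aff (vertexPt ∘ i.succAbove) := by
  ext x; apply Subtype.ext; funext j
  rw [aff_val]
  show ∑ k ∈ Finset.univ.filter (fun k => i.succAbove k = j), x.1 k = _
  simp [vertexPt, Finset.sum_filter, eq_comm]

lemma face_vertex (i : Fin (k + 2)) : (faceMap i : TSimplex k → _) ∘ vertexPt =
    vertexPt ∘ i.succAbove := by
  funext j; rw [faceMap_eq]; exact aff_vertex _ _

lemma aff_face (w : Fin (k + 2) → TSimplex m) (i : Fin (k + 2)) :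
    (aff w).comp (faceMap i) = aff (w ∘ i.succAbove) := by
  rw [faceMap_eq, ← aff_comp]
  congr 1; funext j; exact aff_vertex _ _

def rho : Tup R (k + 1) (TSimplex m) →ₗ[R] SChain R k (TSimplex m) := lmapDomain R R aff

lemma rho_single (w : Fin (k + 1) → TSimplex m) : rho (single w (1 : R)) = single (aff w) 1 := by
  simp [rho, Finsupp.mapDomain_single]

lemma rho_dT (x : Tup R (k + 2) (TSimplex m)) : sbdry R (rho x) = rho (dT x) := by
  have : (sbdry R ∘ₗ rho : Tup R (k + 2) (TSimplex m) →ₗ[R] _) = rho ∘ₗ dT :=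
    lext fun v => by
      simp only [LinearMap.comp_apply, rho_single, sbdry_single, dT_single, aff_face, map_sum, map_zsmul]
  exact congrArg (· x) this

lemma push_aff_rho {l : ℕ} (u : Fin (m + 1) → TSimplex l) (x : Tup R (k + 1) (TSimplex m)) :
    push (aff u) (rho x) = rho (mapT (aff u) x) := by
  have : (push (aff u) ∘ₗ rho : Tup R (k + 1) (TSimplex m) →ₗ[R] _) = rho ∘ₗ mapT (aff u) :=
    lext fun v => by
      simp only [LinearMap.comp_apply, rho_single, push_single, mapT_single, aff_comp]
  exact congrArg (· x) this

/-- pairs -/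
def aff2 (w : Fin (k + 1) → TSimplex m × TSimplex 1) : C(TSimplex k, TSimplex m × TSimplex 1) :=
  (aff (Prod.fst ∘ w)).prodMk (aff (Prod.snd ∘ w))

def rho2 : Tup R (k + 1) (TSimplex m × TSimplex 1) →ₗ[R] SChain R k (TSimplex m × TSimplex 1) :=
  lmapDomain R R aff2

lemma rho2_single (w : Fin (k + 1) → TSimplex m × TSimplex 1) :
    rho2 (single w (1 : R)) = single (aff2 w) 1 := by
  simp [rho2, Finsupp.mapDomain_single]

lemma rho2_dT (x : Tup R (k + 2) (TSimplex m × TSimplex 1)) :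
    sbdry R (rho2 x) = rho2 (dT x) := by
  have : (sbdry R ∘ₗ rho2 : Tup R (k + 2) (TSimplex m × TSimplex 1) →ₗ[R] _) = rho2 ∘ₗ dT := by
    refine lext fun v => ?_
    simp only [LinearMap.comp_apply, rho2_single, sbdry_single, dT_single, map_sum, map_zsmul]
    refine Finset.sum_congr rfl fun i _ => ?_
    congr 2
    have h1 := aff_face (Prod.fst ∘ v) i
    have h2 := aff_face (Prod.snd ∘ v) i
    ext x : 1
    exact Prod.ext (congrArg (· x) h1) (congrArg (· x) h2)
  exact congrArg (· x) this

lemma push_aff_rho2 {l : ℕ} (u : Fin (m + 1) → TSimplex l)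
    (x : Tup R (k + 1) (TSimplex m × TSimplex 1)) :
    push ((aff u).prodMap (ContinuousMap.id _)) (rho2 x) =
      rho2 (mapT (Prod.map (aff u) id) x) := by
  have : (push ((aff u).prodMap (ContinuousMap.id _)) ∘ₗ rho2 :
      Tup R (k + 1) (TSimplex m × TSimplex 1) →ₗ[R] _) =
      rho2 ∘ₗ mapT (Prod.map (aff u) id) := by
    refine lext fun v => ?_
    simp only [LinearMap.comp_apply, rho2_single, push_single, mapT_single]
    congr 1
    have h1 := aff_comp u (Prod.fst ∘ v)
    ext x : 1
    exact Prod.ext (congrArg (· x) h1.symm) rfl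
  exact congrArg (· x) this
end

section
variable {R : Type} [CommRing R] {X Y Z V W : Type} [TopologicalSpace X] [TopologicalSpace Y]
  [TopologicalSpace Z] {k m : ℕ}

lemma lcongr {α M : Type} [AddCommGroup M] [Module R M] {f g : (α →₀ R) →ₗ[R] M} (z : α →₀ R)
    (h : ∀ a, f (single a 1) = g (single a 1)) : f z = g z := by rw [lext h]

lemma sbdry_sbdry (z : SChain R (k + 2) X) : sbdry R (sbdry R z) = 0 := by
  refine lcongr (f := sbdry R ∘ₗ sbdry R) (g := 0) z fun σ => ?_
  have : single σ (1 : R) = push σ (rho (single vertexPt 1)) := by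
    rw [rho_single, aff_id, push_single]; rfl
  rw [LinearMap.comp_apply, this, push_sbdry, push_sbdry, rho_dT, rho_dT, dT_dT]; simp

lemma sbdryN_sbdry (z : SChain R (k + 1) X) : sbdryN R k (sbdry R z) = 0 := by
  cases k with
  | zero => rfl
  | succ k => exact sbdry_sbdry z

def center (k : ℕ) : TSimplex k :=
  ⟨fun _ => ((k : ℝ) + 1)⁻¹, fun _ => by positivity, by simp; field_simp⟩

def bary (m k : ℕ) (v : Fin (k + 1) → TSimplex m) : TSimplex m := aff v (center k)

lemma bary_nat {l : ℕ} (u : Fin (m + 1) → TSimplex l) (k : ℕ) (v : Fin (k + 1) → TSimplex m) :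
    aff u (bary m k v) = bary l k (aff u ∘ v) := by
  rw [bary, bary, aff_comp]; rfl

/-- generic natural tuple homotopy data -/
structure TD (R : Type) [CommRing R] where
  F : ∀ m k, Tup R k (TSimplex m) →ₗ[R] Tup R k (TSimplex m × TSimplex 1)
  G : ∀ m k, Tup R k (TSimplex m) →ₗ[R] Tup R k (TSimplex m × TSimplex 1)
  b : ∀ m k, (Fin (k + 1) → TSimplex m) → TSimplex m × TSimplex 1
  h0 : ∀ m, F m 0 = G m 0
  hF : ∀ m k x, dT (F m (k + 1) x) = F m k (dT x)
  hG : ∀ m k x, dT (G m (k + 1) x) = G m k (dT x)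
  nF : ∀ (m l : ℕ) (u : Fin (m + 1) → TSimplex l) k x,
    mapT (Prod.map (aff u) id) (F m k x) = F l k (mapT (aff u) x)
  nG : ∀ (m l : ℕ) (u : Fin (m + 1) → TSimplex l) k x,
    mapT (Prod.map (aff u) id) (G m k x) = G l k (mapT (aff u) x)
  nb : ∀ (m l : ℕ) (u : Fin (m + 1) → TSimplex l) k v,
    Prod.map (aff u) id (b m k v) = b l k (aff u ∘ v)

def ee (R : Type) [CommRing R] (k : ℕ) : Tup R (k + 1) (TSimplex k) := single vertexPt 1

def ev (H : C(X × TSimplex 1, Y)) (σ : SingSimplex k X) : C(TSimplex k × TSimplex 1, Y) :=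
  H.comp (σ.prodMap (ContinuousMap.id _))

def opF (F : ∀ m k, Tup R k (TSimplex m) →ₗ[R] Tup R k (TSimplex m × TSimplex 1))
    (H : C(X × TSimplex 1, Y)) : SChain R k X →ₗ[R] SChain R k Y :=
  lc fun σ => push (ev H σ) (rho2 (F k (k + 1) (ee R k)))

def hop (D : TD R) (H : C(X × TSimplex 1, Y)) : SChain R k X →ₗ[R] SChain R (k + 1) Y :=
  lc fun σ => push (ev H σ) (rho2 (hT (D.F k) (D.G k) (D.b k) (k + 1) (ee R k)))

def hopN (D : TD R) (H : C(X × TSimplex 1, Y)) : ∀ k, SChain R (k - 1) X →ₗ[R] SChain R k Y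
  | 0 => 0
  | _ + 1 => hop D H

lemma hop_formula (D : TD R) (H : C(X × TSimplex 1, Y)) (z : SChain R k X) :
    sbdry R (hop D H z) = opF D.F H z - opF D.G H z - hopN D H k (sbdryN R k z) := by
  refine lcongr (f := sbdry R ∘ₗ hop D H) (g := opF D.F H - opF D.G H - hopN D H k ∘ₗ sbdryN R k)
    z fun σ => ?_
  simp only [LinearMap.comp_apply, LinearMap.sub_apply, hop, opF, lc_single]
  rw [push_sbdry, rho2_dT, hT_dT _ (D.h0 k) (D.hF k) (D.hG k)]
  simp only [map_sub]
  congr 1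
  cases k with
  | zero => simp [hT, hopN]
  | succ k =>
    simp only [hopN, sbdryN, sbdry_single, ee, dT_single, map_sum, map_zsmul, hop, lc_single]
    refine Finset.sum_congr rfl fun i _ => ?_
    congr 1
    have h1 : (single (vertexPt ∘ i.succAbove) 1 : Tup R (k + 1) (TSimplex (k + 1))) =
        mapT (aff (vertexPt ∘ i.succAbove)) (ee R k) := by
      rw [ee, mapT_single]; congr 1; funext j; exact (aff_vertex _ _).symm
    rw [h1, ← hT_nat (F := D.F k) (G := D.G k) (b := D.b k) _ (Prod.map (aff _) id)
      (D.nb _ _ _) (D.nF _ _ _) (D.nG _ _ _), ← push_aff_rho2, push_push, ← faceMap_eq]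
    rfl

lemma suppOn_mono {A B : Set X} (h : A ⊆ B) : suppOn R k A ≤ suppOn R k B :=
  Finsupp.supported_mono fun _ hσ => hσ.trans h

lemma single_mem_suppOn {A : Set X} {σ : SingSimplex k X} (h : ∀ x, σ x ∈ A) (r : R) :
    single σ r ∈ suppOn R k A :=
  Finsupp.single_mem_supported _ _ (by rintro _ ⟨x, rfl⟩; exact h x)

lemma lc_mem {l : ℕ} {A : Set X} {B : Set Y} {f : SingSimplex k X → SChain R l Y}
    (h : ∀ σ : SingSimplex k X, (∀ x, σ x ∈ A) → f σ ∈ suppOn R l B) {z : SChain R k X}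
    (hz : z ∈ suppOn R k A) : lc f z ∈ suppOn R l B := by
  rw [lc, Finsupp.linearCombination_apply]
  refine Submodule.sum_mem _ fun σ hσ => Submodule.smul_mem _ _ (h σ fun x => ?_)
  exact (Finsupp.mem_supported R z).1 hz hσ ⟨x, rfl⟩

lemma push_mem {f : C(X, Y)} {A : Set X} {B : Set Y} (h : ∀ x ∈ A, f x ∈ B) {z : SChain R k X}
    (hz : z ∈ suppOn R k A) : push f z ∈ suppOn R k B := by
  have : push f z = lc (fun σ => single (f.comp σ) (1 : R)) z :=
    lcongr z fun σ => by rw [push_single, lc_single]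
  rw [this]
  exact lc_mem (fun σ hσ => single_mem_suppOn (fun x => h _ (hσ x)) _) hz

lemma mem_suppOn_univ (z : SChain R k X) : z ∈ suppOn R k (Set.univ : Set X) := by
  refine (Finsupp.mem_supported R z).2 fun _ _ => Set.subset_univ _

lemma push_range {f : C(X, Y)} {B : Set Y} (h : ∀ x, f x ∈ B) (z : SChain R k X) :
    push f z ∈ suppOn R k B := push_mem (A := Set.univ) (fun x _ => h x) (mem_suppOn_univ z)

lemma sbdry_mem {A : Set X} {z : SChain R (k + 1) X} (hz : z ∈ suppOn R (k + 1) A) :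
    sbdry R z ∈ suppOn R k A := by
  have : sbdry R z = lc (fun σ => ∑ i : Fin (k + 2), ((-1 : ℤ) ^ (i : ℕ)) •
      single (σ.comp (faceMap i)) (1 : R)) z :=
    lcongr z fun σ => by rw [sbdry_single, lc_single]
  rw [this]
  refine lc_mem (fun σ hσ => Submodule.sum_mem _ fun i _ => ?_) hz
  have h2 : single (σ.comp (faceMap i)) (1 : R) ∈ suppOn R k A :=
    single_mem_suppOn (fun x => hσ (faceMap i x)) _
  rcases neg_one_pow_eq_or ℤ (i : ℕ) with h | h <;> rw [h]
  · rwa [one_smul]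
  · rw [neg_smul, one_smul]; exact neg_mem h2

lemma sbdryN_mem {A : Set X} {z : SChain R k X} (hz : z ∈ suppOn R k A) :
    sbdryN R k z ∈ suppOn R (k - 1) A := by
  cases k with
  | zero => exact Submodule.zero_mem _
  | succ k => exact sbdry_mem hz

lemma hop_mem (D : TD R) {H : C(X × TSimplex 1, Y)} {A : Set X} {B : Set Y}
    (h : ∀ x ∈ A, ∀ t, H (x, t) ∈ B) {z : SChain R k X} (hz : z ∈ suppOn R k A) :
    hop D H z ∈ suppOn R (k + 1) B :=
  lc_mem (fun σ hσ => push_range (fun x => h _ (hσ _) _) _) hz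

lemma opF_mem {F} {H : C(X × TSimplex 1, Y)} {A : Set X} {B : Set Y}
    (h : ∀ x ∈ A, ∀ t, H (x, t) ∈ B) {z : SChain R k X} (hz : z ∈ suppOn R k A) :
    opF F H z ∈ suppOn R k B :=
  lc_mem (fun σ hσ => push_range (fun x => h _ (hσ _) _) _) hz

lemma hopN_mem (D : TD R) {H : C(X × TSimplex 1, Y)} {A : Set X} {B : Set Y}
    (h : ∀ x ∈ A, ∀ t, H (x, t) ∈ B) {z : SChain R (k - 1) X} (hz : z ∈ suppOn R (k - 1) A) :
    hopN D H k z ∈ suppOn R k B := by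
  cases k with
  | zero => exact Submodule.zero_mem _
  | succ k => exact hop_mem D h hz

/-- relative cycles and boundaries as submodules -/
def relCyc (R : Type) [CommRing R] (k : ℕ) (A : Set X) : Submodule R (SChain R k X) :=
  (suppOn R (k - 1) A).comap (sbdryN R k)

def relBd (R : Type) [CommRing R] (k : ℕ) (A : Set X) : Submodule R (SChain R k X) :=
  LinearMap.range (sbdry R : SChain R (k + 1) X →ₗ[R] _) ⊔ suppOn R k A

lemma mem_relBd {A : Set X} {z : SChain R k X} :
    z ∈ relBd R k A ↔ ∃ w, ∃ u ∈ suppOn R k A, z = sbdry R w + u := by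
  simp only [relBd, Submodule.mem_sup, LinearMap.mem_range]
  constructor
  · rintro ⟨_, ⟨w, rfl⟩, u, hu, rfl⟩; exact ⟨w, u, hu, rfl⟩
  · rintro ⟨w, u, hu, rfl⟩; exact ⟨_, ⟨w, rfl⟩, u, hu, rfl⟩

lemma relHom_iff {A : Set X} {z z' : SChain R k X} :
    RelHomologous R k A z z' ↔ z - z' ∈ relBd R k A := by
  rw [mem_relBd]
  constructor
  · rintro ⟨w, h⟩; exact ⟨w, _, h, by abel⟩
  · rintro ⟨w, u, hu, h⟩; exact ⟨w, by rw [h]; simpa using hu⟩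

lemma sbdry_relBd (A : Set X) (w : SChain R (k + 1) X) : sbdry R w ∈ relBd R k A :=
  Submodule.mem_sup_left ⟨w, rfl⟩

lemma supp_relBd {A : Set X} {u : SChain R k X} (h : u ∈ suppOn R k A) : u ∈ relBd R k A :=
  Submodule.mem_sup_right h

lemma relBd_mono {A B : Set X} (h : A ⊆ B) : relBd R k A ≤ relBd R k B :=
  sup_le_sup_left (suppOn_mono h) _

lemma relCyc_mono {A B : Set X} (h : A ⊆ B) : relCyc R k A ≤ relCyc R k B :=
  Submodule.comap_mono (suppOn_mono h)

lemma relBd_le_relCyc (A : Set X) : relBd R k A ≤ relCyc R k A := by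
  intro z hz
  obtain ⟨w, u, hu, rfl⟩ := mem_relBd.1 hz
  show sbdryN R k (sbdry R w + u) ∈ suppOn R (k - 1) A
  rw [map_add, sbdryN_sbdry, zero_add]
  exact sbdryN_mem hu

lemma push_relCyc {f : C(X, Y)} {A : Set X} {B : Set Y} (h : ∀ x ∈ A, f x ∈ B) {z : SChain R k X}
    (hz : z ∈ relCyc R k A) : push f z ∈ relCyc R k B := by
  show sbdryN R k (push f z) ∈ suppOn R (k - 1) B
  rw [push_sbdryN]; exact push_mem h hz

lemma push_relBd {f : C(X, Y)} {A : Set X} {B : Set Y} (h : ∀ x ∈ A, f x ∈ B) {z : SChain R k X}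
    (hz : z ∈ relBd R k A) : push f z ∈ relBd R k B := by
  obtain ⟨w, u, hu, rfl⟩ := mem_relBd.1 hz
  rw [map_add, ← push_sbdry]
  exact add_mem (sbdry_relBd _ _) (supp_relBd (push_mem h hu))

lemma hop_rel (D : TD R) {H : C(X × TSimplex 1, Y)} {A : Set X} {B : Set Y}
    (h : ∀ x ∈ A, ∀ t, H (x, t) ∈ B) {z : SChain R k X} (hz : z ∈ relCyc R k A) :
    opF D.F H z - opF D.G H z ∈ relBd R k B := by
  have := hop_formula D H z
  rw [eq_sub_iff_add_eq] at this
  rw [← this]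
  exact add_mem (sbdry_relBd _ _) (supp_relBd (hopN_mem D h hz))

def inc (R : Type) [CommRing R] (t : TSimplex 1) (m k : ℕ) :
    Tup R k (TSimplex m) →ₗ[R] Tup R k (TSimplex m × TSimplex 1) := mapT fun x => (x, t)

lemma mapT_mapT {U : Type} (g : W → U) (f : V → W) (x : Tup R k V) :
    mapT g (mapT f x) = mapT (g ∘ f) x :=
  lcongr (f := mapT g ∘ₗ mapT f) x fun v => by
    simp only [LinearMap.comp_apply, mapT_single]; rfl

lemma mapT_zero_eq (f g : V → W) : (mapT f : Tup R 0 V →ₗ[R] _) = mapT g :=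
  lext fun v => by simp only [mapT_single]; congr 1; exact Subsingleton.elim _ _

lemma inc_nat (t : TSimplex 1) (m l : ℕ) (u : Fin (m + 1) → TSimplex l) (k) (x : Tup R k _) :
    mapT (Prod.map (aff u) id) (inc R t m k x) = inc R t l k (mapT (aff u) x) := by
  rw [inc, inc, mapT_mapT, mapT_mapT]; rfl

def prismD (R : Type) [CommRing R] : TD R where
  F := inc R (vertexPt 1)
  G := inc R (vertexPt 0)
  b _ _ v := (v 0, vertexPt 0)
  h0 _ := mapT_zero_eq _ _
  hF _ _ _ := (mapT_dT _ _).symm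
  hG _ _ _ := (mapT_dT _ _).symm
  nF := inc_nat _
  nG := inc_nat _
  nb _ _ _ _ _ := rfl

def sdD (R : Type) [CommRing R] : TD R where
  F := inc R (vertexPt 0)
  G m k := inc R (vertexPt 0) m k ∘ₗ sdT (bary m) k
  b m k v := (bary m k v, vertexPt 0)
  h0 _ := rfl
  hF _ _ _ := (mapT_dT _ _).symm
  hG m k x := by
    simp only [LinearMap.comp_apply]; rw [← sdT_dT]; exact (mapT_dT _ _).symm
  nF := inc_nat _
  nG m l u k x := by
    simp only [LinearMap.comp_apply]; rw [inc_nat, sdT_nat (b' := bary l) _ (bary_nat u)]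
  nb m l u k v := by simp [bary_nat]

def at' (H : C(X × TSimplex 1, Y)) (t : TSimplex 1) : C(X, Y) :=
  H.comp ((ContinuousMap.id X).prodMk (ContinuousMap.const X t))

lemma aff_const (t : TSimplex m) : aff (fun _ : Fin (k + 1) => t) = ContinuousMap.const _ t := by
  ext x; apply Subtype.ext; funext i
  rw [aff_val, ← Finset.sum_mul, x.2.2, one_mul]; rfl

lemma rho2_inc (t : TSimplex 1) (x : Tup R (k + 1) (TSimplex m)) :
    rho2 (inc R t m (k + 1) x) =
      push ((ContinuousMap.id _).prodMk (ContinuousMap.const _ t)) (rho x) := by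
  refine lcongr (f := rho2 ∘ₗ inc R t m (k + 1)) (g := push _ ∘ₗ rho) x fun v => ?_
  simp only [LinearMap.comp_apply, inc, mapT_single, rho2_single, rho_single, push_single]
  congr 1
  ext x : 1
  refine Prod.ext rfl ?_
  exact congrArg (· x) (aff_const (k := k) t)

lemma opF_inc (t : TSimplex 1) (H : C(X × TSimplex 1, Y)) (z : SChain R k X) :
    opF (inc R t) H z = push (at' H t) z := by
  refine lcongr z fun σ => ?_
  rw [opF, lc_single, rho2_inc, push_push, ee, rho_single, aff_id, push_single, push_single]
  rfl

/-- prism operator -/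
def Pop (H : C(X × TSimplex 1, Y)) : SChain R k X →ₗ[R] SChain R (k + 1) Y := hop (prismD R) H

lemma Pop_formula (H : C(X × TSimplex 1, Y)) (z : SChain R k X) :
    sbdry R (Pop H z) = push (at' H (vertexPt 1)) z - push (at' H (vertexPt 0)) z
      - hopN (prismD R) H k (sbdryN R k z) := by
  rw [Pop, hop_formula]
  rw [← opF_inc, ← opF_inc]; rfl

lemma homot {H : C(X × TSimplex 1, Y)} {A : Set X} {B : Set Y}
    (h : ∀ x ∈ A, ∀ t, H (x, t) ∈ B) {z : SChain R k X} (hz : z ∈ relCyc R k A) :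
    push (at' H (vertexPt 1)) z - push (at' H (vertexPt 0)) z ∈ relBd R k B := by
  have := hop_rel (prismD R) h hz
  rwa [show (prismD R).F = inc R (vertexPt 1) from rfl,
    show (prismD R).G = inc R (vertexPt 0) from rfl, opF_inc, opF_inc] at this

/-- subdivision -/
def Sop : SChain R k X →ₗ[R] SChain R k X :=
  lc fun σ => push σ (rho (sdT (bary k) (k + 1) (ee R k)))

lemma Sop_eq (z : SChain R k X) : opF (sdD R).G ContinuousMap.fst z = Sop z := by
  refine lcongr z fun σ => ?_
  rw [opF, Sop, lc_single, lc_single]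
  show push _ (rho2 (inc R _ k (k + 1) _)) = _
  rw [rho2_inc, push_push]; rfl

lemma Sop_push (f : C(X, Y)) (z : SChain R k X) : Sop (push f z) = push f (Sop z) := by
  refine lcongr (f := Sop ∘ₗ push f) (g := push f ∘ₗ Sop) z fun σ => ?_
  simp only [LinearMap.comp_apply, push_single, Sop, lc_single, push_push]

lemma Sop_rho (x : Tup R (k + 1) (TSimplex m)) : Sop (rho x) = rho (sdT (bary m) (k + 1) x) := by
  refine lcongr (f := Sop ∘ₗ rho) (g := rho ∘ₗ sdT (bary m) (k + 1)) x fun v => ?_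
  simp only [LinearMap.comp_apply, rho_single, Sop, lc_single]
  rw [push_aff_rho, sdT_nat (b' := bary m) _ (bary_nat v), ee, mapT_single]
  congr 3; funext j; exact aff_vertex _ _

lemma Sop_mem {A : Set X} {z : SChain R k X} (hz : z ∈ suppOn R k A) : Sop z ∈ suppOn R k A :=
  lc_mem (fun _ hσ => push_range (fun _ => hσ _) _) hz

lemma Sop_rel {A : Set X} {z : SChain R k X} (hz : z ∈ relCyc R k A) :
    z - Sop z ∈ relBd R k A := by
  have := hop_rel (sdD R) (H := ContinuousMap.fst) (A := A) (B := A) (fun x hx t => hx) hz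
  rw [Sop_eq, show (sdD R).F = inc R (vertexPt 0) from rfl, opF_inc] at this
  have h2 : push (at' (ContinuousMap.fst : C(X × TSimplex 1, X)) (vertexPt 0)) z = z := push_id z
  rwa [h2] at this

lemma Sop_sbdry (z : SChain R (k + 1) X) : Sop (sbdry R z) = sbdry R (Sop z) := by
  have := hop_formula (sdD R) ContinuousMap.fst z
  have h2 := hop_formula (sdD R) ContinuousMap.fst (sbdry R z)
  have h3 := congrArg (sbdry R) this
  rw [sbdry_sbdry, map_sub, map_sub] at h3
  rw [sbdryN_sbdry, map_zero, sub_zero] at h2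
  have h4 : sbdry R (hopN (sdD R) ContinuousMap.fst (k + 1) (sbdryN R (k + 1) z)) = _ := h2
  rw [h4, Sop_eq, Sop_eq, show (sdD R).F = inc R (vertexPt 0) from rfl, opF_inc, opF_inc] at h3
  have h5 : ∀ (l : ℕ) (y : SChain R l X),
    push (at' (ContinuousMap.fst : C(X × TSimplex 1, X)) (vertexPt 0)) y = y := fun l y => push_id y
  rw [h5, h5] at h3
  rw [← sub_eq_zero]
  rw [eq_comm] at h3
  rw [← h3]; abel
end

section
variable {R : Type} [CommRing R] {X Y Z V W : Type} [TopologicalSpace X] [TopologicalSpace Y]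
  [TopologicalSpace Z] {k m : ℕ}

instance : MetricSpace (TSimplex m) := inferInstanceAs (MetricSpace (Subtype _))
instance : CompactSpace (TSimplex m) :=
  isCompact_iff_compactSpace.1 (isCompact_stdSimplex ℝ (Fin (m + 1)))

def Sm (R : Type) [CommRing R] (k : ℕ) (m : ℕ) (δ : ℝ) : Submodule R (Tup R k (TSimplex m)) :=
  supported R R {w | ∀ i j l, |(w i).1 l - (w j).1 l| ≤ δ}

def Hu (v : Fin k → TSimplex m) (x : TSimplex m) : Prop :=
  ∀ l (a b : ℝ), (∀ i, a ≤ (v i).1 l ∧ (v i).1 l ≤ b) → a ≤ x.1 l ∧ x.1 l ≤ b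

lemma Hu_aff (v : Fin (k + 1) → TSimplex m) (x : TSimplex k) : Hu v (aff v x) := by
  intro l a b h
  rw [aff_val]
  constructor
  · calc a = ∑ i, x.1 i * a := by rw [← Finset.sum_mul, x.2.2, one_mul]
      _ ≤ _ := Finset.sum_le_sum fun i _ => mul_le_mul_of_nonneg_left (h i).1 (x.2.1 i)
  · calc _ ≤ ∑ i, x.1 i * b :=
          Finset.sum_le_sum fun i _ => mul_le_mul_of_nonneg_left (h i).2 (x.2.1 i)
      _ = b := by rw [← Finset.sum_mul, x.2.2, one_mul]

lemma lc_mem' {α β : Type} {f : α → β →₀ R} {s : Set α} {t : Set β}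
    (h : ∀ a ∈ s, f a ∈ supported R R t) {z : α →₀ R} (hz : z ∈ supported R R s) :
    lc f z ∈ supported R R t := by
  rw [lc, Finsupp.linearCombination_apply]
  exact Submodule.sum_mem _ fun σ hσ => Submodule.smul_mem _ _
    (h σ ((Finsupp.mem_supported R z).1 hz hσ))

lemma zs_mem {α : Type} {s : Set α} (i : ℕ) {a : α} (h : a ∈ s) :
    ((-1 : ℤ) ^ i) • single a (1 : R) ∈ supported R R s := by
  have := Finsupp.single_mem_supported R (1 : R) h
  rcases neg_one_pow_eq_or ℤ i with h | h <;> rw [h]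
  · rwa [one_smul]
  · rw [neg_smul, one_smul]; exact neg_mem this

lemma sdT_small (N : ℕ) (δ : ℝ) (hδ : 0 ≤ δ) : ∀ k, k ≤ N + 1 → ∀ v : Fin k → TSimplex m,
    (∀ i j l, |(v i).1 l - (v j).1 l| ≤ δ) → sdT (bary m) k (single v (1 : R)) ∈
      supported R R {w | (∀ i j l, |(w i).1 l - (w j).1 l| ≤ (N / (N + 1) : ℝ) * δ) ∧
        ∀ i, Hu v (w i)} := by
  intro k
  induction k with
  | zero =>
    intro _ v _
    exact Finsupp.single_mem_supported _ _ ⟨fun i => i.elim0, fun i => i.elim0⟩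
  | succ k ih =>
    intro hk v hv
    rw [sdT, lc_single, cone, dT_single, map_sum, map_sum]
    refine Submodule.sum_mem _ fun i _ => ?_
    rw [map_zsmul, map_zsmul]
    have h1 := ih (by omega) (v ∘ i.succAbove) (fun _ _ _ => hv _ _ _)
    have h2 : lmapDomain R R (fun w : Fin k → TSimplex m => (Fin.cons (bary m k v) w : Fin (k + 1) → _))
        (sdT (bary m) k (single (v ∘ i.succAbove) (1 : R))) ∈
      supported R R {w | (∀ i j l, |(w i).1 l - (w j).1 l| ≤ (N / (N + 1) : ℝ) * δ) ∧
        ∀ i, Hu v (w i)} := by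
      have h3 := Submodule.mem_map_of_mem (f := lmapDomain R R (fun w : Fin k → TSimplex m =>
        (Fin.cons (bary m k v) w : Fin (k + 1) → _))) h1
      rw [Finsupp.lmapDomain_supported] at h3
      refine Finsupp.supported_mono ?_ h3
      rintro _ ⟨w, ⟨hw1, hw2⟩, rfl⟩
      have hw2' : ∀ i, Hu v (w i) := fun j l a b h => hw2 j l a b fun i' => h _
      have hb : ∀ j l, |(bary m k v).1 l - (v j).1 l| ≤ (N / (N + 1) : ℝ) * δ := by
        intro j l
        have e1 : (bary m k v).1 l - (v j).1 l =
            ((k : ℝ) + 1)⁻¹ * ∑ i, ((v i).1 l - (v j).1 l) := by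
          rw [bary, aff_val, Finset.sum_sub_distrib]
          simp [center, ← Finset.mul_sum]
          field_simp
        have e2 : |∑ i, ((v i).1 l - (v j).1 l)| ≤ k * δ := by
          rw [Fin.sum_univ_succAbove _ j, sub_self, zero_add]
          refine (Finset.abs_sum_le_sum_abs _ _).trans ?_
          refine (Finset.sum_le_sum fun i _ => hv _ _ _).trans ?_
          simp
        rw [e1, abs_mul, abs_of_pos (by positivity)]
        have e3 : (k : ℝ) ≤ N := by exact_mod_cast (by omega : k ≤ N)
        calc ((k : ℝ) + 1)⁻¹ * _ ≤ ((k : ℝ) + 1)⁻¹ * (k * δ) := by gcongr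
          _ = (k / (k + 1) : ℝ) * δ := by ring
          _ ≤ _ := by
            gcongr ?_ * δ
            rw [div_le_div_iff₀ (by positivity) (by positivity)]; nlinarith
      have hb2 : ∀ j l, |(bary m k v).1 l - (w j).1 l| ≤ (N / (N + 1) : ℝ) * δ := by
        intro j l
        have := hw2' j l ((bary m k v).1 l - N / (N + 1) * δ) ((bary m k v).1 l + N / (N + 1) * δ)
          fun i => by have := abs_le.1 (hb i l); constructor <;> linarith
        rw [abs_le]; constructor <;> linarith
      constructor
      · intro a b l
        refine Fin.cases ?_ (fun a => ?_) a <;> refine Fin.cases ?_ (fun b => ?_) b <;>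
          simp only [Fin.cons_zero, Fin.cons_succ]
        · rw [sub_self, abs_zero]; positivity
        · exact hb2 _ _
        · rw [abs_sub_comm]; exact hb2 _ _
        · exact hw1 _ _ _
      · intro a
        refine Fin.cases ?_ (fun a => ?_) a <;> simp only [Fin.cons_zero, Fin.cons_succ]
        · exact Hu_aff _ _
        · exact hw2' _
    rcases neg_one_pow_eq_or ℤ (i : ℕ) with h | h <;> rw [h]
    · rwa [one_smul]
    · rw [neg_smul, one_smul]; exact neg_mem h2

lemma sdT_Sm {δ : ℝ} (hδ : 0 ≤ δ) {x : Tup R (k + 1) (TSimplex m)} (hx : x ∈ Sm R (k + 1) m δ) :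
    sdT (bary m) (k + 1) x ∈ Sm R (k + 1) m ((k / (k + 1) : ℝ) * δ) := by
  have : sdT (bary m) (k + 1) x = lc (fun v => sdT (bary m) (k + 1) (single v 1)) x :=
    lcongr x fun v => by rw [lc_single]
  rw [this]
  exact lc_mem' (fun v hv => Finsupp.supported_mono (fun w hw => hw.1)
    (sdT_small k δ hδ (k + 1) le_rfl v hv)) hx

abbrev SP (R : Type) [CommRing R] (k : ℕ) (X : Type) [TopologicalSpace X] (M : ℕ) :
    SChain R k X →ₗ[R] SChain R k X := ((Sop : Module.End R (SChain R k X)) ^ M : Module.End R _)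

lemma SP_succ (M : ℕ) (z : SChain R k X) : SP R k X (M + 1) z = Sop (SP R k X M z) := by
  rw [SP, pow_succ']; rfl

lemma SP_ind {p : SChain R k X → Prop} (h : ∀ z, p z → p (Sop z)) {z} (hz : p z) (M : ℕ) :
    p (SP R k X M z) := by
  induction M with
  | zero => exact hz
  | succ M ih => rw [SP_succ]; exact h _ ih

lemma SP_mem {A : Set X} {z : SChain R k X} (hz : z ∈ suppOn R k A) (M : ℕ) :
    SP R k X M z ∈ suppOn R k A :=
  SP_ind (p := fun z => z ∈ suppOn R k A) (fun z h => Sop_mem h) hz M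

lemma SP_push (f : C(X, Y)) (z : SChain R k X) (M : ℕ) :
    SP R k Y M (push f z) = push f (SP R k X M z) := by
  induction M with
  | zero => rfl
  | succ M ih => rw [SP_succ, SP_succ, ih, Sop_push]

lemma SP_sbdry (z : SChain R (k + 1) X) (M : ℕ) :
    SP R k X M (sbdry R z) = sbdry R (SP R (k + 1) X M z) := by
  induction M with
  | zero => rfl
  | succ M ih => rw [SP_succ, SP_succ, ih, Sop_sbdry]

lemma SP_rel {A : Set X} {z : SChain R k X} (hz : z ∈ relCyc R k A) (M : ℕ) :
    z - SP R k X M z ∈ relBd R k A := by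
  induction M with
  | zero => rw [show SP R k X 0 z = z from rfl, sub_self]; exact zero_mem _
  | succ M ih =>
    have h1 : SP R k X M z ∈ relCyc R k A := by
      have := sub_mem hz (relBd_le_relCyc _ ih); rwa [sub_sub_cancel] at this
    have := add_mem ih (Sop_rel h1)
    rwa [← SP_succ, sub_add_sub_cancel] at this

lemma SP_add (a b : ℕ) (z : SChain R k X) : SP R k X (a + b) z = SP R k X a (SP R k X b z) := by
  rw [SP, pow_add]; rfl

lemma small {U V : Set X} (hU : IsOpen U) (hV : IsOpen V) {z : SChain R k X}
    (hz : z ∈ suppOn R k (U ∪ V)) : ∃ M, SP R k X M z ∈ suppOn R k U ⊔ suppOn R k V := by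
  have hmono : ∀ (y : SChain R k X) a, y ∈ suppOn R k U ⊔ suppOn R k V →
      SP R k X a y ∈ suppOn R k U ⊔ suppOn R k V := by
    intro y a hy
    obtain ⟨p, hp, q, hq, rfl⟩ := Submodule.mem_sup.1 hy
    rw [map_add]
    exact Submodule.add_mem_sup (SP_mem hp a) (SP_mem hq a)
  let T : Submodule R (SChain R k X) :=
    { carrier := {z | ∃ M, SP R k X M z ∈ suppOn R k U ⊔ suppOn R k V}
      add_mem' := by
        rintro a b ⟨M, hM⟩ ⟨N, hN⟩
        refine ⟨M + N, ?_⟩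
        rw [map_add, SP_add M N b, add_comm M N, SP_add N M a]
        exact add_mem (hmono _ _ hM) (hmono _ _ hN)
      zero_mem' := ⟨0, by rw [map_zero]; exact zero_mem _⟩
      smul_mem' := by
        rintro c x ⟨M, hM⟩
        exact ⟨M, by rw [map_smul]; exact Submodule.smul_mem _ _ hM⟩ }
  suffices z ∈ T from this
  rw [← Finsupp.sum_single z]
  refine Submodule.sum_mem _ fun σ hσ => ?_
  have hr : Set.range σ ⊆ U ∪ V := (Finsupp.mem_supported R z).1 hz hσ
  rw [← mul_one (z σ), ← smul_eq_mul, ← Finsupp.smul_single]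
  refine T.smul_mem _ ?_
  obtain ⟨δ, hδ, hL⟩ := lebesgue_number_lemma_of_metric (s := (Set.univ : Set (TSimplex k)))
    (c := fun b : Bool => cond b (σ ⁻¹' U) (σ ⁻¹' V)) isCompact_univ
    (by rintro (_ | _); exacts [hV.preimage σ.continuous, hU.preimage σ.continuous])
    (by
      intro x _
      rcases hr ⟨x, rfl⟩ with h | h
      · exact Set.mem_iUnion.2 ⟨true, h⟩
      · exact Set.mem_iUnion.2 ⟨false, h⟩)
  obtain ⟨M, hM⟩ : ∃ M : ℕ, ((k / (k + 1) : ℝ)) ^ M < δ :=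
    exists_pow_lt_of_lt_one hδ (by rw [div_lt_one (by positivity)]; linarith)
  refine ⟨M, ?_⟩
  have h0 : (single σ 1 : SChain R k X) = push σ (rho (ee R k)) := by
    rw [ee, rho_single, aff_id, push_single]; rfl
  have h1 : ∀ M : ℕ, ∃ x ∈ Sm R (k + 1) k (((k / (k + 1) : ℝ)) ^ M),
      SP R k _ M (rho (ee R k)) = rho x := by
    intro M
    induction M with
    | zero =>
      refine ⟨ee R k, Finsupp.single_mem_supported _ _ fun i j l => ?_, rfl⟩
      rw [pow_zero, abs_le]
      simp only [vertexPt]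
      constructor <;> split_ifs <;> norm_num
    | succ M ih =>
      obtain ⟨x, hx, h⟩ := ih
      refine ⟨_, pow_succ' (k / (k + 1) : ℝ) M ▸ sdT_Sm (by positivity) hx, ?_⟩
      rw [SP_succ, h, Sop_rho]
  obtain ⟨x, hx, h1⟩ := h1 M
  rw [h0, SP_push, h1]
  rw [← Finsupp.sum_single x, Finsupp.sum, map_sum, map_sum]
  refine Submodule.sum_mem _ fun w hw => ?_
  have hw' := (Finsupp.mem_supported R x).1 hx hw
  rw [rho, Finsupp.lmapDomain_apply, Finsupp.mapDomain_single, push_single]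
  obtain ⟨b, hb⟩ := hL (w 0) trivial
  have hin : ∀ y, aff w y ∈ Metric.ball (w 0) δ := by
    intro y
    rw [Metric.mem_ball]
    refine lt_of_le_of_lt ?_ hM
    refine (dist_pi_le_iff (by positivity)).2 fun l => ?_
    have := Hu_aff w y l ((w 0).1 l - (k / (k + 1) : ℝ) ^ M) ((w 0).1 l + (k / (k + 1) : ℝ) ^ M)
      fun i => by have := abs_le.1 (hw' i 0 l); constructor <;> linarith
    rw [Real.dist_eq, abs_le]; constructor <;> linarith
  rcases b with _ | _
  · have h2 : ∀ y, (σ.comp (aff w)) y ∈ V := fun y => hb (hin y)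
    exact Submodule.mem_sup_right (single_mem_suppOn h2 _)
  · have h2 : ∀ y, (σ.comp (aff w)) y ∈ U := fun y => hb (hin y)
    exact Submodule.mem_sup_left (single_mem_suppOn h2 _)

lemma suppOn_inter {A B : Set X} {z : SChain R k X} (h : z ∈ suppOn R k A) (h' : z ∈ suppOn R k B) :
    z ∈ suppOn R k (A ∩ B) := by
  rw [suppOn, Finsupp.mem_supported] at *
  exact fun σ hσ => Set.subset_inter (h hσ) (h' hσ)

lemma small_rel {U V : Set X} (hU : IsOpen U) (hV : IsOpen V) {z : SChain R k X}
    (hz : z ∈ relBd R k (U ∪ V)) : ∃ M c, ∃ p ∈ suppOn R k U, ∃ q ∈ suppOn R k V,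
      SP R k X M z = sbdry R c + p + q := by
  obtain ⟨c, w, hw, rfl⟩ := mem_relBd.1 hz
  obtain ⟨M, hM⟩ := small hU hV hw
  obtain ⟨p, hp, q, hq, h⟩ := Submodule.mem_sup.1 hM
  exact ⟨M, SP R _ X M c, p, hp, q, hq, by rw [map_add, SP_sbdry, ← h, add_assoc]⟩

lemma MVa {U V : Set X} (hU : IsOpen U) (hV : IsOpen V) {z u v : SChain R k X}
    {a b : SChain R (k + 1) X} (hu : u ∈ suppOn R k U) (hv : v ∈ suppOn R k V)
    (ha : z = sbdry R a + u) (hb : z = sbdry R b + v) (h : a - b ∈ relBd R (k + 1) (U ∪ V)) :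
    z ∈ relBd R k (U ∩ V) := by
  obtain ⟨M, c, p, hp, q, hq, hM⟩ := small_rel hU hV h
  have hz : z ∈ relCyc R k (U ∩ V) := by
    refine suppOn_inter ?_ ?_
    · rw [ha, map_add, sbdryN_sbdry, zero_add]; exact sbdryN_mem hu
    · rw [hb, map_add, sbdryN_sbdry, zero_add]; exact sbdryN_mem hv
  have h1 := SP_rel hz M
  rw [← sub_add_cancel z (SP R k X M z)]
  refine add_mem h1 ?_
  rw [← sub_add_cancel (SP R k X M z) (sbdry R (SP R _ X M a - p)), add_comm]
  refine add_mem (sbdry_relBd _ _) (supp_relBd (suppOn_inter ?_ ?_))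
  · have e : SP R k X M z - sbdry R (SP R _ X M a - p) = SP R k X M u + sbdry R p := by
      rw [ha, map_add, SP_sbdry, map_sub]; abel
    rw [e]; exact add_mem (SP_mem hu M) (sbdry_mem hp)
  · have e2 : SP R _ X M a - p = SP R _ X M b + sbdry R c + q := by
      rw [map_sub, sub_eq_iff_eq_add] at hM; rw [hM]; abel
    have e : SP R k X M z - sbdry R (SP R _ X M a - p) = SP R k X M v - sbdry R q := by
      rw [e2, hb, map_add, SP_sbdry, map_add, map_add, sbdry_sbdry]; abel
    rw [e]; exact sub_mem (SP_mem hv M) (sbdry_mem hq)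

lemma SP_sbdryN (z : SChain R k X) (M : ℕ) :
    SP R _ X M (sbdryN R k z) = sbdryN R k (SP R k X M z) := by
  cases k with
  | zero => simp [sbdryN]
  | succ k => exact SP_sbdry z M

lemma SP_relCyc {A : Set X} {z : SChain R k X} (hz : z ∈ relCyc R k A) (M : ℕ) :
    SP R k X M z ∈ relCyc R k A := by
  show sbdryN R k (SP R k X M z) ∈ suppOn R (k - 1) A
  rw [← SP_sbdryN]; exact SP_mem hz M

lemma MVb {U V : Set X} (hU : IsOpen U) (hV : IsOpen V) {α β : SChain R k X}
    (hα : α ∈ relCyc R k U) (hβ : β ∈ relCyc R k V) (h : α - β ∈ relBd R k (U ∪ V)) :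
    ∃ γ ∈ relCyc R k (U ∩ V), γ - α ∈ relBd R k U ∧ γ - β ∈ relBd R k V := by
  obtain ⟨M, c, p, hp, q, hq, hM⟩ := small_rel hU hV h
  have e2 : SP R _ X M α - p = SP R _ X M β + (sbdry R c + q) := by
    rw [map_sub, sub_eq_iff_eq_add] at hM; rw [hM]; abel
  have hc : sbdry R c + q ∈ relBd R k V := add_mem (sbdry_relBd _ _) (supp_relBd hq)
  refine ⟨SP R k X M α - p, suppOn_inter ?_ ?_, ?_, ?_⟩
  · exact sub_mem (SP_relCyc hα M) (relBd_le_relCyc U (supp_relBd hp))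
  · rw [e2]
    exact add_mem (SP_relCyc hβ M) (relBd_le_relCyc V hc)
  · have := neg_mem (add_mem (SP_rel hα M) (supp_relBd hp))
    convert this using 1; abel
  · rw [e2]
    have := add_mem (neg_mem (SP_rel hβ M)) hc
    convert this using 1; abel

lemma push_inj {f : C(X, Y)} (hf : Function.Injective f) :
    Function.Injective (push f : SChain R k X →ₗ[R] SChain R k Y) :=
  Finsupp.mapDomain_injective fun a b h => by
    ext x; exact hf (congrArg (· x) h)

lemma push_mem_iff {f : C(X, Y)} (hf : Function.Injective f) {B : Set Y} {z : SChain R k X} :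
    push f z ∈ suppOn R k B ↔ z ∈ suppOn R k (f ⁻¹' B) := by
  classical
  refine ⟨fun h => ?_, fun h => push_mem (fun x hx => hx) h⟩
  have hi : Function.Injective (fun σ : SingSimplex k X => f.comp σ) := fun a b h => by
    ext x; exact hf (congrArg (· x) h)
  rw [suppOn, Finsupp.mem_supported] at *
  rintro σ hσ _ ⟨x, rfl⟩
  have : f.comp σ ∈ (push f z : SChain R k Y).support := by
    rw [push, Finsupp.lmapDomain_apply, Finsupp.mapDomain_support_of_injective hi]
    exact Finset.mem_image_of_mem _ hσ
  exact h this ⟨x, rfl⟩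

lemma lift_chain {f : C(X, Y)} (hf : Topology.IsEmbedding f) {z : SChain R k Y}
    (hz : z ∈ suppOn R k (Set.range f)) : ∃ y : SChain R k X, push f y = z := by
  suffices z ∈ LinearMap.range (push f : SChain R k X →ₗ[R] SChain R k Y) from this
  rw [← Finsupp.sum_single z]
  refine Submodule.sum_mem _ fun σ hσ => ?_
  have hr := (Finsupp.mem_supported R z).1 hz hσ
  choose g hg using fun x => hr ⟨x, rfl⟩
  have hc : Continuous g := by
    rw [hf.continuous_iff]; convert σ.continuous using 1; funext x; exact hg x
  exact ⟨single ⟨g, hc⟩ (z σ), by rw [push_single]; congr 1; ext x; exact hg x⟩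

lemma exc_surj {f : C(Y, X)} (hf : Topology.IsOpenEmbedding f) {K : Set Y}
    (hK : IsClosed (f '' K)) {z : SChain R k X} (hz : z ∈ relCyc R k (f '' K)ᶜ) :
    ∃ y ∈ relCyc R k Kᶜ, z - push f y ∈ relBd R k (f '' K)ᶜ := by
  have hcov : z ∈ suppOn R k (Set.range f ∪ (f '' K)ᶜ) :=
    suppOn_mono (fun x _ => by
      by_cases h : x ∈ f '' K
      · exact Or.inl (Set.image_subset_range _ _ h)
      · exact Or.inr h) (mem_suppOn_univ z)
  obtain ⟨M, hM⟩ := small hf.isOpen_range hK.isOpen_compl hcov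
  obtain ⟨p, hp, q, hq, h⟩ := Submodule.mem_sup.1 hM
  obtain ⟨y, rfl⟩ := lift_chain hf.isEmbedding hp
  have e : push f y = SP R k X M z - q := by rw [← h]; abel
  refine ⟨y, ?_, ?_⟩
  · have : push f y ∈ relCyc R k (f '' K)ᶜ := by
      rw [e]; exact sub_mem (SP_relCyc hz M) (relBd_le_relCyc _ (supp_relBd hq))
    have h2 : sbdryN R k (push f y) ∈ suppOn R (k - 1) (f '' K)ᶜ := this
    rw [push_sbdryN, push_mem_iff hf.injective] at h2
    rwa [Set.preimage_compl, Set.preimage_image_eq _ hf.injective] at h2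
  · rw [e, ← sub_add]
    exact add_mem (SP_rel hz M) (supp_relBd hq)

lemma exc_inj {f : C(Y, X)} (hf : Topology.IsOpenEmbedding f) {K : Set Y}
    (hK : IsClosed (f '' K)) {y : SChain R k Y} (hy : y ∈ relCyc R k Kᶜ)
    (h : push f y ∈ relBd R k (f '' K)ᶜ) : y ∈ relBd R k Kᶜ := by
  obtain ⟨w, v, hv, e⟩ := mem_relBd.1 h
  have hcov : w ∈ suppOn R (k + 1) (Set.range f ∪ (f '' K)ᶜ) :=
    suppOn_mono (fun x _ => by
      by_cases h : x ∈ f '' K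
      · exact Or.inl (Set.image_subset_range _ _ h)
      · exact Or.inr h) (mem_suppOn_univ w)
  obtain ⟨M, hM⟩ := small hf.isOpen_range hK.isOpen_compl hcov
  obtain ⟨p, hp, q, hq, h⟩ := Submodule.mem_sup.1 hM
  obtain ⟨c, rfl⟩ := lift_chain hf.isEmbedding hp
  rw [← sub_add_cancel y (SP R k Y M y)]
  refine add_mem (SP_rel hy M) ?_
  rw [← sub_add_cancel (SP R k Y M y) (sbdry R c), add_comm]
  refine add_mem (sbdry_relBd _ _) (supp_relBd ?_)
  have : push f (SP R k Y M y - sbdry R c) ∈ suppOn R k (f '' K)ᶜ := by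
    have : push f (SP R k Y M y - sbdry R c) = SP R k X M v + sbdry R q := by
      rw [map_sub, ← SP_push, e, map_add, SP_sbdry, ← push_sbdry, ← h, map_add]; abel
    rw [this]; exact add_mem (SP_mem hv M) (sbdry_mem hq)
  rw [push_mem_iff hf.injective] at this
  rwa [Set.preimage_compl, Set.preimage_image_eq _ hf.injective] at this
end

section
variable {R : Type} [CommRing R] {X Y Z : Type} [TopologicalSpace X] [TopologicalSpace Y]
  [TopologicalSpace Z] {k m n i : ℕ}

def tt : C(TSimplex 1, ℝ) := ⟨fun x => x.1 1, (continuous_apply 1).comp continuous_subtype_val⟩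
lemma tt0 : tt (vertexPt 0) = 0 := by simp [tt, vertexPt]
lemma tt1 : tt (vertexPt 1) = 1 := by simp [tt, vertexPt]
lemma tt_nonneg (t) : 0 ≤ tt t := t.2.1 1
lemma tt_le (t) : tt t ≤ 1 := by
  have h := t.2.2; rw [Fin.sum_univ_two] at h
  have := t.2.1 0; show t.1 1 ≤ 1; linarith

/-- a homotopy given by a function of `(x,t) ∈ X × [0,1]` between two maps -/
lemma homot' (H : X → ℝ → Y) (hc : Continuous fun q : X × TSimplex 1 => H q.1 (tt q.2))
    {f g : C(X, Y)} (h0 : ∀ x, H x 0 = f x) (h1 : ∀ x, H x 1 = g x) {A : Set X} {B : Set Y}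
    (h : ∀ x ∈ A, ∀ t, 0 ≤ t → t ≤ 1 → H x t ∈ B) {z : SChain R k X} (hz : z ∈ relCyc R k A) :
    push g z - push f z ∈ relBd R k B := by
  have := homot (H := ⟨_, hc⟩) (A := A) (B := B) (fun x hx t => h x hx _ (tt_nonneg t) (tt_le t)) hz
  have e0 : at' ⟨_, hc⟩ (vertexPt 0) = f := by ext x; show H x (tt (vertexPt 0)) = _; rw [tt0, h0]
  have e1 : at' ⟨_, hc⟩ (vertexPt 1) = g := by ext x; show H x (tt (vertexPt 1)) = _; rw [tt1, h1]
  rwa [e0, e1] at this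

def Hz (i : ℕ) (A : Set X) : Prop := ∀ z ∈ relCyc ℤ i A, z ∈ relBd ℤ i A

structure Hg (i : ℕ) (A : Set X) (G : SChain ℤ i X) : Prop where
  cyc : G ∈ relCyc ℤ i A
  gen : ∀ z ∈ relCyc ℤ i A, ∃ k : ℤ, z - k • G ∈ relBd ℤ i A
  free : ∀ k : ℤ, k • G ∈ relBd ℤ i A → k = 0

/-- an equivalence in relative homology -/
structure HEq (A : Set X) (B : Set Y) (f : C(X, Y)) (g : C(Y, X)) : Prop where
  hf : ∀ x ∈ A, f x ∈ B
  hg : ∀ y ∈ B, g y ∈ A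
  gf : ∀ i, ∀ z ∈ relCyc ℤ i A, push (g.comp f) z - z ∈ relBd ℤ i A
  fg : ∀ i, ∀ z ∈ relCyc ℤ i B, push (f.comp g) z - z ∈ relBd ℤ i B

lemma HEq.Hz {A : Set X} {B : Set Y} {f : C(X, Y)} {g : C(Y, X)} (h : HEq A B f g)
    (hB : Hz i B) : Hz i A := by
  intro z hz
  have h1 := push_relBd h.hg (hB _ (push_relCyc h.hf hz))
  rw [push_push] at h1
  have := sub_mem h1 (h.gf i z hz)
  rwa [sub_sub_cancel] at this

lemma HEq.Hg {A : Set X} {B : Set Y} {f : C(X, Y)} {g : C(Y, X)} (h : HEq A B f g)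
    {G : SChain ℤ i X} (hG : Hg i A G) : Hg i B (push f G) := by
  refine ⟨push_relCyc h.hf hG.cyc, fun z hz => ?_, fun k hk => ?_⟩
  · obtain ⟨k, hk⟩ := hG.gen _ (push_relCyc h.hg hz)
    refine ⟨k, ?_⟩
    have h1 := push_relBd h.hf hk
    rw [map_sub, map_zsmul, push_push] at h1
    have := sub_mem h1 (h.fg i z hz)
    convert this using 1; abel
  · apply hG.free
    rw [← map_zsmul] at hk
    have h1 := push_relBd h.hg hk
    rw [push_push] at h1
    have := sub_mem h1 (h.gf i (k • G) (zsmul_mem hG.cyc k))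
    rwa [sub_sub_cancel] at this

lemma HEq.homeo (e : X ≃ₜ Y) {A : Set X} {B : Set Y} (h : ∀ x, x ∈ A ↔ e x ∈ B) :
    HEq A B (e : C(X, Y)) (e.symm : C(Y, X)) where
  hf x hx := (h x).1 hx
  hg y hy := (h _).2 (by simpa using hy)
  gf i z _ := by
    have : (e.symm : C(Y, X)).comp (e : C(X, Y)) = ContinuousMap.id X := by ext x; simp
    rw [this, push_id, sub_self]; exact zero_mem _
  fg i z _ := by
    have : (e : C(X, Y)).comp (e.symm : C(Y, X)) = ContinuousMap.id Y := by ext x; simp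
    rw [this, push_id, sub_self]; exact zero_mem _

lemma Hz_contract {A : Set X} (H : X → ℝ → X)
    (hc : Continuous fun q : X × TSimplex 1 => H q.1 (tt q.2)) (h0 : ∀ x, H x 0 = x)
    (h1 : ∀ x, H x 1 ∈ A) (h : ∀ x ∈ A, ∀ t, 0 ≤ t → t ≤ 1 → H x t ∈ A) : Hz i A := by
  intro z hz
  have hc1 : Continuous fun x => H x 1 := by
    have := hc.comp (Continuous.prodMk continuous_id (continuous_const (y := vertexPt 1)))
    simpa [Function.comp_def, tt1] using this
  have h2 := homot' (f := ContinuousMap.id X) (g := ⟨fun x => H x 1, hc1⟩) H hc h0 (fun _ => rfl) h hz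
  have h3 := sub_mem (supp_relBd (push_range (f := ⟨fun x => H x 1, hc1⟩) h1 z)) h2
  rwa [sub_sub_cancel, push_id] at h3

/-! connecting relation -/
def Conn (U V : Set X) (c : SChain ℤ i X) (w : SChain ℤ (i + 1) X) : Prop :=
  ∃ a b, ∃ u ∈ suppOn ℤ i U, ∃ v ∈ suppOn ℤ i V, c = sbdry ℤ a + u ∧ c = sbdry ℤ b + v ∧ w = a - b

lemma Conn.cyc {U V : Set X} {c : SChain ℤ i X} {w} (h : Conn U V c w) :
    w ∈ relCyc ℤ (i + 1) (U ∪ V) := by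
  obtain ⟨a, b, u, hu, v, hv, h1, h2, rfl⟩ := h
  show sbdry ℤ (a - b) ∈ suppOn ℤ i (U ∪ V)
  have : sbdry ℤ (a - b) = v - u := by
    rw [map_sub, eq_sub_of_add_eq h1.symm, eq_sub_of_add_eq h2.symm]; abel
  rw [this]
  exact sub_mem (suppOn_mono Set.subset_union_right hv) (suppOn_mono Set.subset_union_left hu)

lemma Conn.sub_smul {U V : Set X} {c c' : SChain ℤ i X} {w w'} (h : Conn U V c w)
    (h' : Conn U V c' w') (k l : ℤ) : Conn U V (k • c - l • c') (k • w - l • w') := by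
  obtain ⟨a, b, u, hu, v, hv, h1, h2, rfl⟩ := h
  obtain ⟨a', b', u', hu', v', hv', h1', h2', rfl⟩ := h'
  refine ⟨k • a - l • a', k • b - l • b', k • u - l • u', sub_mem (zsmul_mem hu k) (zsmul_mem hu' l),
    k • v - l • v', sub_mem (zsmul_mem hv k) (zsmul_mem hv' l), ?_, ?_, ?_⟩
  · rw [h1, h1', map_sub, map_zsmul, map_zsmul, smul_add, smul_add]; abel
  · rw [h2, h2', map_sub, map_zsmul, map_zsmul, smul_add, smul_add]; abel
  · rw [smul_sub, smul_sub]; abel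

lemma Conn.zero {U V : Set X} : Conn U V (0 : SChain ℤ i X) 0 :=
  ⟨0, 0, 0, zero_mem _, 0, zero_mem _, by simp, by simp, by simp⟩

lemma Conn.fwd {U V : Set X} (hU : IsOpen U) (hV : IsOpen V) {c : SChain ℤ i X} {w}
    (h : Conn U V c w) (hw : w ∈ relBd ℤ (i + 1) (U ∪ V)) : c ∈ relBd ℤ i (U ∩ V) := by
  obtain ⟨a, b, u, hu, v, hv, h1, h2, rfl⟩ := h
  exact MVa hU hV hu hv h1 h2 hw

lemma Conn.bwd {U V : Set X} (hU : Hz (i + 1) U) (hV : Hz (i + 1) V) {c : SChain ℤ i X} {w}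
    (h : Conn U V c w) (hc : c ∈ relBd ℤ i (U ∩ V)) : w ∈ relBd ℤ (i + 1) (U ∪ V) := by
  obtain ⟨a, b, u, hu, v, hv, h1, h2, rfl⟩ := h
  obtain ⟨e, f, hf, h3⟩ := mem_relBd.1 hc
  have ha : a - e ∈ relBd ℤ (i + 1) U := hU _ <| by
    show sbdry ℤ (a - e) ∈ suppOn ℤ i U
    have : sbdry ℤ (a - e) = f - u := by
      rw [map_sub, eq_sub_of_add_eq h1.symm, eq_sub_of_add_eq h3.symm]; abel
    rw [this]; exact sub_mem (suppOn_mono Set.inter_subset_left hf) hu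
  have hb : b - e ∈ relBd ℤ (i + 1) V := hV _ <| by
    show sbdry ℤ (b - e) ∈ suppOn ℤ i V
    have : sbdry ℤ (b - e) = f - v := by
      rw [map_sub, eq_sub_of_add_eq h2.symm, eq_sub_of_add_eq h3.symm]; abel
    rw [this]; exact sub_mem (suppOn_mono Set.inter_subset_right hf) hv
  have := sub_mem (relBd_mono Set.subset_union_left ha) (relBd_mono Set.subset_union_right hb)
  rwa [sub_sub_sub_cancel_right] at this

lemma Conn.exists {U V : Set X} (hU : Hz i U) (hV : Hz i V) {c : SChain ℤ i X}
    (hc : c ∈ relCyc ℤ i (U ∩ V)) : ∃ w, Conn U V c w := by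
  obtain ⟨a, u, hu, h1⟩ := mem_relBd.1 (hU c (relCyc_mono Set.inter_subset_left hc))
  obtain ⟨b, v, hv, h2⟩ := mem_relBd.1 (hV c (relCyc_mono Set.inter_subset_right hc))
  exact ⟨a - b, a, b, u, hu, v, hv, h1, h2, rfl⟩

lemma Conn.surj {U V : Set X} (hU : IsOpen U) (hV : IsOpen V) {z : SChain ℤ (i + 1) X}
    (hz : z ∈ relCyc ℤ (i + 1) (U ∪ V)) :
    ∃ c ∈ relCyc ℤ i (U ∩ V), ∃ w, Conn U V c w ∧ z - w ∈ relBd ℤ (i + 1) (U ∪ V) := by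
  obtain ⟨M, hM⟩ := small hU hV (show sbdry ℤ z ∈ suppOn ℤ i (U ∪ V) from hz)
  obtain ⟨p, hp, q, hq, h⟩ := Submodule.mem_sup.1 hM
  rw [SP_sbdry] at h
  have e : -p = q - sbdry ℤ (SP ℤ _ X M z) := by rw [← h]; abel
  refine ⟨-p, suppOn_inter ?_ ?_, SP ℤ _ X M z, ⟨0, -SP ℤ _ X M z, -p, neg_mem hp, q, hq,
    by simp, by rw [e, map_neg]; abel, by abel⟩, SP_rel hz M⟩
  · exact sbdryN_mem (neg_mem hp)
  · rw [e, map_sub, sbdryN_sbdry, sub_zero]; exact sbdryN_mem hq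

lemma Conn.Hz {U V : Set X} (hU : IsOpen U) (hV : IsOpen V) (hU' : Hz (i + 1) U)
    (hV' : SV.Hz (i + 1) V) (h : SV.Hz i (U ∩ V)) : SV.Hz (i + 1) (U ∪ V) := by
  intro z hz
  obtain ⟨c, hc, w, hw, hzw⟩ := Conn.surj hU hV hz
  have := add_mem hzw (hw.bwd hU' hV' (h c hc))
  rwa [sub_add_cancel] at this

lemma Conn.Hg {U V : Set X} (hU : IsOpen U) (hV : IsOpen V) (hU' : ∀ i, SV.Hz i U)
    (hV' : ∀ i, SV.Hz i V) {G : SChain ℤ i X} (h : Hg i (U ∩ V) G) :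
    ∃ G', SV.Hg (i + 1) (U ∪ V) G' := by
  obtain ⟨w, hw⟩ := Conn.exists (hU' i) (hV' i) h.cyc
  refine ⟨w, hw.cyc, fun z hz => ?_, fun k hk => ?_⟩
  · obtain ⟨c, hc, w', hw', hzw⟩ := Conn.surj hU hV hz
    obtain ⟨k, hk⟩ := h.gen c hc
    refine ⟨k, ?_⟩
    have h2 := (hw'.sub_smul hw 1 k).bwd (hU' _) (hV' _) (by simpa using hk)
    have := add_mem hzw h2
    convert this using 1; simp
  · have h2 := hw.sub_smul Conn.zero k 0
    have h3 := h2.fwd hU hV (by simpa using hk)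
    exact h.free k (by simpa using h3)

/-- local homology of a point is that of a Euclidean n-space -/
def LocH (n : ℕ) (y : Y) : Prop := (∃ G, Hg n ({y}ᶜ : Set Y) G) ∧ ∀ i, n < i → Hz i ({y}ᶜ : Set Y)

lemma LocH.susp [T1Space Y] {y : Y} (h : LocH n y) : LocH (n + 1) ((y, 0) : Y × ℝ) := by
  let U : Set (Y × ℝ) := {q | q.1 ≠ y ∨ 0 < q.2}
  let V : Set (Y × ℝ) := {q | q.1 ≠ y ∨ q.2 < 0}
  have hy : IsOpen {q : Y × ℝ | q.1 ≠ y} := isOpen_ne.preimage continuous_fst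
  have hU : IsOpen U := hy.union (isOpen_lt continuous_const continuous_snd)
  have hV : IsOpen V := hy.union (isOpen_lt continuous_snd continuous_const)
  have eU : U ∪ V = {(y, 0)}ᶜ := by
    ext ⟨a, t⟩
    simp only [U, V, Set.mem_union, Set.mem_setOf_eq, Set.mem_compl_iff, Set.mem_singleton_iff,
      Prod.mk.injEq]
    rcases lt_trichotomy t 0 with h | h | h
    · simp [h, h.ne]
    · simp [h]
    · simp [h, h.ne']
  have eI : U ∩ V = {q | q.1 ∈ ({y}ᶜ : Set Y)} := by
    ext ⟨a, t⟩
    simp only [U, V, Set.mem_inter_iff, Set.mem_setOf_eq, Set.mem_compl_iff, Set.mem_singleton_iff]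
    constructor
    · rintro ⟨h1 | h1, h2 | h2⟩ <;> first | assumption | exact absurd h1 h2.asymm
    · intro h; exact ⟨Or.inl h, Or.inl h⟩
  have hUz : ∀ i, Hz i U := fun i => by
    refine Hz_contract (fun q t => (q.1, (1 - t) * q.2 + t)) (by fun_prop) (by simp) (by simp [U]) ?_
    rintro ⟨a, s⟩ (h | h) t h0 h1
    · exact Or.inl h
    · right; show 0 < (1 - t) * s + t
      replace h : 0 < s := h
      rcases eq_or_lt_of_le h0 with rfl | h0
      · simpa
      · have : 0 ≤ (1 - t) * s := mul_nonneg (by linarith) h.le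
        linarith
  have hVz : ∀ i, Hz i V := fun i => by
    refine Hz_contract (fun q t => (q.1, (1 - t) * q.2 - t)) (by fun_prop) (by simp) (by simp [V]) ?_
    rintro ⟨a, s⟩ (h | h) t h0 h1
    · exact Or.inl h
    · right; show (1 - t) * s - t < 0
      replace h : s < 0 := h
      rcases eq_or_lt_of_le h0 with rfl | h0
      · simpa
      · have : 0 ≤ (1 - t) * (-s) := mul_nonneg (by linarith) (by linarith)
        linarith
  have he : HEq ({y}ᶜ : Set Y) {q : Y × ℝ | q.1 ∈ ({y}ᶜ : Set Y)}
      ⟨fun a => (a, 0), by fun_prop⟩ ⟨Prod.fst, continuous_fst⟩ :=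
    { hf := fun x hx => hx
      hg := fun x hx => hx
      gf := fun i z _ => by
        rw [show ContinuousMap.comp _ _ = ContinuousMap.id Y from rfl, push_id, sub_self]
        exact zero_mem _
      fg := fun i z hz => by
        have := homot' (A := {q : Y × ℝ | q.1 ∈ ({y}ᶜ : Set Y)})
          (B := {q : Y × ℝ | q.1 ∈ ({y}ᶜ : Set Y)}) (f := ContinuousMap.id _)
          (g := ContinuousMap.comp ⟨fun a => (a, 0), by fun_prop⟩ ⟨Prod.fst, continuous_fst⟩)
          (fun q t => (q.1, (1 - t) * q.2)) (by fun_prop) (by simp) (by simp)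
          (fun x hx t _ _ => hx) hz
        rwa [push_id] at this }
  have he' : HEq {q : Y × ℝ | q.1 ∈ ({y}ᶜ : Set Y)} ({y}ᶜ : Set Y)
       ⟨Prod.fst, continuous_fst⟩ ⟨fun a => (a, 0), by fun_prop⟩ := ⟨he.hg, he.hf, he.fg, he.gf⟩
  rw [LocH, ← eU]
  refine ⟨?_, fun i hi => ?_⟩
  · obtain ⟨G, hG⟩ := h.1
    exact Conn.Hg hU hV hUz hVz (by rw [eI]; exact he.Hg hG)
  · obtain ⟨j, rfl⟩ : ∃ j, i = j + 1 := ⟨i - 1, by omega⟩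
    exact Conn.Hz hU hV (hUz _) (hVz _) (by rw [eI]; exact he'.Hz (h.2 j (by omega)))

lemma LocH.homeo (e : X ≃ₜ Y) {x : X} (h : LocH n x) : LocH n (e x) := by
  have h1 : ∀ x', x' ∈ ({x}ᶜ : Set X) ↔ e x' ∈ ({e x}ᶜ : Set Y) := by simp
  have h2 : ∀ y', y' ∈ ({e x}ᶜ : Set Y) ↔ e.symm y' ∈ ({x}ᶜ : Set X) := by
    intro y'; simp [Equiv.symm_apply_eq, Homeomorph.symm_apply_eq]
  obtain ⟨G, hG⟩ := h.1
  exact ⟨⟨_, (HEq.homeo e h1).Hg hG⟩, fun i hi => (HEq.homeo e.symm h2).Hz (h.2 i hi)⟩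

abbrev E (n : ℕ) : Type := Fin n → ℝ

lemma sbdry_subsingleton [Subsingleton X] (σ : SingSimplex (k + 1) X) (τ : SingSimplex k X) :
    sbdry ℤ (single σ 1) = if Even k then 0 else single τ 1 := by
  have : ∀ i, σ.comp (faceMap i) = τ := fun i => by ext x; exact Subsingleton.elim _ _
  rw [sbdry_single]
  simp only [this, ← Finset.sum_smul]
  rw [Fin.sum_neg_one_pow]
  simp [Nat.even_add]

lemma LocH_zero : LocH 0 (0 : E 0) := by
  have hs : ({0}ᶜ : Set (E 0)) = ∅ := by ext x; simp [Subsingleton.elim x 0]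
  let s : ∀ i, SingSimplex i (E 0) := fun i => ContinuousMap.const _ 0
  have hu : ∀ i (z : SChain ℤ i (E 0)), ∃ r : ℤ, z = r • single (s i) 1 := fun i z => by
    refine ⟨z (s i), Finsupp.ext fun τ => ?_⟩
    have : τ = s i := ContinuousMap.ext fun x => Subsingleton.elim _ _
    simp [this]
  have h0 : ∀ i (z : SChain ℤ i (E 0)), z ∈ suppOn ℤ i (∅ : Set (E 0)) → z = 0 := by
    intro i z hz
    ext τ
    by_contra h
    exact (Finsupp.mem_supported ℤ z).1 hz (Finsupp.mem_support_iff.2 h) ⟨center i, rfl⟩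
  rw [LocH, hs]
  refine ⟨⟨single (s 0) 1, (suppOn ℤ 0 (∅ : Set (E 0))).zero_mem, fun z _ => ?_, fun k hk => ?_⟩, fun i hi z hz => ?_⟩
  · obtain ⟨r, rfl⟩ := hu _ z
    exact ⟨r, by rw [sub_self]; exact zero_mem _⟩
  · obtain ⟨w, u, hu', h⟩ := mem_relBd.1 hk
    obtain ⟨r, rfl⟩ := hu _ w
    rw [h0 _ u hu', map_zsmul, sbdry_subsingleton _ (s 0)] at h
    have := congrArg (· (s 0)) h
    simpa using this
  · obtain ⟨r, rfl⟩ := hu _ z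
    obtain ⟨j, rfl⟩ : ∃ j, i = j + 1 := ⟨i - 1, by omega⟩
    have h1 := h0 _ _ (show sbdry ℤ (r • single (s (j + 1)) 1) ∈ _ from hz)
    by_cases hj : Even j
    · refine zsmul_mem ?_ r
      have := sbdry_subsingleton (k := j + 1) (s _) (s (j + 1))
      rw [if_neg (by simpa [Nat.even_add_one] using hj)] at this
      rw [← this]; exact sbdry_relBd _ _
    · rw [map_zsmul, sbdry_subsingleton _ (s j), if_neg hj] at h1
      have : r = 0 := by simpa using congrArg (· (s j)) h1
      rw [this, zero_smul]; exact zero_mem _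

lemma LocH_E : ∀ n, LocH n (0 : E n)
  | 0 => LocH_zero
  | n + 1 => by
    let e : E n × ℝ ≃ₜ E (n + 1) :=
      { toFun := fun q => Fin.cons q.2 q.1
        invFun := fun v => (Fin.tail v, v 0)
        left_inv := fun q => by simp
        right_inv := fun v => by simp
        continuous_toFun := by
          refine continuous_pi fun j => ?_
          refine Fin.cases ?_ (fun j => ?_) j
          · simpa using continuous_snd
          · simp only [Fin.cons_succ]; fun_prop
        continuous_invFun := by
          refine Continuous.prodMk (continuous_pi fun j => ?_) (continuous_apply 0)
          exact continuous_apply _ }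
    have := (LocH_E n).susp.homeo e
    convert this using 1
    funext j
    refine Fin.cases ?_ (fun j => ?_) j <;> simp [e]

end

section
open Topology
variable {R : Type} [CommRing R] {X Y Z N : Type} [TopologicalSpace X] [TopologicalSpace Y]
  [TopologicalSpace Z] [TopologicalSpace N] {k m n i : ℕ}

lemma cpt_supp {A : Set X} {z : SChain R k X} (hz : z ∈ suppOn R k A) :
    ∃ C, IsCompact C ∧ C ⊆ A ∧ z ∈ suppOn R k C := by
  refine ⟨⋃ σ ∈ z.support, Set.range σ, ?_, ?_, ?_⟩
  · exact z.support.finite_toSet.isCompact_biUnion fun σ _ => isCompact_range σ.continuous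
  · exact Set.iUnion₂_subset fun σ hσ => (Finsupp.mem_supported R z).1 hz hσ
  · exact (Finsupp.mem_supported R z).2 fun σ hσ => Set.subset_biUnion_of_mem (u := fun σ : SingSimplex k X => Set.range ⇑σ) hσ

lemma nhd_supp [T2Space X] {x : X} {z : SChain R k X} (hz : z ∈ suppOn R k {x}ᶜ) :
    ∃ W, IsOpen W ∧ x ∈ W ∧ z ∈ suppOn R k Wᶜ := by
  obtain ⟨C, hC, hCx, h⟩ := cpt_supp hz
  exact ⟨Cᶜ, hC.isClosed.isOpen_compl, fun h => hCx h rfl, by rwa [compl_compl]⟩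

def Gn (n : ℕ) : SChain ℤ n (E n) := (LocH_E n).1.choose
lemma Gn_spec (n : ℕ) : Hg n ({0}ᶜ : Set (E n)) (Gn n) := (LocH_E n).1.choose_spec

lemma loc_Hg [T1Space X] [T1Space Y] {f : C(Y, X)} (hf : IsOpenEmbedding f) {y : Y} {g : SChain ℤ i Y}
    (h : Hg i ({y}ᶜ : Set Y) g) : Hg i ({f y}ᶜ : Set X) (push f g) := by
  have e : f '' {y} = {f y} := Set.image_singleton
  have hc : IsClosed (f '' {y}) := by rw [e]; exact isClosed_singleton
  have hm : ∀ x ∈ ({y}ᶜ : Set Y), f x ∈ ({f y}ᶜ : Set X) := fun x hx h => hx (hf.injective h)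
  refine ⟨push_relCyc hm h.cyc, fun z hz => ?_, fun k hk => ?_⟩
  · obtain ⟨a, ha, h1⟩ := exc_surj hf hc (z := z) (by rwa [e])
    obtain ⟨k, hk⟩ := h.gen a ha
    refine ⟨k, ?_⟩
    have h2 := push_relBd hm hk
    rw [e] at h1
    have := add_mem h1 h2
    rwa [map_sub, map_zsmul, sub_add_sub_cancel] at this
  · refine h.free k (exc_inj hf hc (zsmul_mem h.cyc k) ?_)
    rwa [e, map_zsmul]

lemma loc_Hz [T1Space X] [T1Space Y] {f : C(Y, X)} (hf : IsOpenEmbedding f) {y : Y}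
    (h : Hz i ({y}ᶜ : Set Y)) : Hz i ({f y}ᶜ : Set X) := by
  have e : f '' {y} = {f y} := Set.image_singleton
  have hc : IsClosed (f '' {y}) := by rw [e]; exact isClosed_singleton
  have hm : ∀ x ∈ ({y}ᶜ : Set Y), f x ∈ ({f y}ᶜ : Set X) := fun x hx h => hx (hf.injective h)
  intro z hz
  obtain ⟨a, ha, h1⟩ := exc_surj hf hc (z := z) (by rwa [e])
  rw [e] at h1
  have := add_mem h1 (push_relBd hm (h a ha))
  rwa [sub_add_cancel] at this

structure Man (n : ℕ) (N : Type) [TopologicalSpace N] : Prop where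
  t2 : T2Space N
  chart : ∀ x : N, ∃ φ : C(E n, N), IsOpenEmbedding φ ∧ φ 0 = x

namespace Man
def Φ (h : Man n N) (x : N) : C(E n, N) := (h.chart x).choose
lemma emb (h : Man n N) (x : N) : IsOpenEmbedding (h.Φ x) := (h.chart x).choose_spec.1
lemma Φ0 (h : Man n N) (x : N) : h.Φ x 0 = x := (h.chart x).choose_spec.2
end Man

/-! ### the vanishing theorem -/
def Q (i : ℕ) (K : Set N) : Prop :=
  ∀ z ∈ relCyc ℤ i Kᶜ, (∀ x ∈ K, z ∈ relBd ℤ i {x}ᶜ) → z ∈ relBd ℤ i Kᶜ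

lemma Q_union {K L : Set N} (hK : IsClosed K) (hL : IsClosed L)
    (hp : ∀ x : N, Hz (i + 1) ({x}ᶜ : Set N)) (h1 : Q i K) (h2 : Q i L) (h3 : Q (i + 1) (K ∩ L)) :
    Q i (K ∪ L) := by
  intro z hz hx
  have hKL : (K ∪ L)ᶜ = Kᶜ ∩ Lᶜ := Set.compl_union _ _
  rw [hKL] at hz ⊢
  obtain ⟨a, u, hu, ha⟩ := mem_relBd.1 (h1 z (relCyc_mono Set.inter_subset_left hz)
    fun x h => hx x (Or.inl h))
  obtain ⟨b, v, hv, hb⟩ := mem_relBd.1 (h2 z (relCyc_mono Set.inter_subset_right hz)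
    fun x h => hx x (Or.inr h))
  refine MVa hK.isOpen_compl hL.isOpen_compl hu hv ha hb ?_
  have hc : a - b ∈ relCyc ℤ (i + 1) (Kᶜ ∪ Lᶜ) := Conn.cyc ⟨a, b, u, hu, v, hv, ha, hb, rfl⟩
  rw [← Set.compl_inter] at hc ⊢
  refine h3 _ hc fun x hx => hp x _ (relCyc_mono ?_ hc)
  exact Set.compl_subset_compl.2 (Set.singleton_subset_iff.2 hx)

lemma Q_fin {P : Set N → Prop} (hp : ∀ i > n, ∀ x : N, Hz i ({x}ᶜ : Set N))
    (hcl : ∀ K, P K → IsClosed K) (hin : ∀ K L, P K → P L → P (K ∩ L))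
    (hQ : ∀ K, P K → ∀ i ≥ n, Q i K) {ι : Type*} (s : Finset ι) :
    ∀ f : ι → Set N, (∀ a, P (f a)) → ∀ i ≥ n, Q i (⋃ a ∈ s, f a) := by
  classical
  induction s using Finset.induction_on with
  | empty =>
    intro f _ i _ z hz _
    simp only [Finset.notMem_empty, Set.iUnion_of_empty, Set.iUnion_empty, Set.compl_empty]
    exact supp_relBd (mem_suppOn_univ z)
  | insert a s ha ih =>
    intro f hf i hi
    rw [Finset.set_biUnion_insert]
    refine Q_union (hcl _ (hf a)) (isClosed_biUnion_finset fun b _ => hcl _ (hf b))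
      (hp _ (by omega)) (hQ _ (hf a) i hi) (ih f hf i hi) ?_
    rw [Set.inter_iUnion₂]
    exact ih (fun b => f a ∩ f b) (fun b => hin _ _ (hf a) (hf b)) _ (by omega)

lemma pt_vanish (h : Man n N) (i : ℕ) (hi : n < i) (x : N) : Hz i ({x}ᶜ : Set N) := by
  have := h.t2
  rw [← h.Φ0 x]
  exact loc_Hz (h.emb x) ((LocH_E n).2 i hi)

lemma Man_E (n : ℕ) : Man n (E n) where
  t2 := inferInstance
  chart x := ⟨⟨fun v => v + x, by fun_prop⟩, (Homeomorph.addRight x).isOpenEmbedding, by simp⟩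

lemma star_lem {K : Set (E n)} {p : E n} (hK : Bornology.IsBounded K) (hs : StarConvex ℝ p K)
    {z : SChain ℤ i (E n)} (hz : z ∈ relCyc ℤ i Kᶜ) (h : z ∈ relBd ℤ i {p}ᶜ) :
    z ∈ relBd ℤ i Kᶜ := by
  obtain ⟨w, u, hu, e⟩ := mem_relBd.1 h
  obtain ⟨W, hW, hpW, hu⟩ := nhd_supp hu
  obtain ⟨r, hr, hball⟩ := Metric.isOpen_iff.1 hW p hpW
  obtain ⟨ρ, hρ⟩ := hK.subset_ball p
  let T : ℝ := max 1 (ρ / r)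
  have hT1 : 1 ≤ T := le_max_left _ _
  let g : C(E n, E n) := ⟨fun x => p + T • (x - p), by fun_prop⟩
  have key : ∀ c : ℝ, 1 ≤ c → ∀ x, x ∉ K → p + c • (x - p) ∉ K := by
    intro c hc x hx hm
    apply hx
    have := hs hm (a := 1 - c⁻¹) (b := c⁻¹) (by simpa using inv_le_one_of_one_le₀ hc) (by positivity)
      (by ring)
    convert this using 1
    rw [smul_add, smul_smul, inv_mul_cancel₀ (by positivity), sub_smul, one_smul, one_smul]; abel
  have h1 := homot' (A := Kᶜ) (B := Kᶜ) (f := ContinuousMap.id _) (g := g)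
    (fun x t => p + (1 + t * (T - 1)) • (x - p)) (by fun_prop) (by simp) (by simp [g])
    (fun x hx t h0 _ => key _ (by nlinarith) x hx) hz
  have h2 : push g z ∈ relBd ℤ i Kᶜ := by
    rw [e, map_add, ← push_sbdry]
    refine add_mem (sbdry_relBd _ _) (supp_relBd (push_mem (A := Wᶜ) (B := Kᶜ) (fun x hx hm => hx (hball ?_)) hu))
    have h3 := hρ hm
    rw [Metric.mem_ball, dist_eq_norm] at h3 ⊢
    have h4 : ‖g x - p‖ = T * ‖x - p‖ := by
      simp only [g, ContinuousMap.coe_mk, add_sub_cancel_left, norm_smul, Real.norm_eq_abs,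
        abs_of_pos (by linarith : 0 < T)]
    rw [h4] at h3
    have h5 : ρ ≤ T * r := by
      have := le_max_right 1 (ρ / r); rw [div_le_iff₀ hr] at this; exact this
    exact lt_of_mul_lt_mul_left (h3.trans_le h5) (by linarith)
  have := sub_mem h2 h1
  rwa [sub_sub_cancel, push_id] at this

lemma Q_convex {K : Set (E n)} (hK : IsCompact K) (hc : Convex ℝ K) (i : ℕ) : Q i K := by
  intro z hz h
  rcases K.eq_empty_or_nonempty with rfl | ⟨p, hp⟩
  · rw [Set.compl_empty]; exact supp_relBd (mem_suppOn_univ z)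
  · exact star_lem hK.isBounded (hc.starConvex hp) hz (h p hp)

lemma Q_E {K : Set (E n)} (hK : IsCompact K) (i : ℕ) (hi : n ≤ i) : Q i K := by
  intro z hz h
  obtain ⟨C, hC, hCK, hzC⟩ := cpt_supp (show sbdryN ℤ i z ∈ suppOn ℤ (i - 1) Kᶜ from hz)
  have hd : Disjoint K C := Set.disjoint_left.2 fun x hx hx' => hCK hx' hx
  obtain ⟨δ, hδ, hd⟩ := hd.exists_cthickenings hK hC.isClosed
  have hball : ∀ x ∈ K, Metric.closedBall x δ ⊆ Cᶜ := fun x hx y hy hyC =>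
    Set.disjoint_left.1 hd (Metric.closedBall_subset_cthickening hx δ hy)
      (Metric.self_subset_cthickening _ hyC)
  obtain ⟨t, htK, hcov⟩ := hK.elim_finite_subcover_image (b := K) (c := fun x => Metric.ball x δ)
    (fun x _ => Metric.isOpen_ball) (fun x hx => Set.mem_biUnion hx (Metric.mem_ball_self hδ))
  obtain ⟨htf, hcov⟩ := hcov
  have hQ := Q_fin (P := fun L : Set (E n) => IsCompact L ∧ Convex ℝ L) (n := n)
    (fun i hi x => pt_vanish (Man_E n) i hi x) (fun K h => h.1.isClosed)
    (fun K L h h' => ⟨h.1.inter h'.1, h.2.inter h'.2⟩) (fun K h i _ => Q_convex h.1 h.2 i)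
    htf.toFinset (fun x => Metric.closedBall x δ)
    (fun x => ⟨isCompact_closedBall x δ, convex_closedBall x δ⟩) i hi
  have hKL : K ⊆ ⋃ a ∈ htf.toFinset, Metric.closedBall a δ := fun x hx => by
    obtain ⟨a, ha, hxa⟩ := Set.mem_iUnion₂.1 (hcov hx)
    exact Set.mem_iUnion₂.2 ⟨a, by simpa using ha, Metric.ball_subset_closedBall hxa⟩
  refine relBd_mono (Set.compl_subset_compl.2 hKL) (hQ z ?_ ?_)
  · refine suppOn_mono ?_ hzC
    rw [Set.subset_compl_comm]
    exact Set.iUnion₂_subset fun a ha => hball a (htK (by simpa using ha))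
  · intro x hx
    obtain ⟨a, ha, hxa⟩ := Set.mem_iUnion₂.1 hx
    have haK := htK (show a ∈ t by simpa using ha)
    have h1 : z ∈ relCyc ℤ i (Metric.closedBall a δ)ᶜ := by
      refine suppOn_mono ?_ hzC
      rw [Set.subset_compl_comm]; exact hball a haK
    refine relBd_mono (Set.compl_subset_compl.2 (Set.singleton_subset_iff.2 hxa)) (star_lem
      Metric.isBounded_closedBall ((convex_closedBall a δ).starConvex
        (Metric.mem_closedBall_self hδ.le)) h1 (h a haK))

lemma Q_chart [T2Space N] {φ : C(E n, N)} (hφ : IsOpenEmbedding φ) {K : Set N} (hK : IsCompact K)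
    (hr : K ⊆ Set.range φ) (i : ℕ) (hi : n ≤ i) : Q i K := by
  intro z hz h
  have hK' : IsCompact (φ ⁻¹' K) := hφ.isInducing.isCompact_preimage' hK hr
  have e : φ '' (φ ⁻¹' K) = K := Set.image_preimage_eq_of_subset hr
  have hm : ∀ x ∈ (φ ⁻¹' K)ᶜ, φ x ∈ Kᶜ := fun x hx => hx
  obtain ⟨y, hy, h1⟩ := exc_surj hφ (K := φ ⁻¹' K) (z := z) (by rw [e]; exact hK.isClosed) (by rwa [e])
  rw [e] at h1
  have h2 : y ∈ relBd ℤ i (φ ⁻¹' K)ᶜ := by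
    refine Q_E hK' i hi y hy fun x hx => ?_
    have e' : φ '' {x} = {φ x} := Set.image_singleton
    refine exc_inj hφ (by rw [e']; exact isClosed_singleton)
      (relCyc_mono (Set.compl_subset_compl.2 (Set.singleton_subset_iff.2 hx)) hy) ?_
    rw [e']
    have := sub_mem (h (φ x) hx)
      (relBd_mono (Set.compl_subset_compl.2 (Set.singleton_subset_iff.2 (show φ x ∈ K from hx))) h1)
    rwa [sub_sub_cancel] at this
  have := add_mem h1 (push_relBd hm h2)
  rwa [sub_add_cancel] at this

lemma cpt_cover [T2Space N] {K : Set N} (hK : IsCompact K) (U : N → Set N) (hU : ∀ x, IsOpen (U x))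
    (hx : ∀ x ∈ K, x ∈ U x) : ∃ (t : Finset N) (f : N → Set N), (∀ x, IsCompact (f x)) ∧
      (∀ x, f x ⊆ U x) ∧ (∀ x ∈ t, x ∈ K) ∧ K = ⋃ x ∈ t, f x := by
  obtain ⟨t, htK, htf, hcov⟩ := hK.elim_finite_subcover_image (b := K) (c := U)
    (fun x _ => hU x) (fun x hx' => Set.mem_biUnion hx' (hx x hx'))
  obtain ⟨f, h1, h2, h3⟩ := hK.finite_compact_cover htf.toFinset U (fun x _ => hU x)
    (by simpa using hcov)
  exact ⟨htf.toFinset, f, h1, h2, fun x hx => htK (by simpa using hx), h3⟩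

theorem Q_man (h : Man n N) {K : Set N} (hK : IsCompact K) (i : ℕ) (hi : n ≤ i) : Q i K := by
  have := h.t2
  obtain ⟨t, f, h1, h2, _, rfl⟩ := cpt_cover hK (fun x => Set.range (h.Φ x))
    (fun x => (h.emb x).isOpen_range) (fun x _ => ⟨0, h.Φ0 x⟩)
  exact Q_fin (P := fun L : Set N => IsCompact L ∧ ∃ x, L ⊆ Set.range (h.Φ x)) (n := n)
    (fun i hi x => pt_vanish h i hi x) (fun K h => h.1.isClosed)
    (fun K L h h' => ⟨h.1.inter h'.1, h.2.imp fun x hx => Set.inter_subset_left.trans hx⟩)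
    (fun K hK i hi => Q_chart (h.emb hK.2.choose) hK.1 hK.2.choose_spec i hi)
    t f (fun x => ⟨h1 x, x, h2 x⟩) i hi

end

section
open Topology
variable {X Y N : Type} [TopologicalSpace X] [TopologicalSpace Y]
  [TopologicalSpace N] {k m n i : ℕ}

lemma Hg.congr {A : Set X} {G G' : SChain ℤ i X} (h : Hg i A G) (e : G' - G ∈ relBd ℤ i A) :
    Hg i A G' := by
  refine ⟨?_, fun z hz => ?_, fun k hk => h.free k ?_⟩
  · have := add_mem (relBd_le_relCyc _ e) h.cyc
    rwa [sub_add_cancel] at this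
  · obtain ⟨k, hk⟩ := h.gen z hz
    refine ⟨k, ?_⟩
    have := sub_mem hk (zsmul_mem e k)
    rw [smul_sub] at this
    convert this using 1; abel
  · have := sub_mem hk (zsmul_mem e k)
    rw [smul_sub] at this
    convert this using 1; abel

lemma pt_mono {x : X} {K : Set X} (h : x ∈ K) : Kᶜ ⊆ ({x}ᶜ : Set X) :=
  Set.compl_subset_compl.2 (Set.singleton_subset_iff.2 h)

lemma bd_nhd [T2Space X] {x : X} {z : SChain ℤ i X} (h : z ∈ relBd ℤ i {x}ᶜ) :
    ∃ W, IsOpen W ∧ x ∈ W ∧ z ∈ relBd ℤ i Wᶜ := by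
  obtain ⟨w, u, hu, rfl⟩ := mem_relBd.1 h
  obtain ⟨W, h1, h2, h3⟩ := nhd_supp hu
  exact ⟨W, h1, h2, mem_relBd.2 ⟨w, u, h3, rfl⟩⟩

lemma cyc_nhd [T2Space X] {x : X} {z : SChain ℤ i X} (h : z ∈ relCyc ℤ i {x}ᶜ) :
    ∃ W, IsOpen W ∧ x ∈ W ∧ z ∈ relCyc ℤ i Wᶜ := by
  obtain ⟨W, h1, h2, h3⟩ := nhd_supp (show sbdryN ℤ i z ∈ suppOn ℤ (i - 1) {x}ᶜ from h)
  exact ⟨W, h1, h2, h3⟩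

lemma LG_E (n : ℕ) : ∃ W : Set (E n), IsOpen W ∧ 0 ∈ W ∧ ∀ x ∈ W, Hg n ({x}ᶜ : Set (E n)) (Gn n) := by
  obtain ⟨W, h1, h2, h3⟩ := cyc_nhd (Gn_spec n).cyc
  obtain ⟨r, hr, hb⟩ := Metric.isOpen_iff.1 h1 0 h2
  refine ⟨Metric.ball 0 r, Metric.isOpen_ball, Metric.mem_ball_self hr, fun e he => ?_⟩
  let τ : C(E n, E n) := ⟨fun v => v + e, by fun_prop⟩
  have ht : IsOpenEmbedding τ := (Homeomorph.addRight e).isOpenEmbedding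
  have hg := loc_Hg ht (Gn_spec n)
  have e0 : τ 0 = e := by simp [τ]
  rw [e0] at hg
  refine hg.congr ?_
  rw [← neg_mem_iff, neg_sub]
  have := homot' (A := (Metric.ball (0 : E n) r)ᶜ) (B := {e}ᶜ) (f := ContinuousMap.id _) (g := τ)
    (fun x t => x + t • e) (by fun_prop) (by simp) (by simp [τ]) ?_
    (relCyc_mono (Set.compl_subset_compl.2 hb) h3)
  · rwa [push_id] at this
  · intro x hx t h0 ht h
    apply hx
    have h' : x + t • e = e := h
    have : x = (1 - t) • e := by rw [sub_smul, one_smul, eq_sub_iff_add_eq]; exact h'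
    rw [this, mem_ball_zero_iff, norm_smul, Real.norm_eq_abs, abs_of_nonneg (by linarith)]
    rw [mem_ball_zero_iff] at he
    nlinarith [norm_nonneg e]

lemma LG [T2Space N] {φ : C(E n, N)} (hφ : IsOpenEmbedding φ) : ∃ W : Set N, IsOpen W ∧ φ 0 ∈ W ∧
    W ⊆ Set.range φ ∧ push φ (Gn n) ∈ relCyc ℤ n Wᶜ ∧ ∀ x ∈ W, Hg n ({x}ᶜ : Set N) (push φ (Gn n)) := by
  obtain ⟨W, h1, h2, h3⟩ := LG_E n
  obtain ⟨W', h1', h2', h3'⟩ := cyc_nhd (loc_Hg hφ (Gn_spec n)).cyc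
  refine ⟨φ '' W ∩ W', (hφ.isOpenMap _ h1).inter h1', ⟨⟨0, h2, rfl⟩, h2'⟩, ?_, ?_, ?_⟩
  · rintro _ ⟨⟨x, _, rfl⟩, _⟩; exact ⟨x, rfl⟩
  · exact relCyc_mono (Set.compl_subset_compl.2 Set.inter_subset_right) h3'
  · rintro _ ⟨⟨x, hx, rfl⟩, _⟩; exact loc_Hg hφ (h3 x hx)

theorem EZ0 (hN : Man n N) {K : Set N} (hK : IsCompact K) (hc : IsPreconnected K) {z : SChain ℤ n N}
    (hz : z ∈ relCyc ℤ n Kᶜ) {q : N} (hq : q ∈ K) (h : z ∈ relBd ℤ n {q}ᶜ) : z ∈ relBd ℤ n Kᶜ := by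
  have := hN.t2
  refine Q_man hN hK n le_rfl z hz ?_
  let u : Set N := {x | z ∈ relBd ℤ n {x}ᶜ}
  let v : Set N := ⋃₀ {W | IsOpen W ∧ ∀ x ∈ W, z ∉ relBd ℤ n {x}ᶜ}
  have hu : IsOpen u := isOpen_iff_forall_mem_open.2 fun x hx => by
    obtain ⟨W, h1, h2, h3⟩ := bd_nhd hx
    exact ⟨W, fun y hy => relBd_mono (pt_mono hy) h3, h1, h2⟩
  have hv : IsOpen v := isOpen_sUnion fun W h => h.1
  refine hc.subset_left_of_subset_union hu hv ?_ ?_ ⟨q, hq, h⟩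
  · refine Set.disjoint_left.2 ?_
    rintro x hx ⟨W, hW, hxW⟩
    exact hW.2 x hxW hx
  · intro x hx
    by_cases hxu : z ∈ relBd ℤ n {x}ᶜ
    · exact Or.inl hxu
    right
    obtain ⟨W, hW, hxW, -, -, hg⟩ := LG (hN.emb x)
    rw [hN.Φ0] at hxW
    obtain ⟨m, hm⟩ := (hg x hxW).gen z (relCyc_mono (pt_mono hx) hz)
    obtain ⟨W', hW', hxW', hm'⟩ := bd_nhd hm
    refine ⟨W ∩ W', ⟨hW.inter hW', fun y hy hzy => ?_⟩, hxW, hxW'⟩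
    have h1 := sub_mem hzy (relBd_mono (pt_mono hy.2) hm')
    rw [sub_sub_cancel] at h1
    rw [(hg y hy.1).free m h1, zero_smul, sub_zero] at hm
    exact hxu hm

theorem sec_exists (hN : Man n N) {K : Set N} (hK : IsCompact K) (α : N → SChain ℤ n N)
    (h : ∀ x ∈ K, ∃ W, IsOpen W ∧ x ∈ W ∧ ∃ g ∈ relCyc ℤ n Wᶜ, ∀ y ∈ W, y ∈ K →
      g - α y ∈ relBd ℤ n {y}ᶜ) :
    ∃ z ∈ relCyc ℤ n Kᶜ, ∀ x ∈ K, z - α x ∈ relBd ℤ n {x}ᶜ := by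
  classical
  have := hN.t2
  have h' : ∀ x, ∃ W, IsOpen W ∧ (x ∈ K → x ∈ W ∧ ∃ g ∈ relCyc ℤ n Wᶜ, ∀ y ∈ W, y ∈ K →
      g - α y ∈ relBd ℤ n {y}ᶜ) := fun x => by
    by_cases hx : x ∈ K
    · obtain ⟨W, h1, h2⟩ := h x hx; exact ⟨W, h1, fun _ => h2⟩
    · exact ⟨∅, isOpen_empty, fun h => absurd h hx⟩
  choose U hU hU' using h'
  obtain ⟨t, f, hf, hfU, htK, hcov⟩ := cpt_cover hK U hU (fun x hx => (hU' x hx).1)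
  have hfK : ∀ x ∈ t, f x ⊆ K := fun x hx => by
    rw [hcov]; exact Set.subset_biUnion_of_mem (u := fun x => f x) hx
  have key : ∀ s ⊆ t, ∃ z ∈ relCyc ℤ n (⋃ x ∈ s, f x)ᶜ, ∀ x ∈ ⋃ x ∈ s, f x,
      z - α x ∈ relBd ℤ n {x}ᶜ := by
    intro s
    induction s using Finset.induction_on with
    | empty => intro _; exact ⟨0, zero_mem _, by simp⟩
    | insert a s ha ih =>
      intro hs
      obtain ⟨z, hz, hz'⟩ := ih fun x hx => hs (Finset.mem_insert_of_mem hx)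
      have hat : a ∈ t := hs (Finset.mem_insert_self _ _)
      obtain ⟨-, g, hg, hg'⟩ := hU' a (htK a hat)
      rw [Finset.set_biUnion_insert]
      set L := ⋃ x ∈ s, f x with hL
      have hLc : IsCompact L := s.isCompact_biUnion fun x _ => hf x
      have hgf : g ∈ relCyc ℤ n (f a)ᶜ := relCyc_mono (Set.compl_subset_compl.2 (hfU a)) hg
      have hga : ∀ x ∈ f a, g - α x ∈ relBd ℤ n {x}ᶜ := fun x hx => hg' x (hfU a hx) (hfK a hat hx)
      have hQ : g - z ∈ relBd ℤ n ((f a)ᶜ ∪ Lᶜ) := by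
        rw [← Set.compl_inter]
        refine Q_man hN ((hf a).inter hLc) n le_rfl _ (sub_mem
          (relCyc_mono (Set.compl_subset_compl.2 Set.inter_subset_left) hgf)
          (relCyc_mono (Set.compl_subset_compl.2 Set.inter_subset_right) hz)) fun x hx => ?_
        have := sub_mem (hga x hx.1) (hz' x hx.2)
        rwa [sub_sub_sub_cancel_right] at this
      obtain ⟨c, hc, h1, h2⟩ := MVb (hf a).isClosed.isOpen_compl hLc.isClosed.isOpen_compl hgf hz hQ
      rw [← Set.compl_union] at hc
      refine ⟨c, hc, ?_⟩
      rintro x (hx | hx)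
      · have := add_mem (relBd_mono (pt_mono hx) h1) (hga x hx)
        rwa [sub_add_sub_cancel] at this
      · have := add_mem (relBd_mono (pt_mono hx) h2) (hz' x hx)
        rwa [sub_add_sub_cancel] at this
  rw [hcov]
  exact key t subset_rfl

/-- `H_i(X, A; ℤ)` embeds in `ℤ`. -/
def EZ (i : ℕ) (A : Set X) : Prop :=
  ∃ D : relCyc ℤ i A →+ ℤ, ∀ z : relCyc ℤ i A, D z = 0 ↔ (z : SChain ℤ i X) ∈ relBd ℤ i A

lemma Hg.hom {A : Set X} {G : SChain ℤ i X} (h : Hg i A G) :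
    ∃ D : relCyc ℤ i A →+ ℤ, ∀ z : relCyc ℤ i A, (z : SChain ℤ i X) - D z • G ∈ relBd ℤ i A := by
  choose D hD using fun z : relCyc ℤ i A => h.gen z z.2
  refine ⟨AddMonoidHom.mk' D fun a b => ?_, hD⟩
  rw [← sub_eq_zero]
  apply h.free
  have := sub_mem (add_mem (hD a) (hD b)) (hD (a + b))
  convert this using 1
  simp only [Submodule.coe_add, sub_smul, add_smul]; abel

lemma EZ.of_map {A : Set X} {B : Set Y} {G : SChain ℤ n Y} (h : Hg n B G)
    (J : SChain ℤ i X →ₗ[ℤ] SChain ℤ n Y) (h1 : ∀ z ∈ relCyc ℤ i A, J z ∈ relCyc ℤ n B)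
    (h2 : ∀ z ∈ relCyc ℤ i A, J z ∈ relBd ℤ n B → z ∈ relBd ℤ i A)
    (h3 : ∀ z ∈ relBd ℤ i A, J z ∈ relBd ℤ n B) : EZ i A := by
  obtain ⟨D, hD⟩ := h.hom
  refine ⟨D.comp (J.restrict h1).toAddMonoidHom, fun z => ⟨fun hz => h2 _ z.2 ?_, fun hz => ?_⟩⟩
  · have := hD (J.restrict h1 z)
    have e : D (J.restrict h1 z) = 0 := hz
    rw [e, zero_smul, sub_zero] at this
    exact this
  · apply h.free
    have := sub_mem (h3 _ hz) (hD (J.restrict h1 z))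
    convert this using 1
    exact (sub_sub_cancel _ _).symm

variable {A : Set X}

lemma EZ.cyclic (h : EZ i A) : ∃ c : SChain ℤ i X, IsFundCycle i A c := by
  obtain ⟨D, hD⟩ := h
  obtain ⟨a, ha⟩ := Int.subgroup_cyclic D.range
  obtain ⟨c, hc⟩ : a ∈ D.range := by rw [ha]; exact AddSubgroup.subset_closure rfl
  refine ⟨c, c.2, fun z hz => ?_⟩
  have : D ⟨z, hz⟩ ∈ D.range := ⟨_, rfl⟩
  rw [ha, AddSubgroup.mem_closure_singleton] at this
  obtain ⟨k, hk⟩ := this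
  refine ⟨k, relHom_iff.2 ?_⟩
  refine (hD (⟨z, hz⟩ - k • c)).1 ?_
  rw [map_sub, map_zsmul, hc, hk, sub_self]

lemma EZ.orientable (h : EZ i A) {z : SChain ℤ i X} (hz : z ∈ relCyc ℤ i A) (hz' : z ∉ relBd ℤ i A) :
    HomOrientable i X A := by
  obtain ⟨c, hc⟩ := h.cyclic
  refine ⟨c, hc, fun h0 => hz' ?_⟩
  rw [relHom_iff, sub_zero] at h0
  obtain ⟨k, hk⟩ := hc.2 z hz
  have := add_mem (relHom_iff.1 hk) (zsmul_mem h0 k)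
  rwa [sub_add_cancel] at this

lemma EZ.tf (h : EZ i A) {z : SChain ℤ i X} (hz : z ∈ relCyc ℤ i A) {k : ℤ} (hk : k ≠ 0)
    (h0 : k • z ∈ relBd ℤ i A) : z ∈ relBd ℤ i A := by
  obtain ⟨D, hD⟩ := h
  refine (hD ⟨z, hz⟩).1 ?_
  have := (hD (k • ⟨z, hz⟩)).2 h0
  rw [map_zsmul, smul_eq_mul] at this
  exact (mul_eq_zero.1 this).resolve_left hk

end

section
open Topology
variable {R : Type} [CommRing R] {X Y B : Type} [TopologicalSpace X] [TopologicalSpace Y]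
  [TopologicalSpace B] {k m n i : ℕ} {A P D : Set X} {β : C(B, X)}

instance TS_conn (k : ℕ) : PreconnectedSpace (TSimplex k) := by
  refine Subtype.preconnectedSpace (Convex.isPreconnected ?_)
  rintro x ⟨hx, hx'⟩ y ⟨hy, hy'⟩ a b ha hb hab
  refine ⟨fun i => add_nonneg (mul_nonneg ha (hx i)) (mul_nonneg hb (hy i)), ?_⟩
  simp only [Pi.add_apply, Pi.smul_apply, smul_eq_mul, Finset.sum_add_distrib, ← Finset.mul_sum, hx',
    hy', mul_one, hab]

instance TS_ne (k : ℕ) : Nonempty (TSimplex k) := ⟨vertexPt 0⟩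

lemma suppOn_empty {z : SChain R k X} (h : z ∈ suppOn R k (∅ : Set X)) : z = 0 := by
  rw [suppOn, Finsupp.mem_supported] at h
  rw [← Finsupp.support_eq_empty, Finset.eq_empty_iff_forall_notMem]
  intro σ hσ
  exact h hσ ⟨vertexPt 0, rfl⟩

lemma relCyc_empty {z : SChain R k X} : z ∈ relCyc R k (∅ : Set X) ↔ sbdryN R k z = 0 :=
  ⟨fun h => suppOn_empty h, fun h => by
    show sbdryN R k z ∈ suppOn R (k - 1) (∅ : Set X); rw [h]; exact zero_mem _⟩

lemma relBd_empty {z : SChain R k X} : z ∈ relBd R k (∅ : Set X) ↔ ∃ w, z = sbdry R w := by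
  rw [mem_relBd]
  refine ⟨?_, fun ⟨w, h⟩ => ⟨w, 0, zero_mem _, by rw [h, add_zero]⟩⟩
  rintro ⟨w, u, hu, rfl⟩
  exact ⟨w, by rw [suppOn_empty hu, add_zero]⟩

open Classical in
def pull (R : Type) [CommRing R] (β : C(B, X)) : SChain R k X →ₗ[R] SChain R k B :=
  lc fun σ => if h : ∃ τ : SingSimplex k B, β.comp τ = σ then single h.choose 1 else 0

lemma pull_push (hβ : Function.Injective β) (w : SChain R k B) : pull R β (push β w) = w := by
  refine lcongr (f := pull R β ∘ₗ push β) (g := LinearMap.id) w fun τ => ?_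
  have h : ∃ τ' : SingSimplex k B, β.comp τ' = β.comp τ := ⟨τ, rfl⟩
  rw [LinearMap.comp_apply, push_single, pull, lc_single, dif_pos h, LinearMap.id_apply]
  congr 1
  ext x; exact hβ (congrArg (· x) h.choose_spec)

lemma push_pull (hβ : IsEmbedding β) {z : SChain R k X} (hz : z ∈ suppOn R k (Set.range β)) :
    push β (pull R β z) = z := by
  obtain ⟨y, rfl⟩ := lift_chain hβ hz
  rw [pull_push hβ.injective]

lemma pull_zero {z : SChain R k X} (hz : z ∈ suppOn R k (Set.range β)ᶜ) : pull R β z = 0 := by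
  refine suppOn_empty ?_
  refine lc_mem (A := (Set.range β)ᶜ) (fun σ hσ => ?_) hz
  rw [dif_neg]
  · exact zero_mem _
  · rintro ⟨τ, rfl⟩
    exact hσ (vertexPt 0) ⟨_, rfl⟩

def Piece (P A : Set X) : Prop := ∀ S, IsPreconnected S → S ⊆ A → S ⊆ P ∨ S ⊆ A \ P

lemma Piece.split (h : Piece P A) {z : SChain R k X} (hz : z ∈ suppOn R k A) :
    ∃ u ∈ suppOn R k P, ∃ v ∈ suppOn R k (A \ P), z = u + v := by
  have : z ∈ suppOn R k P ⊔ suppOn R k (A \ P) := by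
    rw [suppOn, suppOn, ← Finsupp.supported_union]
    rw [suppOn, Finsupp.mem_supported] at hz
    exact (Finsupp.mem_supported R z).2 fun σ hσ => h _ (isPreconnected_range σ.continuous) (hz hσ)
  obtain ⟨u, hu, v, hv, e⟩ := Submodule.mem_sup.1 this
  exact ⟨u, hu, v, hv, e.symm⟩

lemma diff_compl : A \ P ⊆ Pᶜ := fun _ h => h.2

lemma pull_split (hβ : IsEmbedding β) (h : Piece (Set.range β) A) {z : SChain R k X}
    (hz : z ∈ suppOn R k A) :
    ∃ v ∈ suppOn R k (A \ Set.range β), z = push β (pull R β z) + v := by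
  obtain ⟨u, hu, v, hv, e⟩ := h.split hz
  refine ⟨v, hv, ?_⟩
  rw [e, map_add, pull_zero (suppOn_mono diff_compl hv), add_zero, push_pull hβ hu]

lemma pull_sbdry (hβ : IsEmbedding β) (h : Piece (Set.range β) A) {z : SChain R (k + 1) X}
    (hz : z ∈ suppOn R (k + 1) A) : pull R β (sbdry R z) = sbdry R (pull R β z) := by
  obtain ⟨v, hv, e⟩ := pull_split hβ h hz
  have : sbdry R z = push β (sbdry R (pull R β z)) + sbdry R v := by
    rw [← push_sbdry, ← map_add, ← e]
  rw [this, map_add, pull_push hβ.injective, pull_zero (sbdry_mem (suppOn_mono diff_compl hv)), add_zero]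

lemma pull_sbdryN (hβ : IsEmbedding β) (h : Piece (Set.range β) A) {z : SChain R k X}
    (hz : z ∈ suppOn R k A) : pull R β (sbdryN R k z) = sbdryN R k (pull R β z) := by
  cases k with
  | zero => simp [sbdryN]
  | succ k => exact pull_sbdry hβ h hz

lemma Piece.of_closed (h1 : IsClosed P) (h2 : IsClosed (A \ P)) : Piece P A := by
  intro S hS hSA
  by_cases hP : (S ∩ P).Nonempty
  · by_cases hP' : (S ∩ (A \ P)).Nonempty
    · obtain ⟨x, _, hx, hx'⟩ := isPreconnected_closed_iff.1 hS P (A \ P) h1 h2 (fun x hx => by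
        by_cases h : x ∈ P
        · exact Or.inl h
        · exact Or.inr ⟨hSA hx, h⟩) hP hP'
      exact absurd hx hx'.2
    · left; intro x hx
      by_contra h
      exact hP' ⟨x, hx, hSA hx, h⟩
  · right; exact fun x hx => ⟨hSA hx, fun h => hP ⟨x, hx, h⟩⟩

lemma Piece.of_open (h1 : IsOpen P) (h2 : IsOpen D) (h : A ⊆ P ∪ D) (hd : ∀ x ∈ P, x ∉ D) :
    Piece P A := by
  intro S hS hSA
  by_cases hP : (S ∩ P).Nonempty
  · left
    exact hS.subset_left_of_subset_union h1 h2 (Set.disjoint_left.2 hd) (hSA.trans h) hP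
  · right; exact fun x hx => ⟨hSA hx, fun h => hP ⟨x, hx, h⟩⟩

/-! ### the external collar -/
def Coll (A : Set X) : Type := {q : X × ℝ // 0 ≤ q.2 ∧ (q.2 = 0 ∨ q.1 ∈ A)}
instance (A : Set X) : TopologicalSpace (Coll A) := instTopologicalSpaceSubtype

namespace Coll
def h : C(Coll A, ℝ) := ⟨fun q => q.1.2, continuous_snd.comp continuous_subtype_val⟩
def ret : C(Coll A, X) := ⟨fun q => q.1.1, continuous_fst.comp continuous_subtype_val⟩
def ι : C(X, Coll A) := ⟨fun x => ⟨(x, 0), le_rfl, Or.inl rfl⟩, by fun_prop⟩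
def incA : C(A, X) := ⟨Subtype.val, continuous_subtype_val⟩
def Hc : C(A × TSimplex 1, Coll A) :=
  ⟨fun q => ⟨(q.1, 2 * tt q.2), mul_nonneg zero_le_two (tt_nonneg _), Or.inr q.1.2⟩, by fun_prop⟩

lemma ret_Hc (q) : ret (Hc (A := A) q) = q.1 := rfl
lemma h_Hc (q) : h (Hc (A := A) q) = 2 * tt q.2 := rfl
lemma mem_of_h {q : Coll A} (hq : h q ≠ 0) : ret q ∈ A := q.2.2.resolve_left hq
lemma ext {p q : Coll A} (h1 : ret p = ret q) (h2 : h p = h q) : p = q := Subtype.ext (Prod.ext h1 h2)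
lemma inc_emb : IsEmbedding (incA (A := A)) := IsEmbedding.subtypeVal
lemma inc_range : Set.range (incA (A := A)) = A := Subtype.range_val
lemma h_nonneg (q : Coll A) : 0 ≤ h q := q.2.1

def top : C(A, Coll A) := at' Hc (vertexPt 1)
def bot : C(A, Coll A) := at' Hc (vertexPt 0)
lemma h_top (a : A) : h (top a) = 2 := by show 2 * tt (vertexPt 1) = 2; rw [tt1, mul_one]
lemma h_bot (a : A) : h (bot a) = 0 := by show 2 * tt (vertexPt 0) = 0; rw [tt0, mul_zero]
lemma ret_top (a : A) : ret (top a) = a := rfl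
lemma bot_eq : bot (A := A) = ι.comp incA := by
  ext1 a; exact ext rfl (h_bot a)

def cyl : SChain R k A →ₗ[R] SChain R (k + 1) (Coll A) := Pop Hc

lemma d_cyl (a : SChain R (k + 1) A) :
    sbdry R (cyl a) = push top a - push bot a - cyl (sbdry R a) := Pop_formula Hc a
lemma d_cyl0 {a : SChain R k A} (ha : sbdryN R k a = 0) :
    sbdry R (cyl a) = push top a - push bot a := by
  have := Pop_formula Hc a
  rw [ha, map_zero, sub_zero] at this; exact this

lemma cyl_mem {S : Set A} {T : Set (Coll A)} (h : ∀ x ∈ S, ∀ t, Hc (x, t) ∈ T) {a : SChain R k A}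
    (ha : a ∈ suppOn R k S) : cyl a ∈ suppOn R (k + 1) T := hop_mem _ h ha

def J : SChain R (k + 1) X →ₗ[R] SChain R (k + 1) (Coll A) :=
  push ι + cyl ∘ₗ pull R incA ∘ₗ sbdry R

lemma J_apply (z : SChain R (k + 1) X) :
    J (A := A) z = push ι z + cyl (pull R incA (sbdry R z)) := rfl

lemma d_J {z : SChain R (k + 1) X} (hz : z ∈ relCyc R (k + 1) A) :
    sbdry R (J (A := A) z) = push top (pull R incA (sbdry R z)) := by
  have h1 : push incA (pull R (incA (A := A)) (sbdry R z)) = sbdry R z :=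
    push_pull inc_emb (by rw [inc_range]; exact hz)
  have h2 : sbdryN R k (pull R (incA (A := A)) (sbdry R z)) = 0 := by
    apply push_inj (f := incA (A := A)) inc_emb.injective
    rw [← push_sbdryN, h1, sbdryN_sbdry, map_zero]
  rw [J_apply, map_add, d_cyl0 h2, push_sbdry, bot_eq, ← push_push, h1]
  abel

def K1 : Set (Coll A) := {q | h q ≤ 1}

lemma J_cyc {z : SChain R (k + 1) X} (hz : z ∈ relCyc R (k + 1) A) :
    J z ∈ relCyc R (k + 1) (K1 (A := A))ᶜ := by
  show sbdry R (J z) ∈ suppOn R k _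
  rw [d_J hz]
  refine push_range (fun a (ha : h (top a) ≤ 1) => ?_) _
  rw [h_top] at ha; norm_num at ha

lemma J_inj {z : SChain R (k + 1) X} (hz : J z ∈ relBd R (k + 1) (K1 (A := A))ᶜ) :
    z ∈ relBd R (k + 1) A := by
  have h1 := push_relBd (f := ret) (B := A) (fun q (hq : ¬ h q ≤ 1) => mem_of_h fun h0 => hq
    (by rw [h0]; exact zero_le_one)) hz
  rw [J_apply, map_add, push_push] at h1
  have h2 : push ret (cyl (pull R incA (sbdry R z))) ∈ suppOn R (k + 1) A :=
    push_mem (A := ret ⁻¹' A) (fun x hx => hx)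
      (cyl_mem (S := Set.univ) (fun x _ t => x.2) (mem_suppOn_univ _))
  have := sub_mem h1 (supp_relBd h2)
  rw [add_sub_cancel_right] at this
  rwa [show ret.comp ι = ContinuousMap.id X from rfl, push_id] at this

lemma J_bd {z : SChain R (k + 1) X} (hz : z ∈ relBd R (k + 1) A) :
    J z ∈ relBd R (k + 1) (K1 (A := A))ᶜ := by
  obtain ⟨w, u, hu, rfl⟩ := mem_relBd.1 hz
  obtain ⟨v, rfl⟩ := lift_chain (inc_emb (A := A)) (by rwa [inc_range])
  have e : J (sbdry R w + push incA v) = sbdry R (push ι w - cyl v) + push top v := by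
    rw [J_apply, map_add, map_add, sbdry_sbdry, zero_add, push_sbdry, pull_push inc_emb.injective,
      map_sub, d_cyl, push_sbdry, bot_eq, ← push_push]
    abel
  rw [e]
  refine add_mem (sbdry_relBd _ _) (supp_relBd (push_range (fun a (ha : h (top a) ≤ 1) => ?_) _))
  rw [h_top] at ha; norm_num at ha

end Coll

structure Pair (n : ℕ) (A : Set X) : Prop where
  cpt : CompactSpace X
  t2 : T2Space X
  cl : IsClosed A
  man : Man n (Coll A)

open Coll

lemma Coll.emb (hA : IsClosed A) : IsClosedEmbedding (Subtype.val : Coll A → X × ℝ) := by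
  refine IsClosed.isClosedEmbedding_subtypeVal ?_
  exact (isClosed_le continuous_const continuous_snd).inter
    ((isClosed_eq continuous_snd continuous_const).union (hA.preimage continuous_fst))

lemma Coll.cpt [CompactSpace X] (hA : IsClosed A) {K : Set (Coll A)} (hK : IsClosed K) (r : ℝ)
    (h : ∀ q ∈ K, Coll.h q ≤ r) : IsCompact K := by
  have h1 : IsCompact ((Set.univ : Set X) ×ˢ Set.Icc (0 : ℝ) r) := isCompact_univ.prod isCompact_Icc
  exact ((Coll.emb hA).isCompact_preimage h1).of_isClosed_subset hK
    fun q hq => ⟨trivial, h_nonneg q, h q hq⟩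

lemma K1_cpt (hA : Pair n A) : IsCompact (K1 (A := A)) := by
  have := hA.cpt
  exact Coll.cpt hA.cl (isClosed_le (ContinuousMap.continuous _) continuous_const) 1 fun q hq => hq

lemma K1_conn [PreconnectedSpace X] : IsPreconnected (K1 (A := A)) := by
  rcases isEmpty_or_nonempty X with hX | ⟨⟨x0⟩⟩
  · have : K1 (A := A) = ∅ := by ext q; exact (hX.false (ret q)).elim
    rw [this]; exact isPreconnected_empty
  refine isPreconnected_of_forall (ι x0) fun y hy => ?_
  let f : ℝ → Coll A := fun s => ⟨(ret y, |s| * h y), mul_nonneg (abs_nonneg _) (h_nonneg y), by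
    rcases y.2.2 with h | h
    · left; show |s| * Coll.h y = 0; rw [show Coll.h y = 0 from h, mul_zero]
    · exact Or.inr h⟩
  have hf : Continuous f := by
    refine Continuous.subtype_mk (continuous_const.prodMk (continuous_abs.mul continuous_const)) _
  refine ⟨Set.range ι ∪ f '' Set.Icc 0 1, ?_, Or.inl ⟨x0, rfl⟩, Or.inr ⟨1, by simp, ?_⟩, ?_⟩
  · rintro _ (⟨x, rfl⟩ | ⟨s, hs, rfl⟩)
    · exact zero_le_one (α := ℝ)
    · show |s| * h y ≤ 1
      rw [abs_of_nonneg hs.1]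
      exact mul_le_one₀ hs.2 (h_nonneg y) hy
  · exact Coll.ext rfl (by show |1| * h y = h y; simp)
  · refine IsPreconnected.union (ι (ret y)) ⟨_, rfl⟩ ⟨0, by simp, ?_⟩
      (isPreconnected_range (ContinuousMap.continuous _)) (isPreconnected_Icc.image f hf.continuousOn)
    exact Coll.ext rfl (by show |0| * h y = 0; simp)

lemma pt_Hg (hN : Man n X) (q : X) : ∃ G, Hg n ({q}ᶜ : Set X) G := by
  have := hN.t2
  have h := loc_Hg (hN.emb q) (Gn_spec n)
  rw [hN.Φ0] at h; exact ⟨_, h⟩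

theorem EZ_pair (hA : Pair (k + 1) A) [PreconnectedSpace X] [Nonempty X] : EZ (k + 1) A := by
  let q : Coll A := ι (Classical.arbitrary X)
  have hq : q ∈ K1 (A := A) := zero_le_one (α := ℝ)
  obtain ⟨G, hG⟩ := pt_Hg hA.man q
  exact EZ.of_map hG J (fun z hz => relCyc_mono (pt_mono hq) (J_cyc hz))
    (fun z hz h => J_inj (EZ0 hA.man (K1_cpt hA) K1_conn (J_cyc hz) hq h))
    (fun z hz => relBd_mono (pt_mono hq) (J_bd hz))

/-- a clopen piece of `A` -/
structure Pc (A : Set X) (β : C(B, X)) : Prop where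
  emb : IsEmbedding β
  sub : ∀ b, β b ∈ A
  cl : IsClosed (Set.range β)
  cl' : IsClosed (A \ Set.range β)

lemma Pc.piece (h : Pc A β) : Piece (Set.range β) A := .of_closed h.cl h.cl'

def Pc.lift (h : Pc A β) : C(B, A) := ⟨fun b => ⟨β b, h.sub b⟩, by fun_prop⟩
lemma Pc.incA_lift (h : Pc A β) : incA.comp h.lift = β := rfl

theorem nonvanish (hA : Pair (k + 1) A) [PreconnectedSpace X] (hβ : Pc A β) [Nonempty B]
    {z : SChain ℤ (k + 1) X} (hz : z ∈ relCyc ℤ (k + 1) A) (hz' : z ∉ relBd ℤ (k + 1) A) :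
    pull ℤ β (sbdry ℤ z) ∉ relBd ℤ k (∅ : Set B) := by
  intro h
  obtain ⟨w, hw⟩ := relBd_empty.1 h
  let b := Classical.arbitrary B
  let q : Coll A := ⟨(β b, 1), zero_le_one, Or.inr (hβ.sub b)⟩
  have hq : q ∈ K1 (A := A) := le_refl (1 : ℝ)
  refine hz' (J_inj (EZ0 hA.man (K1_cpt hA) K1_conn (J_cyc hz) hq ?_))
  have hq0 : ∀ y : Coll A, Coll.h y ≠ 1 → y ∈ ({q}ᶜ : Set (Coll A)) := by
    rintro y hy rfl; exact hy rfl
  obtain ⟨v, hv, e⟩ := pull_split hβ.emb hβ.piece (z := sbdry ℤ z) hz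
  have e2 : pull ℤ incA (sbdry ℤ z) = sbdry ℤ (push hβ.lift w) + pull ℤ (incA (A := A)) v := by
    have e' : push β (sbdry ℤ w) = push incA (push hβ.lift (sbdry ℤ w)) := by
      rw [push_push, hβ.incA_lift]
    rw [e, map_add, hw, e', pull_push inc_emb.injective, push_sbdry]
  have hv' : pull ℤ incA v ∈ suppOn ℤ k ((incA (A := A)) ⁻¹' (A \ Set.range β)) := by
    rw [← push_mem_iff inc_emb.injective, push_pull inc_emb]
    · exact hv
    · rw [inc_range]; exact suppOn_mono Set.diff_subset hv
  have e3 : J (A := A) z = push ι z + (push top (push hβ.lift w) - push bot (push hβ.lift w) -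
      sbdry ℤ (cyl (push hβ.lift w))) + cyl (pull ℤ incA v) := by
    rw [J_apply, e2, map_add, d_cyl]; abel
  rw [e3]
  refine add_mem (add_mem (supp_relBd (push_range (fun x => hq0 _ ?_) _)) (sub_mem (sub_mem
    (supp_relBd (push_range (fun x => hq0 _ ?_) _)) (supp_relBd (push_range (fun x => hq0 _ ?_) _)))
    (sbdry_relBd _ _))) (supp_relBd (cyl_mem ?_ hv'))
  · exact zero_ne_one
  · rw [h_top]; norm_num
  · rw [h_bot]; norm_num
  · intro x hx t he
    apply hx.2
    have : Hc (x, t) = q := he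
    exact ⟨b, by rw [← show ret q = β b from rfl, ← this]; rfl⟩

theorem EZ_piece (hA : Pair (k + 1) A) (hβ : Pc A β) [Nonempty B] [PreconnectedSpace B] :
    EZ k (∅ : Set B) := by
  have hX := hA.cpt
  have hBc : CompactSpace B := by
    rw [← isCompact_univ_iff, hβ.emb.isCompact_iff, Set.image_univ]; exact hβ.cl.isCompact
  let f : C(B, Coll A) := ⟨fun b => ⟨(β b, 1), zero_le_one, Or.inr (hβ.sub b)⟩, by fun_prop⟩
  let K : Set (Coll A) := Set.range f
  have hK : IsCompact K := isCompact_range f.continuous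
  have hKc : IsPreconnected K := isPreconnected_range f.continuous
  have hK1 : ∀ y : Coll A, Coll.h y ≠ 1 → y ∈ Kᶜ := by
    rintro _ hy ⟨b, rfl⟩; exact hy rfl
  have ht : ∀ a : A, top a ∈ Kᶜ := fun a => hK1 _ (by rw [h_top]; norm_num)
  have hb : ∀ a : A, bot a ∈ Kᶜ := fun a => hK1 _ (by rw [h_bot]; norm_num)
  let q := f (Classical.arbitrary B)
  have hq : q ∈ K := ⟨_, rfl⟩
  let L : SChain ℤ k B →ₗ[ℤ] SChain ℤ (k + 1) (Coll A) := cyl ∘ₗ push hβ.lift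
  have dL : ∀ z ∈ relCyc ℤ k (∅ : Set B), sbdry ℤ (L z) = push top (push hβ.lift z) -
      push bot (push hβ.lift z) := fun z hz => d_cyl0 (by
    rw [push_sbdryN, relCyc_empty.1 hz, map_zero])
  have hL : ∀ z ∈ relCyc ℤ k (∅ : Set B), L z ∈ relCyc ℤ (k + 1) Kᶜ := fun z hz => by
    show sbdry ℤ (L z) ∈ suppOn ℤ k _
    rw [dL z hz]
    exact sub_mem (push_range ht _) (push_range hb _)
  obtain ⟨G, hG⟩ := pt_Hg hA.man q
  refine EZ.of_map hG L (fun z hz => relCyc_mono (pt_mono hq) (hL z hz)) (fun z hz h => ?_)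
    (fun z hz => ?_)
  · obtain ⟨w, u, hu, e⟩ := mem_relBd.1 (EZ0 hA.man hK hKc (hL z hz) hq h)
    let O : Set (Coll A) := {y | 1 < Coll.h y ∧ ret y ∈ Set.range β}
    have hO : O = {y | 1 < Coll.h y ∧ ret y ∉ A \ Set.range β} := by
      ext y
      refine ⟨fun h => ⟨h.1, fun h' => h'.2 h.2⟩, fun h => ⟨h.1, ?_⟩⟩
      by_contra h'
      exact h.2 ⟨mem_of_h (by have := h.1; intro h0; rw [h0] at this; linarith), h'⟩
    have hOo : IsOpen O := by
      rw [hO]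
      exact (isOpen_lt continuous_const (ContinuousMap.continuous Coll.h)).inter
        (hβ.cl'.isOpen_compl.preimage (ContinuousMap.continuous ret))
    let j : C(O, Coll A) := ⟨Subtype.val, continuous_subtype_val⟩
    have hj : IsEmbedding j := IsEmbedding.subtypeVal
    have hjr : Set.range j = O := Subtype.range_val
    have hp : Piece (Set.range j) Kᶜ := by
      rw [hjr]
      refine Piece.of_open (D := {y | Coll.h y < 1} ∪ {y | ret y ∉ Set.range β}) hOo
        ((isOpen_lt (ContinuousMap.continuous Coll.h) continuous_const).union
          (hβ.cl.isOpen_compl.preimage (ContinuousMap.continuous ret))) ?_ ?_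
      · intro y hy
        by_cases h1 : ret y ∈ Set.range β
        · rcases lt_trichotomy (Coll.h y) 1 with h2 | h2 | h2
          · exact Or.inr (Or.inl h2)
          · obtain ⟨b, hb⟩ := h1
            exact absurd ⟨b, Coll.ext hb h2.symm⟩ hy
          · exact Or.inl ⟨h2, h1⟩
        · exact Or.inr (Or.inr h1)
      · rintro y ⟨h1, h2⟩ (h3 | h3)
        · exact lt_asymm h1 h3
        · exact h3 h2
    let g : C(B, O) := ⟨fun b => ⟨top (hβ.lift b), by rw [h_top]; norm_num, ⟨b, rfl⟩⟩, by fun_prop⟩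
    let r : C(O, B) := ⟨fun y => hβ.emb.toHomeomorph.symm ⟨ret y.1, y.2.2⟩, by
      refine hβ.emb.toHomeomorph.symm.continuous.comp (Continuous.subtype_mk ?_ _)
      exact (ContinuousMap.continuous ret).comp continuous_subtype_val⟩
    have hrg : r.comp g = ContinuousMap.id B := by
      ext1 b
      exact hβ.emb.toHomeomorph.symm_apply_eq.2 rfl
    have e1 : sbdry ℤ (L z) = sbdry ℤ u := by rw [e, map_add, sbdry_sbdry, zero_add]
    rw [dL z hz] at e1
    have e2 := congrArg (pull ℤ j) e1
    rw [pull_sbdry hj hp hu, map_sub, pull_zero (z := push bot _) (push_range (fun a => ?_) _), sub_zero,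
      push_push, show top.comp hβ.lift = j.comp g from rfl, ← push_push, pull_push hj.injective] at e2
    · have e3 := congrArg (push r) e2
      rw [push_push, hrg, push_id, ← push_sbdry] at e3
      exact relBd_empty.2 ⟨_, e3⟩
    · rw [hjr]
      intro h
      have := h.1
      rw [h_bot] at this; norm_num at this
  · obtain ⟨w, rfl⟩ := relBd_empty.1 hz
    have : L (sbdry ℤ w) = push top (push hβ.lift w) - push bot (push hβ.lift w) -
        sbdry ℤ (cyl (push hβ.lift w)) := by
      rw [d_cyl, push_sbdry]; simp only [L, LinearMap.comp_apply]; abel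
    rw [this]
    exact sub_mem (sub_mem (supp_relBd (push_range (fun x => pt_mono hq (ht _)) _))
      (supp_relBd (push_range (fun x => pt_mono hq (hb _)) _))) (sbdry_relBd _ _)

end

/-! coverings -/
section
open Topology
variable {X Y N N' B : Type} [TopologicalSpace X] [TopologicalSpace Y]
  [TopologicalSpace N] [TopologicalSpace N'] [TopologicalSpace B] {k m n i : ℕ}

/-- étale maps -/
structure Et (f : N' → N) : Prop where
  cont : Continuous f
  op : IsOpenMap f
  inj : IsLocallyInjective f

lemma sub_chart {V : Set (E n)} (hV : IsOpen V) {x : E n} (h0 : x ∈ V) :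
    ∃ θ : C(E n, E n), IsOpenEmbedding θ ∧ θ 0 = x ∧ Set.range θ ⊆ V := by
  obtain ⟨r, hr, hb⟩ := Metric.isOpen_iff.1 hV x h0
  let u := OpenPartialHomeomorph.univBall x r
  have hs : u.source = Set.univ := OpenPartialHomeomorph.univBall_source x r
  refine ⟨⟨u, OpenPartialHomeomorph.continuous_univBall x r⟩, u.to_isOpenEmbedding hs,
    OpenPartialHomeomorph.univBall_apply_zero x r, ?_⟩
  rintro _ ⟨v, rfl⟩
  have := u.map_source (x := v) (by rw [hs]; trivial)
  rw [OpenPartialHomeomorph.univBall_target x hr] at this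
  exact hb this

lemma Et.chart {f : C(N', N)} (hf : Et f) (hN : Man n N) (y : N') {V : Set N'} (hV : IsOpen V)
    (hy : y ∈ V) : ∃ ψ : C(E n, N'), IsOpenEmbedding ψ ∧ ψ 0 = y ∧ Set.range ψ ⊆ V ∧
      IsOpenEmbedding (f.comp ψ) := by
  obtain ⟨U', hU', hyU', hi⟩ := hf.inj y
  let U : Set N' := U' ∩ V
  have hU : IsOpen U := hU'.inter hV
  let g : U → N := fun u => f u
  have hg : IsOpenEmbedding g := .of_continuous_injective_isOpenMap (f.continuous.comp continuous_subtype_val)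
    (fun a b h => Subtype.ext (hi a.2.1 b.2.1 h)) (hf.op.comp hU.isOpenMap_subtype_val)
  obtain ⟨θ, h1, h2, h3⟩ := sub_chart (V := hN.Φ (f y) ⁻¹' (Set.range g))
    (hg.isOpen_range.preimage (ContinuousMap.continuous _)) (x := 0)
    (by show hN.Φ (f y) 0 ∈ Set.range g; rw [hN.Φ0]; exact ⟨⟨y, hyU', hy⟩, rfl⟩)
  have he := (hN.emb (f y)).comp h1
  choose ψ hψ using fun v => h3 ⟨v, rfl⟩
  have hc : g ∘ ψ = hN.Φ (f y) ∘ θ := funext hψ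
  have hψ' : IsOpenEmbedding ψ := IsOpenEmbedding.of_comp _ hg (hc ▸ he)
  refine ⟨⟨fun v => ψ v, continuous_subtype_val.comp hψ'.continuous⟩,
    hU.isOpenEmbedding_subtypeVal.comp hψ', ?_, ?_, ?_⟩
  · have : g (ψ 0) = g ⟨y, hyU', hy⟩ := by rw [hψ, h2, hN.Φ0]
    exact congrArg Subtype.val (hg.injective this)
  · rintro _ ⟨v, rfl⟩; exact (ψ v).2.2
  · exact hg.comp hψ'

lemma Et.man {f : C(N', N)} (hf : Et f) (hN : Man n N) (ht : T2Space N') : Man n N' :=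
  ⟨ht, fun y => by
    obtain ⟨ψ, h1, h2, _⟩ := hf.chart hN y isOpen_univ trivial
    exact ⟨ψ, h1, h2⟩⟩

variable {p : Y → X}

lemma dc_t2 [T2Space X] (hp : IsCoveringMap p) : T2Space Y := by
  constructor
  intro a b hab
  by_cases h : p a = p b
  · exact hp.isSeparatedMap a b h hab
  · obtain ⟨u, v, h1, h2, h3, h4, h5⟩ := t2_separation h
    exact ⟨p ⁻¹' u, p ⁻¹' v, h1.preimage hp.continuous, h2.preimage hp.continuous, h3, h4,
      h5.preimage p⟩

lemma dc_cpt [T2Space X] [CompactSpace X] (hp : IsDoubleCover p) : CompactSpace Y := by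
  have key : ∀ x, ∃ K ∈ 𝓝 x, IsCompact (p ⁻¹' K) := by
    intro x
    obtain ⟨hI, U, hx, hU, hfU, H, hH⟩ := hp.1 x
    have : Finite (p ⁻¹' {x}) := Nat.finite_of_card_ne_zero (by rw [hp.2 x]; norm_num)
    obtain ⟨K, hK, hxK, hKU⟩ := exists_compact_subset hU hx
    refine ⟨K, mem_interior_iff_mem_nhds.1 hxK, ?_⟩
    have h1 : IsCompact ((Subtype.val : U → X) ⁻¹' K) := by
      rw [IsEmbedding.subtypeVal.isCompact_iff, Subtype.image_preimage_val, Set.inter_eq_right.2 hKU]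
      exact hK
    have h2 := ((h1.prod (isCompact_univ (X := p ⁻¹' {x}))).image H.symm.continuous).image
      continuous_subtype_val
    convert h2
    ext y
    constructor
    · intro hy
      have hy' : y ∈ p ⁻¹' U := hKU hy
      refine ⟨⟨y, hy'⟩, ⟨H ⟨y, hy'⟩, ⟨?_, trivial⟩, by simp⟩, rfl⟩
      show ((H ⟨y, hy'⟩).1.1) ∈ K
      rw [hH]; exact hy
    · rintro ⟨_, ⟨q, ⟨hq, _⟩, rfl⟩, rfl⟩
      have := hH (H.symm q)
      rw [Homeomorph.apply_symm_apply] at this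
      show p _ ∈ K
      rw [← this]; exact hq
  choose K hK hK' using key
  obtain ⟨t, -, ht⟩ := isCompact_univ.elim_nhds_subcover K (fun x _ => hK x)
  refine ⟨(t.isCompact_biUnion fun x _ => hK' x).of_isClosed_subset isClosed_univ ?_⟩
  intro y _
  have := ht (Set.mem_univ (p y))
  simpa using this

variable {A : Set X}
open Coll

def pc (p : C(Y, X)) (A : Set X) : C(Coll (p ⁻¹' A), Coll A) :=
  ⟨fun q => ⟨(p (ret q), h q), q.2⟩, by fun_prop⟩

lemma Et.coll {p : C(Y, X)} (hp : Et p) : Et (pc p A) where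
  cont := (pc p A).continuous
  op := (hp.op.prodMap IsOpenMap.id).restrictPreimage {q : X × ℝ | 0 ≤ q.2 ∧ (q.2 = 0 ∨ q.1 ∈ A)}
  inj := fun y => by
    obtain ⟨U, h1, h2, h3⟩ := hp.inj (ret y)
    refine ⟨ret ⁻¹' U, h1.preimage (ContinuousMap.continuous _), h2, fun a ha b hb hab => ?_⟩
    exact Coll.ext (h3 ha hb (congrArg (ret (A := A)) hab)) (congrArg (Coll.h (A := A)) hab)

lemma Et.of_cover (hp : IsCoveringMap p) : Et p :=
  ⟨hp.continuous, hp.isOpenMap, hp.isLocalHomeomorph.isLocallyInjective⟩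

lemma dc_pair {p : C(Y, X)} (hp : IsDoubleCover p) (hA : Pair n A) : Pair n (p ⁻¹' A) := by
  have := hA.cpt; have := hA.t2; have := dc_t2 hp.1
  refine ⟨dc_cpt hp, dc_t2 hp.1, hA.cl.preimage p.continuous, (Et.of_cover hp.1).coll.man hA.man ?_⟩
  exact (inferInstance : T2Space {q : Y × ℝ // 0 ≤ q.2 ∧ (q.2 = 0 ∨ q.1 ∈ p ⁻¹' A)})

/-- disconnected double covers split -/
lemma dc_split [T2Space X] [CompactSpace X] [PreconnectedSpace X] {p : C(Y, X)}
    (hp : IsDoubleCover p) (hY : ¬ PreconnectedSpace Y) :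
    ∃ s t : C(X, Y), (∀ x, p (s x) = x) ∧ (∀ x, p (t x) = x) ∧ IsClopen (Set.range s) ∧
      Set.range t = (Set.range s)ᶜ := by
  have := dc_t2 hp.1; have := dc_cpt hp
  have h0 : ∃ U : Set Y, IsClopen U ∧ U.Nonempty ∧ Uᶜ.Nonempty := by
    by_contra hcon
    push Not at hcon
    refine hY (preconnectedSpace_iff_clopen.2 fun s hs => ?_)
    by_contra! h'
    have := hcon s hs h'.1
    exact h'.2 (Set.compl_empty_iff.1 this)
  obtain ⟨U, hU, hn, hn'⟩ := h0
  have sur : ∀ V : Set Y, IsClopen V → V.Nonempty → ∀ x, ∃ y ∈ V, p y = x := by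
    intro V hV hVn x
    have : IsClopen (p '' V) := ⟨(hV.1.isCompact.image p.continuous).isClosed, hp.1.isOpenMap _ hV.2⟩
    have := this.eq_univ (hVn.image p)
    have hx : x ∈ p '' V := by rw [this]; trivial
    exact hx
  have uni : ∀ V : Set Y, IsClopen V → V.Nonempty → Vᶜ.Nonempty → ∀ y ∈ V, ∀ y' ∈ V, p y = p y' → y = y' := by
    intro V hV h1 h2 y hy y' hy' e
    by_contra hne
    obtain ⟨c, hc, hcp⟩ := sur _ hV.compl h2 (p y)
    have hcard := hp.2 (p y)
    have hfin : Finite (p ⁻¹' {p y}) := Nat.finite_of_card_ne_zero (by rw [hcard]; norm_num)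
    have : ({y, y', c} : Set Y).ncard ≤ (p ⁻¹' {p y}).ncard := Set.ncard_le_ncard (by
      rintro _ (rfl | rfl | rfl)
      · rfl
      · exact e.symm
      · exact hcp) hfin
    rw [Set.ncard_eq_three.2 ⟨y, y', c, hne, fun h => hc (h ▸ hy), fun h => hc (h ▸ hy'), rfl⟩,
      ← Nat.card_coe_set_eq, hcard] at this
    omega
  have mk : ∀ V : Set Y, IsClopen V → V.Nonempty → Vᶜ.Nonempty →
      ∃ s : C(X, Y), (∀ x, p (s x) = x) ∧ Set.range s = V := by
    intro V hV h1 h2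
    choose s hs hps using sur V hV h1
    refine ⟨⟨s, ?_⟩, hps, ?_⟩
    · rw [continuous_def]
      intro W hW
      have : s ⁻¹' W = p '' (W ∩ V) := by
        ext x
        constructor
        · intro hx; exact ⟨s x, ⟨hx, hs x⟩, hps x⟩
        · rintro ⟨y, ⟨hy, hyV⟩, rfl⟩
          show s (p y) ∈ W
          rw [uni V hV h1 h2 _ (hs (p y)) y hyV (hps _)]; exact hy
      rw [this]
      exact hp.1.isOpenMap _ (hW.inter hV.2)
    · ext y
      constructor
      · rintro ⟨x, rfl⟩; exact hs x
      · intro hy; exact ⟨p y, uni V hV h1 h2 _ (hs _) _ hy (hps _)⟩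
  obtain ⟨s, h1, h2⟩ := mk U hU hn hn'
  obtain ⟨t, h3, h4⟩ := mk Uᶜ hU.compl hn' (by rwa [compl_compl])
  exact ⟨s, t, h1, h3, by rwa [h2], by rw [h4, h2]⟩

end

/-! transfer -/
section
open Topology
variable {R : Type} [CommRing R] {X Y B : Type} [TopologicalSpace X] [TopologicalSpace Y] [TopologicalSpace B] {k m n i : ℕ}
  {p : C(Y, X)} {A : Set X}

lemma lift_uniq (hp : IsCoveringMap p) {τ τ' : SingSimplex k Y} (h : p.comp τ = p.comp τ')
    (v : TSimplex k) (hv : τ v = τ' v) : τ = τ' :=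
  ContinuousMap.coe_injective (hp.eq_of_comp_eq τ.continuous τ'.continuous
    (funext fun x => congrArg (· x) h) v hv)

lemma lift_ex (hp : IsCoveringMap p) (σ : SingSimplex k X) (v : TSimplex k) {y : Y}
    (hy : p y = σ v) : ∃ τ : SingSimplex k Y, p.comp τ = σ ∧ τ v = y := by
  let c : unitInterval × TSimplex k → TSimplex k := fun q => ⟨fun i => (1 - q.1.1) * v.1 i + q.1.1 * q.2.1 i,
    fun i => add_nonneg (mul_nonneg (sub_nonneg.2 q.1.2.2) (v.2.1 i)) (mul_nonneg q.1.2.1 (q.2.2.1 i)), by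
      rw [Finset.sum_add_distrib, ← Finset.mul_sum, ← Finset.mul_sum, v.2.2, q.2.2.2]; ring⟩
  have hc : Continuous c := by
    refine Continuous.subtype_mk (continuous_pi fun i => ?_) _
    have h1 : Continuous fun q : unitInterval × TSimplex k => q.2.1 i :=
      (continuous_apply i).comp (continuous_subtype_val.comp continuous_snd)
    fun_prop
  let H : C(unitInterval × TSimplex k, X) := σ.comp ⟨c, hc⟩
  have H0 : ∀ a, H (0, a) = p ((ContinuousMap.const (TSimplex k) y) a) := fun a => by
    show σ (c (0, a)) = p y
    rw [hy]; congr 1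
    exact Subtype.ext (funext fun i => by simp [c])
  let L := hp.liftHomotopy H (ContinuousMap.const _ y) H0
  have hL : ∀ q, p (L q) = H q := fun q => congrFun (hp.liftHomotopy_lifts H _ H0) q
  let τ : SingSimplex k Y := L.comp ⟨fun x => (1, x), by fun_prop⟩
  refine ⟨τ, ?_, ?_⟩
  · ext x
    show p (L (1, x)) = σ x
    rw [hL]; show σ (c (1, x)) = _
    congr 1
    exact Subtype.ext (funext fun i => by simp [c])
  · have h1 := hp.eq_of_comp_eq (A := unitInterval) (g₁ := fun t => L (t, v)) (g₂ := fun _ => y)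
      (by fun_prop) continuous_const (funext fun t => by
        show p (L (t, v)) = p y
        rw [hL, hy]; show σ (c (t, v)) = _
        congr 1
        exact Subtype.ext (funext fun i => by show (1 - t.1) * v.1 i + t.1 * v.1 i = _; ring)) 0
      (hp.liftHomotopy_zero H _ H0 v)
    exact congrFun h1 1

def lifts (p : C(Y, X)) (σ : SingSimplex k X) : Set (SingSimplex k Y) := {τ | p.comp τ = σ}

lemma lifts_card (hp : IsDoubleCover p) (σ : SingSimplex k X) : (lifts p σ).ncard = 2 := by
  rw [← Nat.card_coe_set_eq, ← hp.2 (σ (vertexPt 0))]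
  refine Nat.card_eq_of_bijective (fun τ : lifts p σ => (⟨τ.1 (vertexPt 0), DFunLike.congr_fun (show p.comp τ.1 = σ from τ.2) (vertexPt 0)⟩ :
    (p ⁻¹' {σ (vertexPt 0)} : Set Y))) ⟨fun a b h => ?_, fun y => ?_⟩
  · exact Subtype.ext (lift_uniq hp.1 (a.2.trans b.2.symm) _ (congrArg Subtype.val h))
  · obtain ⟨τ, h1, h2⟩ := lift_ex hp.1 σ (vertexPt 0) y.2
    exact ⟨⟨τ, h1⟩, Subtype.ext h2⟩

lemma lifts_fin (hp : IsDoubleCover p) (σ : SingSimplex k X) : (lifts p σ).Finite :=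
  Set.finite_of_ncard_ne_zero (by rw [lifts_card hp]; norm_num)

def tr (hp : IsDoubleCover p) : SChain R k X →ₗ[R] SChain R k Y :=
  lc fun σ => ∑ τ ∈ (lifts_fin hp σ).toFinset, single τ 1

lemma push_tr (hp : IsDoubleCover p) (z : SChain R k X) : push p (tr hp z) = (2 : ℤ) • z := by
  refine lcongr (f := push p ∘ₗ tr hp) (g := (2 : ℤ) • LinearMap.id) z fun σ => ?_
  rw [LinearMap.comp_apply, tr, lc_single, map_sum]
  rw [Finset.sum_congr rfl (g := fun _ => single σ (1 : R)) fun τ hτ => by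
    rw [push_single, show p.comp τ = σ from (lifts_fin hp σ).mem_toFinset.1 hτ]]
  rw [Finset.sum_const, ← Set.ncard_eq_toFinset_card _ (lifts_fin hp σ), lifts_card hp]
  simp

lemma tr_sbdry (hp : IsDoubleCover p) (z : SChain R (k + 1) X) : sbdry R (tr hp z) = tr hp (sbdry R z) := by
  refine lcongr (f := sbdry R ∘ₗ tr hp) (g := tr hp ∘ₗ sbdry R) z fun σ => ?_
  rw [LinearMap.comp_apply, LinearMap.comp_apply, sbdry_single, map_sum, tr, lc_single, map_sum]
  simp_rw [sbdry_single]
  rw [Finset.sum_comm]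
  refine Finset.sum_congr rfl fun i _ => ?_
  rw [← Finset.smul_sum, map_zsmul, tr, lc_single]
  congr 1
  refine Finset.sum_bij (fun τ _ => τ.comp (faceMap i)) (fun τ hτ => ?_) (fun a ha b hb h => ?_)
    (fun τ hτ => ?_) (fun _ _ => rfl)
  · rw [Set.Finite.mem_toFinset] at hτ ⊢
    show p.comp (τ.comp (faceMap i)) = _
    rw [← ContinuousMap.comp_assoc, show p.comp τ = σ from hτ]
  · rw [Set.Finite.mem_toFinset] at ha hb
    exact lift_uniq hp.1 (ha.trans (Eq.symm hb)) _ (congrArg (· (vertexPt 0)) h)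
  · rw [Set.Finite.mem_toFinset] at hτ
    obtain ⟨τ', h1, h2⟩ := lift_ex hp.1 σ (faceMap i (vertexPt 0)) (y := τ (vertexPt 0))
      (congrArg (· (vertexPt 0)) hτ)
    refine ⟨τ', by rw [Set.Finite.mem_toFinset]; exact h1, ?_⟩
    refine lift_uniq hp.1 ?_ (vertexPt 0) h2
    rw [show p.comp τ = _ from hτ, ← ContinuousMap.comp_assoc, h1]

lemma tr_cyc (hp : IsDoubleCover p) {z : SChain R k X} (hz : z ∈ relCyc R k (∅ : Set X)) :
    tr hp z ∈ relCyc R k (∅ : Set Y) := by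
  rw [relCyc_empty] at *
  cases k with
  | zero => rfl
  | succ k => 
    show sbdry R _ = 0
    rw [tr_sbdry, show sbdry R z = 0 from hz, map_zero]

/-- a connected double cover of an orientable closed piece: `p_*` is nonzero on generators -/
lemma dc_deg (hp : IsDoubleCover p) (hX : EZ k (∅ : Set X)) (ho : HomOrientable k X ∅)
    (hY : EZ k (∅ : Set Y)) {z : SChain ℤ k Y} (hz : z ∈ relCyc ℤ k (∅ : Set Y))
    (hz' : z ∉ relBd ℤ k (∅ : Set Y)) : push p z ∉ relBd ℤ k (∅ : Set X) := by
  intro h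
  obtain ⟨b, hb, hb'⟩ := ho
  rw [relHom_iff, sub_zero] at hb'
  obtain ⟨g, hg⟩ := hY.cyclic
  obtain ⟨a, ha⟩ := hg.2 _ (tr_cyc hp hb.1)
  obtain ⟨c, hc⟩ := hg.2 _ hz
  rw [relHom_iff] at ha hc
  have hm : ∀ x ∈ (∅ : Set Y), p x ∈ (∅ : Set X) := fun x hx => hx
  have ha' := push_relBd hm ha
  have hc' := push_relBd hm hc
  rw [map_sub, push_tr, map_zsmul] at ha'
  rw [map_sub, map_zsmul] at hc'
  have h3 : c • push p g ∈ relBd ℤ k (∅ : Set X) := by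
    have := sub_mem h hc'; rwa [sub_sub_cancel] at this
  have hc0 : c ≠ 0 := by
    rintro rfl; rw [zero_smul, sub_zero] at hc; exact hz' hc
  refine hb' (hX.tf hb.1 (mul_ne_zero hc0 two_ne_zero) ?_)
  have h4 := add_mem (Submodule.smul_mem _ c ha') (Submodule.smul_mem _ a h3)
  have e : c • ((2 : ℤ) • b - a • push p g) + a • c • push p g = (c * 2) • b := by module
  rwa [e] at h4

lemma pull_mem {β : C(B, X)} {S : Set X} {z : SChain R k X} (hz : z ∈ suppOn R k S) :
    pull R β z ∈ suppOn R k (β ⁻¹' S) := by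
  refine lc_mem (A := S) (fun σ hσ => ?_) hz
  split_ifs with h
  · refine single_mem_suppOn (fun x => ?_) _
    have := hσ x
    rw [← h.choose_spec] at this; exact this
  · exact zero_mem _

lemma pull_cyc {β : C(B, X)} {S : Set X} (hβ : IsEmbedding β) (h : IsClopen (Set.range β))
    {z : SChain R k X} (hz : z ∈ relCyc R k S) : pull R β z ∈ relCyc R k (β ⁻¹' S) := by
  show sbdryN R k (pull R β z) ∈ suppOn R (k - 1) _
  have hpc : Piece (Set.range β) Set.univ := .of_closed h.1 (by
    rw [← Set.compl_eq_univ_diff]; exact h.compl.1)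
  rw [← pull_sbdryN hβ hpc (mem_suppOn_univ z)]
  exact pull_mem hz

lemma EZ.zero (h : EZ i A) (ho : ¬ HomOrientable i X A) {z : SChain ℤ i X} (hz : z ∈ relCyc ℤ i A) :
    z ∈ relBd ℤ i A := by
  by_contra hz'
  exact ho (h.orientable hz hz')

lemma sec_emb {s : C(X, Y)} (h : ∀ x, p (s x) = x) : IsEmbedding s :=
  Function.LeftInverse.isEmbedding h p.continuous s.continuous

lemma dc_conn (hA : Pair (k + 1) A) [PreconnectedSpace X] [Nonempty X] (hp : IsDoubleCover p)
    (ho : ¬ HomOrientable (k + 1) X A) {c : SChain ℤ (k + 1) Y} (hc : c ∈ relCyc ℤ (k + 1) (p ⁻¹' A))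
    (hc' : c ∉ relBd ℤ (k + 1) (p ⁻¹' A)) : PreconnectedSpace Y := by
  by_contra hY
  have := hA.cpt; have := hA.t2
  obtain ⟨s, t, hs, ht, h1, h2⟩ := dc_split hp hY
  have hpc : Piece (Set.range s) Set.univ := .of_closed h1.1 (by
    rw [← Set.compl_eq_univ_diff]; exact h1.compl.1)
  obtain ⟨v, hv, e⟩ := pull_split (sec_emb hs) hpc (mem_suppOn_univ c)
  rw [← Set.compl_eq_univ_diff, ← h2] at hv
  have key : ∀ s : C(X, Y), (∀ x, p (s x) = x) → IsClopen (Set.range s) →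
      ∀ c ∈ relCyc ℤ (k + 1) (p ⁻¹' A), push s (pull ℤ s c) ∈ relBd ℤ (k + 1) (p ⁻¹' A) := by
    intro s hs h1 c hc
    have h3 := pull_cyc (sec_emb hs) h1 hc
    have h4 : s ⁻¹' (p ⁻¹' A) = A := by ext x; show p (s x) ∈ A ↔ _; rw [hs]
    rw [h4] at h3
    exact push_relBd (fun x hx => by show p (s x) ∈ A; rwa [hs]) ((EZ_pair hA).zero ho h3)
  have h5 := key s hs h1 c hc
  have h6 : v ∈ relCyc ℤ (k + 1) (p ⁻¹' A) := by
    have := sub_mem hc (relBd_le_relCyc _ h5)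
    nth_rw 1 [e] at this
    rwa [add_sub_cancel_left] at this
  have h7 := key t ht (by rw [h2]; exact h1.compl) v h6
  rw [push_pull (sec_emb ht) hv] at h7
  rw [e] at hc'
  exact hc' (add_mem h5 h7)

end

/-! the orientation cover -/
section
open Topology
variable {X Y N N' B : Type} [TopologicalSpace X] [TopologicalSpace Y]
  [TopologicalSpace N] [TopologicalSpace N'] [TopologicalSpace B] {k m n i : ℕ}

lemma ptsurj [T1Space X] {f : C(Y, X)} (hf : IsOpenEmbedding f) {y : Y} {z : SChain ℤ i X}
    (hz : z ∈ relCyc ℤ i {f y}ᶜ) : ∃ u ∈ relCyc ℤ i ({y}ᶜ : Set Y), z - push f u ∈ relBd ℤ i {f y}ᶜ := by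
  have e : f '' {y} = {f y} := Set.image_singleton
  have hc : IsClosed (f '' {y}) := by rw [e]; exact isClosed_singleton
  rw [← e] at hz ⊢
  exact exc_surj hf hc hz

lemma ptinj [T1Space X] {f : C(Y, X)} (hf : IsOpenEmbedding f) {y : Y} {u : SChain ℤ i Y}
    (hu : u ∈ relCyc ℤ i {y}ᶜ) (h : push f u ∈ relBd ℤ i {f y}ᶜ) : u ∈ relBd ℤ i {y}ᶜ := by
  have e : f '' {y} = {f y} := Set.image_singleton
  have hc : IsClosed (f '' {y}) := by rw [e]; exact isClosed_singleton
  rw [← e] at h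
  exact exc_inj hf hc hu h

lemma ptpush {f : C(Y, X)} (hf : Function.Injective f) {y : Y} {u : SChain ℤ i Y}
    (hu : u ∈ relBd ℤ i {y}ᶜ) : push f u ∈ relBd ℤ i {f y}ᶜ :=
  push_relBd (f := f) (B := ({f y}ᶜ : Set X)) (fun x (hx : x ∈ ({y}ᶜ : Set Y)) h => hx (hf h)) hu

lemma cmp [T1Space N] [T1Space N'] {f : C(N', N)} {ψ ψ' : C(E n, N')} (h1 : IsOpenEmbedding ψ)
    (h1' : IsOpenEmbedding ψ') (h2 : IsOpenEmbedding (f.comp ψ)) (h2' : IsOpenEmbedding (f.comp ψ'))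
    {a a' : E n} (ha : ψ a = ψ' a') {u u' : SChain ℤ i (E n)} (hu : u ∈ relCyc ℤ i {a}ᶜ)
    (hu' : u' ∈ relCyc ℤ i {a'}ᶜ)
    (h : push (f.comp ψ) u - push (f.comp ψ') u' ∈ relBd ℤ i {f (ψ a)}ᶜ) :
    push ψ u - push ψ' u' ∈ relBd ℤ i {ψ a}ᶜ := by
  obtain ⟨θ, t1, t2, t3⟩ := sub_chart (V := ψ ⁻¹' Set.range ψ') (x := a)
    (h1'.isOpen_range.preimage ψ.continuous) ⟨a', ha.symm⟩
  choose g hg using fun v => t3 ⟨v, rfl⟩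
  have hc : ψ' ∘ g = ψ.comp θ := funext hg
  have hge : IsOpenEmbedding g := IsOpenEmbedding.of_comp _ h1' (hc ▸ h1.comp t1)
  let θ' : C(E n, E n) := ⟨g, hge.continuous⟩
  have hc' : ψ'.comp θ' = ψ.comp θ := ContinuousMap.coe_injective hc
  have t2' : θ' 0 = a' := h1'.injective (by rw [← ha, ← t2]; exact hg 0)
  subst t2
  rw [← t2'] at hu'
  obtain ⟨v, hv, ev⟩ := ptsurj t1 hu
  obtain ⟨v', hv', ev'⟩ := ptsurj hge (f := θ') hu'
  have e0 : ψ' (θ' 0) = ψ (θ 0) := by rw [t2', ha]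
  have p1 := ptpush h2.injective ev
  have p1' := ptpush h2'.injective ev'
  have p2 := ptpush h1.injective ev
  have p2' := ptpush h1'.injective ev'
  rw [show (f.comp ψ') (θ' 0) = f (ψ (θ 0)) by rw [← e0]; rfl] at p1'
  rw [e0] at p2'
  rw [show (f.comp ψ) (θ 0) = f (ψ (θ 0)) from rfl] at p1
  rw [map_sub, push_push] at p1 p1' p2 p2'
  rw [ContinuousMap.comp_assoc, hc'] at p1'
  rw [ContinuousMap.comp_assoc] at p1
  rw [hc'] at p2'
  have q : push (f.comp (ψ.comp θ)) (v - v') ∈ relBd ℤ i {f (ψ (θ 0))}ᶜ := by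
    have := add_mem (sub_mem h p1) p1'
    rw [map_sub]
    convert this using 1
    abel
  have q2 := ptinj (f := f.comp (ψ.comp θ)) (h2.comp t1) (sub_mem hv hv') q
  have q3 := ptpush (f := ψ.comp θ) (h1.comp t1).injective q2
  rw [map_sub] at q3
  have := add_mem (sub_mem p2 p2') q3
  convert this using 1
  abel

theorem et_sec {f : C(N', N)} (hf : Et f) (hN : Man n N) (ht : T2Space N') {K : Set N'}
    (hK : IsCompact K) (η : N' → SChain ℤ n N) (hη : ∀ y ∈ K, η y ∈ relCyc ℤ n {f y}ᶜ)
    (hl : ∀ y ∈ K, ∃ V, IsOpen V ∧ y ∈ V ∧ ∀ y' ∈ V, y' ∈ K → η y - η y' ∈ relBd ℤ n {f y'}ᶜ) :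
    ∃ z ∈ relCyc ℤ n Kᶜ, ∀ y ∈ K, z ∈ relBd ℤ n {y}ᶜ → η y ∈ relBd ℤ n {f y}ᶜ := by
  have := hN.t2
  have hN' := hf.man hN ht
  have : ∀ y, ∃ (ψ : C(E n, N')) (u : SChain ℤ n (E n)), IsOpenEmbedding ψ ∧ ψ 0 = y ∧
      IsOpenEmbedding (f.comp ψ) ∧ u ∈ relCyc ℤ n {0}ᶜ ∧
      (y ∈ K → η y - push (f.comp ψ) u ∈ relBd ℤ n {f y}ᶜ) := by
    intro y
    obtain ⟨ψ, h1, h2, _, h3⟩ := hf.chart hN y isOpen_univ trivial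
    by_cases hy : y ∈ K
    · have := hη y hy
      have e : f y = (f.comp ψ) 0 := by rw [← h2]; rfl
      rw [e] at this
      obtain ⟨u, hu, hu'⟩ := ptsurj h3 this
      rw [← e] at hu'
      exact ⟨ψ, u, h1, h2, h3, hu, fun _ => hu'⟩
    · exact ⟨ψ, 0, h1, h2, h3, zero_mem _, fun h => absurd h hy⟩
  choose ψ u h1 h2 h3 hu hu' using this
  have hα : ∀ y, push (ψ y) (u y) ∈ relCyc ℤ n {y}ᶜ := fun y => by
    have : push (ψ y) (u y) ∈ relCyc ℤ n {ψ y 0}ᶜ :=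
      push_relCyc (f := ψ y) (B := ({ψ y 0}ᶜ : Set N')) (fun x (hx : x ∈ ({0}ᶜ : Set (E n))) h => hx ((h1 y).injective h)) (hu y)
    rwa [h2] at this
  obtain ⟨z, hz, hz'⟩ := sec_exists hN' hK (fun y => push (ψ y) (u y)) (fun y hy => by
    obtain ⟨W1, o1, m1, c1⟩ := cyc_nhd (hα y)
    obtain ⟨V, o2, m2, c2⟩ := hl y hy
    obtain ⟨W2, o3, m3, c3⟩ := bd_nhd (hu' y hy)
    refine ⟨W1 ∩ V ∩ f ⁻¹' W2 ∩ Set.range (ψ y), ((o1.inter o2).inter (o3.preimage f.continuous)).inter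
      (h1 y).isOpen_range, ⟨⟨⟨m1, m2⟩, m3⟩, 0, h2 y⟩, _, relCyc_mono (Set.compl_subset_compl.2
        fun _ h => h.1.1.1) c1, ?_⟩
    rintro _ ⟨⟨⟨q1, q2⟩, q3⟩, a, rfl⟩ hy'
    set y' := ψ y a with hy'd
    have e : (ψ y) a = ψ y' 0 := by rw [h2]
    refine cmp (h1 y) (h1 y') (h3 y) (h3 y') e ?_ (hu y') ?_
    · have : push (ψ y) (u y) ∈ relCyc ℤ n {ψ y a}ᶜ := relCyc_mono (pt_mono q1) c1
      have h5 : push (ψ y) (sbdryN ℤ n (u y)) ∈ suppOn ℤ (n - 1) {ψ y a}ᶜ := by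
        rw [← push_sbdryN]; exact this
      rw [push_mem_iff (h1 y).injective] at h5
      exact suppOn_mono (fun x (hx : x ∈ ψ y ⁻¹' {ψ y a}ᶜ) h => hx (congrArg (ψ y) h)) h5
    · have := add_mem (sub_mem (c2 _ q2 hy') (relBd_mono (pt_mono (show f y' ∈ W2 from q3)) c3)) (hu' _ hy')
      convert this using 1
      abel)
  refine ⟨z, hz, fun y hy h => ?_⟩
  have h5 := sub_mem h (hz' y hy)
  rw [sub_sub_cancel] at h5
  have h6 : u y ∈ relBd ℤ n {0}ᶜ := ptinj (h1 y) (hu y) (by rw [h2]; exact h5)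
  have h7 := ptpush (h3 y).injective h6
  rw [show (f.comp (ψ y)) 0 = f y by rw [ContinuousMap.comp_apply, h2]] at h7
  have := add_mem (hu' y hy) h7
  rwa [sub_add_cancel] at this

variable {A : Set X}
lemma Hg.unit {G G' : SChain ℤ i X} (h : Hg i A G) (h' : Hg i A G') :
    ∃ s : ℤˣ, G - (s : ℤ) • G' ∈ relBd ℤ i A := by
  obtain ⟨a, ha⟩ := h'.gen _ h.cyc
  obtain ⟨b, hb⟩ := h.gen _ h'.cyc
  have h1 : (1 - a * b) • G ∈ relBd ℤ i A := by
    have := add_mem ha (Submodule.smul_mem _ a hb)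
    convert this using 1
    module
  have h2 := h.free _ h1
  exact ⟨⟨a, b, by linarith, by linarith⟩, ha⟩

lemma Hg.uniq {G G' : SChain ℤ i X} (h' : Hg i A G') {s t : ℤˣ}
    (hs : G - (s : ℤ) • G' ∈ relBd ℤ i A) (ht : G - (t : ℤ) • G' ∈ relBd ℤ i A) : s = t := by
  have := sub_mem ht hs
  rw [sub_sub_sub_cancel_left, ← sub_smul] at this
  have := h'.free _ this
  exact Units.ext (by linarith)

open Coll

structure Frame (hA : Pair n A) where
  γ : X → SChain ℤ n (Coll A)
  W : X → Set X
  op : ∀ i, IsOpen (W i)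
  mem : ∀ i, i ∈ W i
  hg : ∀ i, ∀ x ∈ W i, Hg n ({ι x}ᶜ : Set (Coll A)) (γ i)
  s : X → X → X → ℤˣ
  hs : ∀ i j x, x ∈ W i → x ∈ W j → γ i - (s i j x : ℤ) • γ j ∈ relBd ℤ n {ι x}ᶜ

lemma frame_ex (hA : Pair n A) : Nonempty (Frame hA) := by
  have := hA.man.t2
  choose W h1 h2 h3 h4 h5 using fun q => LG (hA.man.emb q)
  have hm : ∀ i j x, ∃ s : ℤˣ, ι x ∈ W (ι i) → ι x ∈ W (ι j) →
      push (hA.man.Φ (ι i)) (Gn n) - (s : ℤ) • push (hA.man.Φ (ι j)) (Gn n) ∈ relBd ℤ n {ι x}ᶜ := by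
    intro i j x
    by_cases h : ι x ∈ W (ι i) ∧ ι x ∈ W (ι j)
    · obtain ⟨s, hs⟩ := (h5 _ _ h.1).unit (h5 _ _ h.2)
      exact ⟨s, fun _ _ => hs⟩
    · exact ⟨1, fun a b => absurd ⟨a, b⟩ h⟩
  choose s hs using hm
  exact ⟨⟨fun i => push (hA.man.Φ (ι i)) (Gn n), fun i => ι ⁻¹' W (ι i),
    fun i => (h1 _).preimage ι.continuous, fun i => by
      have := h2 (ι i); rw [hA.man.Φ0] at this; exact this,
    fun i x hx => h5 _ _ hx, s, hs⟩⟩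

lemma Frame.cont {hA : Pair n A} (F : Frame hA) (i j : X) :
    ContinuousOn (fun q : X × ℤˣ => q.2 * F.s i j q.1) ((F.W i ∩ F.W j) ×ˢ Set.univ) := by
  have := hA.man.t2
  rintro ⟨x, v⟩ ⟨⟨hi, hj⟩, -⟩
  obtain ⟨V, h1, h2, h3⟩ := bd_nhd (F.hs i j x hi hj)
  have hc : Continuous (fun q : X × ℤˣ => q.2 * F.s i j x) :=
    (continuous_of_discreteTopology (f := fun v : ℤˣ => v * F.s i j x)).comp continuous_snd
  have : {q : X × ℤˣ | q.1 ∈ ι ⁻¹' V} ∈ 𝓝[(F.W i ∩ F.W j) ×ˢ Set.univ] (x, v) :=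
    mem_nhdsWithin_of_mem_nhds (((h1.preimage ι.continuous).preimage continuous_fst).mem_nhds h2)
  have h5 : (fun q : X × ℤˣ => q.2 * F.s i j q.1) =ᶠ[𝓝[(F.W i ∩ F.W j) ×ˢ Set.univ] (x, v)]
      (fun q : X × ℤˣ => q.2 * F.s i j x) := by
    filter_upwards [this, self_mem_nhdsWithin] with q hq hq'
    rw [(F.hg j q.1 hq'.1.2).uniq (F.hs i j q.1 hq'.1.1 hq'.1.2)
      (relBd_mono (pt_mono (show ι q.1 ∈ V from hq)) h3)]
  exact hc.continuousWithinAt.congr_of_eventuallyEq h5 rfl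

def Frame.core {hA : Pair n A} (F : Frame hA) : FiberBundleCore X X ℤˣ where
  baseSet := F.W
  isOpen_baseSet := F.op
  indexAt := id
  mem_baseSet_at := F.mem
  coordChange i j x v := v * F.s i j x
  coordChange_self i x hx v := by
    have : F.s i i x = 1 := (F.hg i x hx).uniq (F.hs i i x hx hx) (by simp)
    rw [this, mul_one]
  continuousOn_coordChange i j := F.cont i j
  coordChange_comp i j k x hx v := by
    have h1 := F.hs i j x hx.1.1 hx.1.2
    have h2 := F.hs j k x hx.1.2 hx.2
    have : F.s i k x = F.s i j x * F.s j k x := by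
      refine (F.hg k x hx.2).uniq (F.hs i k x hx.1.1 hx.2) ?_
      have := add_mem h1 (Submodule.smul_mem _ (F.s i j x : ℤ) h2)
      convert this using 1
      rw [Units.val_mul]
      module
    rw [this, mul_assoc]

theorem or_cover (hA : Pair (k + 1) A) [PreconnectedSpace X] (hx : ∃ x, x ∉ A)
    (ho : ¬ HomOrientable (k + 1) X A) : ∃ (Y : TopCat.{0}) (p : Y → X), IsDoubleCover p ∧
      HomOrientable (k + 1) Y (p ⁻¹' A) := by
  obtain ⟨F⟩ := frame_ex hA
  have := hA.cpt; have := hA.t2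
  let Y := F.core.TotalSpace
  let p0 : Y → X := F.core.proj
  have hcov : IsCoveringMap p0 := FiberBundle.isCoveringMap (F := ℤˣ) (E := F.core.Fiber)
  have hp0 : IsDoubleCover p0 := by
    refine ⟨hcov, fun x => ?_⟩
    have : Nat.card ℤˣ = 2 := by simp
    rw [← this]
    symm
    refine Nat.card_eq_of_bijective (fun v : ℤˣ => (⟨⟨x, v⟩, rfl⟩ : p0 ⁻¹' {x})) ⟨fun a b h => ?_, ?_⟩
    · have h1 := congrArg Subtype.val h
      exact eq_of_heq (Bundle.TotalSpace.mk.inj h1).2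
    · rintro ⟨⟨x', v⟩, rfl⟩; exact ⟨v, rfl⟩
  let p : C(Y, X) := ⟨p0, hcov.continuous⟩
  have hp : IsDoubleCover p := hp0
  have hP := dc_pair hp hA
  have := hP.cpt
  let K0 : Set (Coll (p ⁻¹' A)) := {q | Coll.h q = 0}
  have hK0 : IsCompact K0 := Coll.cpt hP.cl
    (isClosed_eq (ContinuousMap.continuous _) continuous_const) 0 fun q hq => le_of_eq hq
  have hpc : ∀ q ∈ K0, pc p A q = ι (p (ret q)) := fun q hq => Coll.ext rfl hq
  let sg : Y → ℤˣ := fun y => y.2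
  obtain ⟨z, hz, hz'⟩ := et_sec (Et.of_cover hp.1).coll hA.man hP.man.t2 hK0
    (fun q => (sg (ret q) : ℤ) • F.γ (p (ret q))) (fun q hq => by
      rw [hpc q hq]; exact Submodule.smul_mem _ _ (F.hg _ _ (F.mem _)).cyc) (fun q hq => by
      let i := p (ret q)
      let T := F.core.localTriv i
      have hT : ∀ y : Y, p y ∈ F.W i → (T y).2 = sg y * F.s (p y) i (p y) := fun y hy => rfl
      have hc : ContinuousAt (fun q' : Coll (p ⁻¹' A) => (T (ret q')).2) q := by
        refine ContinuousAt.comp (f := fun q' : Coll (p ⁻¹' A) => T (ret q')) continuousAt_snd ?_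
        refine ContinuousAt.comp (f := fun q' : Coll (p ⁻¹' A) => ret q') ?_ ret.continuous.continuousAt
        exact T.continuousAt ((F.core.mem_localTriv_source i _).2 (F.mem _))
      have h1 : {q' : Coll (p ⁻¹' A) | (T (ret q')).2 = (T (ret q)).2} ∈ 𝓝 q :=
        hc.preimage_mem_nhds ((isOpen_discrete {(T (ret q)).2}).mem_nhds rfl)
      obtain ⟨V, hV, o, m⟩ := mem_nhds_iff.1 h1
      refine ⟨V ∩ (fun q' => p (ret q')) ⁻¹' F.W i, o.inter ((F.op i).preimage
        (p.continuous.comp ret.continuous)), ⟨m, F.mem _⟩, fun q' h2 hq' => ?_⟩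
      rw [hpc q' hq']
      have e := hV h2.1
      have e' : (T (ret q')).2 = (T (ret q)).2 := e
      rw [hT _ h2.2, hT _ (F.mem _)] at e'
      have e1 : F.s (p (ret q)) i (p (ret q)) = 1 :=
        (F.hg i _ (F.mem _)).uniq (F.hs i i _ (F.mem _) (F.mem _)) (by simp)
      rw [e1, mul_one] at e'
      have h3 := Submodule.smul_mem _ (-(sg (ret q') : ℤ)) (F.hs _ i _ (F.mem (p (ret q'))) h2.2)
      convert h3 using 1
      rw [← e', Units.val_mul]
      module)
  obtain ⟨x, hx⟩ := hx
  let y : Y := ⟨x, (1 : ℤˣ)⟩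
  have hy : p y ∉ A := hx
  have hr : ∀ q ∈ K0ᶜ, ret q ∈ p ⁻¹' A := fun q hq => mem_of_h hq
  have c1 : push ret z ∈ relCyc ℤ (k + 1) (p ⁻¹' A) := push_relCyc hr hz
  have c2 : push ret z ∉ relBd ℤ (k + 1) (p ⁻¹' A) := by
    intro hb
    have hyK : (ι y : Coll (p ⁻¹' A)) ∈ K0 := rfl
    have h1 : push ι (push ret z) ∈ relBd ℤ (k + 1) ({ι y}ᶜ : Set (Coll (p ⁻¹' A))) :=
      push_relBd (f := ι) (A := p ⁻¹' A) (B := ({ι y}ᶜ : Set (Coll (p ⁻¹' A)))) (fun a ha h => hy (by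
        have : a = y := congrArg (ret (A := p ⁻¹' A)) (show (ι a : Coll (p ⁻¹' A)) = ι y from h)
        rw [← this]; exact ha)) hb
    let H : Coll (p ⁻¹' A) → ℝ → Coll (p ⁻¹' A) :=
      fun q t => ⟨(ret q, |1 - t| * Coll.h q), mul_nonneg (abs_nonneg _) (h_nonneg q), by
        rcases q.2.2 with h | h
        · left; show |1 - t| * Coll.h q = 0; rw [show Coll.h q = 0 from h, mul_zero]
        · exact Or.inr h⟩
    have h2 := homot' (A := K0ᶜ) (B := ({ι y}ᶜ : Set (Coll (p ⁻¹' A)))) (f := ContinuousMap.id _)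
      (g := (ι.comp ret : C(Coll (p ⁻¹' A), Coll (p ⁻¹' A))))
      H (by apply Continuous.subtype_mk; fun_prop)
      (fun q => Coll.ext rfl (by show |(1:ℝ) - 0| * Coll.h q = Coll.h q; simp))
      (fun q => Coll.ext rfl (by show |(1:ℝ) - 1| * Coll.h q = 0; simp))
      (fun q hq t _ _ h => hy (by
        rw [← show ret q = y from congrArg (ret (A := p ⁻¹' A)) h]; exact hr q hq)) hz
    rw [push_id, ← push_push] at h2
    have h3 := sub_mem h1 h2
    rw [sub_sub_cancel] at h3
    have h4 := hz' _ hyK h3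
    rw [hpc _ hyK] at h4
    have := (F.hg _ _ (F.mem (p y))).free _ h4
    exact (Units.ne_zero _) this
  have : Nonempty X := ⟨x⟩
  have : PreconnectedSpace Y := dc_conn hA hp ho c1 c2
  have : Nonempty Y := ⟨y⟩
  exact ⟨TopCat.of Y, p, hp, (EZ_pair hP).orientable c1 c2⟩

end

/-! integral to real chains, norms -/
section
open Topology
variable {X Y B : Type} [TopologicalSpace X] [TopologicalSpace Y] [TopologicalSpace B] {k m n i : ℕ}
  {A : Set X} {α δ : Type}

def itr : SChain ℤ k X →+ SChain ℝ k X := Finsupp.mapRange.addMonoidHom (Int.castAddHom ℝ)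

lemma itr_eq (c : SChain ℤ k X) : intToReal c = itr c := rfl

lemma itr_single (σ : SingSimplex k X) (r : ℤ) : itr (single σ r) = single σ (r : ℝ) :=
  Finsupp.mapRange_single (hf := map_zero _)

lemma acongr {M : Type} [AddCommGroup M] {F G : (α →₀ ℤ) →+ M} (h : ∀ a, F (single a 1) = G (single a 1))
    (z : α →₀ ℤ) : F z = G z :=
  lcongr (f := F.toIntLinearMap) (g := G.toIntLinearMap) z h

lemma itr_push (f : C(X, Y)) (z : SChain ℤ k X) : itr (push f z) = push f (itr z) :=
  acongr (F := itr.comp (push f : SChain ℤ k X →ₗ[ℤ] _).toAddMonoidHom)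
    (G := (push f : SChain ℝ k X →ₗ[ℝ] _).toAddMonoidHom.comp itr)
    (fun σ => by
      show itr (push f (single σ 1)) = push f (itr (single σ 1))
      rw [push_single, itr_single, itr_single, push_single]) z

lemma itr_sbdry (z : SChain ℤ (k + 1) X) : itr (sbdry ℤ z) = sbdry ℝ (itr z) :=
  acongr (F := itr.comp (sbdry ℤ : SChain ℤ (k + 1) X →ₗ[ℤ] _).toAddMonoidHom)
    (G := (sbdry ℝ : SChain ℝ (k + 1) X →ₗ[ℝ] _).toAddMonoidHom.comp itr)
    (fun σ => by
      show itr (sbdry ℤ (single σ 1)) = sbdry ℝ (itr (single σ 1))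
      rw [itr_single, Int.cast_one, sbdry_single, sbdry_single, map_sum]
      refine Finset.sum_congr rfl fun i _ => ?_
      rw [map_zsmul, itr_single, Int.cast_one]) z

lemma itr_pull (β : C(B, X)) (z : SChain ℤ k X) : itr (pull ℤ β z) = pull ℝ β (itr z) :=
  acongr (F := itr.comp (pull ℤ β : SChain ℤ k X →ₗ[ℤ] _).toAddMonoidHom)
    (G := (pull ℝ β : SChain ℝ k X →ₗ[ℝ] _).toAddMonoidHom.comp itr)
    (fun σ => by
      show itr (pull ℤ β (single σ 1)) = pull ℝ β (itr (single σ 1))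
      rw [itr_single, Int.cast_one, pull, pull, lc_single, lc_single]
      split_ifs
      · rw [itr_single, Int.cast_one]
      · exact map_zero _) z

lemma itr_supp {z : SChain ℤ k X} (hz : z ∈ suppOn ℤ k A) : itr z ∈ suppOn ℝ k A := by
  rw [suppOn, Finsupp.mem_supported] at *
  exact subset_trans (Finset.coe_subset.2 (Finsupp.support_mapRange (hf := map_zero (Int.castAddHom ℝ)))) hz

lemma itr_relBd {z : SChain ℤ k X} (hz : z ∈ relBd ℤ k A) : itr z ∈ relBd ℝ k A := by
  obtain ⟨w, u, hu, rfl⟩ := mem_relBd.1 hz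
  rw [map_add, itr_sbdry]
  exact add_mem (sbdry_relBd _ _) (supp_relBd (itr_supp hu))

def wt (f : α → ℝ) (z : α →₀ ℝ) : ℝ := z.sum fun a r => |r| * f a

lemma wt_nonneg {f : α → ℝ} (hf : ∀ a, 0 ≤ f a) (z) : 0 ≤ wt f z :=
  Finset.sum_nonneg fun a _ => mul_nonneg (abs_nonneg _) (hf a)

lemma wt_mono {f g : α → ℝ} (z : α →₀ ℝ) (h : ∀ a, f a ≤ g a) : wt f z ≤ wt g z :=
  Finset.sum_le_sum fun a _ => mul_le_mul_of_nonneg_left (h a) (abs_nonneg _)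

lemma wt_zero (f : α → ℝ) : wt f 0 = 0 := Finsupp.sum_zero_index

lemma wt_single (f : α → ℝ) (a : α) (r : ℝ) : wt f (single a r) = |r| * f a :=
  Finsupp.sum_single_index (by simp)

lemma wt_smul (f : α → ℝ) (r : ℝ) (z) : wt f (r • z) = |r| * wt f z := by
  rw [wt, Finsupp.sum_smul_index (by simp), wt, Finsupp.mul_sum]
  simp only [smul_eq_mul, abs_mul, mul_assoc]

lemma wt_add {f : α → ℝ} (hf : ∀ a, 0 ≤ f a) (x y) : wt f (x + y) ≤ wt f x + wt f y := by
  classical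
  have h := fun (z : α →₀ ℝ) (hz : z.support ⊆ x.support ∪ y.support) =>
    Finsupp.sum_of_support_subset z hz (fun a r => |r| * f a) (by simp)
  rw [wt, wt, wt, h _ Finsupp.support_add, h x Finset.subset_union_left,
    h y Finset.subset_union_right, ← Finset.sum_add_distrib]
  refine Finset.sum_le_sum fun a _ => ?_
  rw [← add_mul]
  exact mul_le_mul_of_nonneg_right (abs_add_le _ _) (hf a)

lemma wt_sum {ι : Type} {f : α → ℝ} (hf : ∀ a, 0 ≤ f a) (s : Finset ι) (g : ι → α →₀ ℝ) :
    wt f (∑ i ∈ s, g i) ≤ ∑ i ∈ s, wt f (g i) := by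
  classical
  induction s using Finset.induction_on with
  | empty => simp [wt_zero]
  | insert a s ha ih =>
    rw [Finset.sum_insert ha, Finset.sum_insert ha]
    exact (wt_add hf _ _).trans (by linarith)

lemma wt_lc {f : δ → ℝ} (hf : ∀ a, 0 ≤ f a) (h : α → δ →₀ ℝ) (z : α →₀ ℝ) :
    wt f (lc h z) ≤ wt (fun a => wt f (h a)) z := by
  rw [lc, Finsupp.linearCombination_apply, Finsupp.sum]
  refine (wt_sum hf _ _).trans (le_of_eq ?_)
  exact Finset.sum_congr rfl fun a _ => wt_smul ..

def nrm (z : α →₀ ℝ) : ℝ := wt (fun _ => 1) z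

open Classical in
lemma relNorm_eq (z : SChain ℝ k X) :
    relNorm A z = wt (fun σ : SingSimplex k X => if Set.range σ ⊆ A then 0 else 1) z := by
  rw [relNorm, wt, Finsupp.sum, Finset.sum_filter]
  refine Finset.sum_congr rfl fun σ _ => ?_
  by_cases h : Set.range σ ⊆ A <;> simp [h]

lemma relNorm_empty (z : SChain ℝ k X) : relNorm ∅ z = nrm z := by
  rw [relNorm_eq, nrm]
  congr 1; funext σ
  rw [if_neg]
  intro h
  exact h ⟨vertexPt 0, rfl⟩

lemma relNorm_nonneg (z : SChain ℝ k X) : 0 ≤ relNorm A z := by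
  classical
  rw [relNorm_eq]
  exact wt_nonneg (fun σ => by split_ifs <;> norm_num) _

open Classical in
def ms (S : Set X) (z : SChain ℝ k X) : ℝ :=
  wt (fun σ : SingSimplex k X => if Set.range σ ⊆ S then 1 else 0) z

lemma nrm_pull {β : C(B, X)} {S : Set X} (h : Set.range β ⊆ S) (z : SChain ℝ k X) :
    nrm (pull ℝ β z) ≤ ms S z := by
  classical
  refine (wt_lc (fun _ => zero_le_one) _ _).trans (wt_mono _ fun σ => ?_)
  by_cases h' : ∃ τ : SingSimplex k B, β.comp τ = σ
  · rw [dif_pos h', wt_single, if_pos]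
    · simp
    · rw [← h'.choose_spec]
      rintro _ ⟨x, rfl⟩; exact h ⟨_, rfl⟩
  · rw [dif_neg h', wt_zero]
    split_ifs <;> norm_num

lemma ms_sum {ι : Type} (s : Finset ι) {S : ι → Set X} {T : Set X} (h : ∀ i ∈ s, S i ⊆ T)
    (hd : ∀ i ∈ s, ∀ j ∈ s, i ≠ j → Disjoint (S i) (S j))
    (z : SChain ℝ k X) : ∑ i ∈ s, ms (S i) z ≤ ms T z := by
  classical
  simp only [ms, wt, Finsupp.sum]
  rw [Finset.sum_comm]
  refine Finset.sum_le_sum fun σ _ => ?_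
  rw [← Finset.mul_sum]
  refine mul_le_mul_of_nonneg_left ?_ (abs_nonneg _)
  rw [← Finset.sum_filter, Finset.sum_const, nsmul_eq_mul, mul_one]
  have hc : (s.filter fun i => Set.range σ ⊆ S i).card ≤ 1 := by
    rw [Finset.card_le_one]
    intro i hi j hj
    rw [Finset.mem_filter] at hi hj
    by_contra hij
    exact Set.disjoint_left.1 (hd i hi.1 j hj.1 hij) (hi.2 ⟨vertexPt 0, rfl⟩) (hj.2 ⟨vertexPt 0, rfl⟩)
  split_ifs with h'
  · exact_mod_cast hc
  · rw [Finset.filter_eq_empty_iff.2]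
    · simp
    · intro i hi h2; exact h' (h2.trans (h i hi))

lemma ms_le (S : Set X) (z : SChain ℝ k X) : ms S z ≤ nrm z := by
  classical
  exact wt_mono _ fun σ => by split_ifs <;> norm_num

end

/-! the norm lemma -/
section
open Topology
variable {X Y B : Type} [TopologicalSpace X] [TopologicalSpace Y] [TopologicalSpace B] {k m n i : ℕ}
  {A : Set X}

lemma contr (H : X → ℝ → X) (hc : Continuous fun q : X × TSimplex 1 => H q.1 (tt q.2))
    (h0 : ∀ x, H x 0 = x) (x0 : X) (h1 : ∀ x, H x 1 = x0) {z : SChain ℤ (k + 1) X}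
    (hz : sbdry ℤ z = 0) : ∃ w, z = sbdry ℤ w := by
  have hz' : z ∈ relCyc ℤ (k + 1) (∅ : Set X) := relCyc_empty.2 hz
  let a : C(X, E 0) := ContinuousMap.const _ 0
  let b : C(E 0, X) := ContinuousMap.const _ x0
  have h2 := homot' (f := ContinuousMap.id X) (g := b.comp a) (A := ∅) (B := ∅) H hc h0 h1
    (fun x hx => absurd hx (Set.notMem_empty _)) hz'
  have hs : ({0}ᶜ : Set (E 0)) = ∅ := by ext x; simp [Subsingleton.elim x 0]
  have h3 := (LocH_E 0).2 (k + 1) (Nat.succ_pos _)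
  rw [hs] at h3
  have h4 := h3 (push a z) (push_relCyc (fun x hx => hx) hz')
  have h5 := push_relBd (f := b) (B := ∅) (fun x hx => absurd hx (Set.notMem_empty _)) h4
  have h6 := sub_mem h5 h2
  rw [push_push, push_id, sub_sub_cancel] at h6
  exact relBd_empty.1 h6

lemma contrS {S : Set X} (H : S → ℝ → S) (hc : Continuous fun q : S × TSimplex 1 => H q.1 (tt q.2))
    (h0 : ∀ x, H x 0 = x) (x0 : S) (h1 : ∀ x, H x 1 = x0) {z : SChain ℤ (k + 1) X}
    (hs : z ∈ suppOn ℤ (k + 1) S) (hz : sbdry ℤ z = 0) : ∃ w ∈ suppOn ℤ (k + 2) S, z = sbdry ℤ w := by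
  let j : C(S, X) := ⟨Subtype.val, continuous_subtype_val⟩
  obtain ⟨y, rfl⟩ := lift_chain (f := j) IsEmbedding.subtypeVal (z := z) (by
    rw [show Set.range j = S from Subtype.range_coe]; exact hs)
  rw [push_sbdry] at hz
  have hy : sbdry ℤ y = 0 := push_inj (f := j) Subtype.val_injective (by rw [hz, map_zero])
  obtain ⟨w, rfl⟩ := contr H hc h0 x0 h1 hy
  exact ⟨push j w, push_range (f := j) (fun x => x.2) w, by rw [push_sbdry]⟩

lemma face_same (j : Fin (m + 2)) (x : TSimplex m) : (faceMap j x).1 j = 0 := by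
  show ∑ k ∈ Finset.univ.filter (fun k => j.succAbove k = j), x.1 k = 0
  simp [Fin.succAbove_ne]

lemma face_succ (j : Fin (m + 2)) (x : TSimplex m) (i) : (faceMap j x).1 (j.succAbove i) = x.1 i := by
  show ∑ k ∈ Finset.univ.filter (fun k => j.succAbove k = j.succAbove i), x.1 k = x.1 i
  simp [Fin.succAbove_right_inj, Finset.sum_filter]

def mn (x : TSimplex m) : ℝ := Finset.univ.inf' ⟨0, Finset.mem_univ _⟩ x.1

lemma mn_nonneg (x : TSimplex m) : 0 ≤ mn x := (Finset.le_inf'_iff _ _).2 fun i _ => x.2.1 i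
lemma mn_le (x : TSimplex m) (i) : mn x ≤ x.1 i := Finset.inf'_le _ (Finset.mem_univ i)
lemma mn_eq (x : TSimplex m) : ∃ i, mn x = x.1 i := by
  obtain ⟨i, _, h⟩ := Finset.exists_mem_eq_inf' ⟨0, Finset.mem_univ _⟩ x.1
  exact ⟨i, h⟩
lemma mn_cont : Continuous (mn : TSimplex m → ℝ) :=
  Continuous.finset_inf'_apply _ fun i _ => (continuous_apply i).comp continuous_subtype_val

def gj (j : Fin (m + 2)) : C(TSimplex m, TSimplex (m + 1)) where
  toFun x := ⟨j.insertNth ((m + 1 : ℝ) * mn x) fun i => x.1 i - mn x, by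
    constructor
    · refine Fin.forall_iff_succAbove j |>.2 ⟨?_, fun i => ?_⟩
      · rw [Fin.insertNth_apply_same]; exact mul_nonneg (by positivity) (mn_nonneg x)
      · rw [Fin.insertNth_apply_succAbove]; linarith [mn_le x i]
    · rw [Fin.sum_univ_succAbove _ j]
      simp [x.2.2]⟩
  continuous_toFun := by
    apply Continuous.subtype_mk
    refine continuous_pi (Fin.forall_iff_succAbove j |>.2 ⟨?_, fun i => ?_⟩)
    · simp only [Fin.insertNth_apply_same]; exact continuous_const.mul mn_cont
    · simp only [Fin.insertNth_apply_succAbove]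
      exact ((continuous_apply i).comp continuous_subtype_val).sub mn_cont

lemma gj_val (j : Fin (m + 2)) (x : TSimplex m) : (gj j x).1 =
    j.insertNth (α := fun _ => ℝ) ((m + 1 : ℝ) * mn x) fun i => x.1 i - mn x := rfl
lemma gj_same (j : Fin (m + 2)) (x) : (gj j x).1 j = (m + 1 : ℝ) * mn x := by
  rw [gj_val, Fin.insertNth_apply_same]
lemma gj_succ (j : Fin (m + 2)) (x) (i) : (gj j x).1 (j.succAbove i) = x.1 i - mn x := by
  rw [gj_val, Fin.insertNth_apply_succAbove]

lemma gj_face (j : Fin (m + 3)) (i : Fin (m + 2)) :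
    (gj j).comp (faceMap i) = (faceMap j).comp (faceMap i) := by
  ext x; apply Subtype.ext
  have h0 : mn (faceMap i x) = 0 := le_antisymm ((mn_le _ i).trans_eq (face_same i x)) (mn_nonneg _)
  refine funext (Fin.forall_iff_succAbove j |>.2 ⟨?_, fun l => ?_⟩)
  · show (gj j (faceMap i x)).1 j = (faceMap j (faceMap i x)).1 j
    rw [gj_same, face_same, h0, mul_zero]
  · show (gj j (faceMap i x)).1 (j.succAbove l) = (faceMap j (faceMap i x)).1 (j.succAbove l)
    rw [gj_succ, face_succ, h0, sub_zero]

def horn (j : Fin (m + 1)) : Set (TSimplex m) := {x | ∃ i ≠ j, x.1 i = 0}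

instance (j : Fin (m + 1)) : TopologicalSpace (horn j) := instTopologicalSpaceSubtype

lemma gj_horn (j : Fin (m + 2)) (x) : gj j x ∈ horn j := by
  obtain ⟨i, hi⟩ := mn_eq x
  refine ⟨j.succAbove i, Fin.succAbove_ne _ _, ?_⟩
  rw [gj_succ, hi, sub_self]

lemma horn_chain (j : Fin (m + 3)) : ∃ w ∈ suppOn ℤ (m + 2) (horn j),
    ∑ i ∈ Finset.univ.erase j, ((-1 : ℤ) ^ (i : ℕ)) • single (faceMap (n := m + 1) i) (1 : ℤ) =
      sbdry ℤ w - ((-1 : ℤ) ^ (j : ℕ)) • single (gj j) 1 := by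
  set s : SChain ℤ (m + 1) (TSimplex (m + 2)) :=
    ∑ i ∈ Finset.univ.erase j, ((-1 : ℤ) ^ (i : ℕ)) • single (faceMap (n := m + 1) i) (1 : ℤ) with hs
  have e1 : sbdry ℤ (single (ContinuousMap.id (TSimplex (m + 2))) (1 : ℤ)) =
      s + ((-1 : ℤ) ^ (j : ℕ)) • single (faceMap j) (1 : ℤ) := by
    rw [sbdry_single, hs, Finset.sum_erase_add _ _ (Finset.mem_univ j)]
    rfl
  have e2 : sbdry ℤ (single (gj j) (1 : ℤ)) = sbdry ℤ (single (faceMap j) (1 : ℤ)) := by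
    rw [sbdry_single, sbdry_single]
    simp only [gj_face]
  have e3 := congrArg (sbdry ℤ) e1
  rw [sbdry_sbdry, map_add, map_zsmul, ← e2, ← map_zsmul, ← map_add] at e3
  have hm : s + ((-1 : ℤ) ^ (j : ℕ)) • single (gj j) (1 : ℤ) ∈ suppOn ℤ (m + 1) (horn j) := by
    refine add_mem (Submodule.sum_mem _ fun i hi => zsmul_mem (single_mem_suppOn (fun x => ?_) _) _)
      (zsmul_mem (single_mem_suppOn (fun x => gj_horn j x) _) _)
    exact ⟨i, (Finset.mem_erase.1 hi).1, face_same i x⟩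
  let H : horn j → ℝ → horn j := fun x t =>
    ⟨⟨fun l => (1 - max 0 (min 1 t)) * x.1.1 l + max 0 (min 1 t) * (vertexPt j).1 l, by
      have h1 : 0 ≤ max 0 (min 1 t) := le_max_left _ _
      have h2 : 0 ≤ 1 - max 0 (min 1 t) := by
        have : max 0 (min 1 t) ≤ 1 := max_le zero_le_one (min_le_left _ _)
        linarith
      refine ⟨fun l => add_nonneg (mul_nonneg h2 (x.1.2.1 l)) (mul_nonneg h1 ((vertexPt j).2.1 l)), ?_⟩
      rw [Finset.sum_add_distrib, ← Finset.mul_sum, ← Finset.mul_sum, x.1.2.2, (vertexPt j).2.2]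
      ring⟩, by
      obtain ⟨i, hi, h⟩ := x.2
      refine ⟨i, hi, ?_⟩
      show (1 - max 0 (min 1 t)) * x.1.1 i + max 0 (min 1 t) * (if i = j then 1 else 0) = 0
      rw [h, if_neg hi]; ring⟩
  obtain ⟨w, hw, e⟩ := contrS (S := horn j) H (by
      apply Continuous.subtype_mk
      apply Continuous.subtype_mk
      refine continuous_pi fun l => ?_
      have h1 : Continuous fun q : horn j × TSimplex 1 => q.1.1.1 l :=
        (continuous_apply l).comp ((continuous_subtype_val (X := Fin (m + 3) → ℝ)).comp
          ((continuous_subtype_val (p := fun x => x ∈ horn j)).comp continuous_fst))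
      have h2 : Continuous fun q : horn j × TSimplex 1 => tt q.2 := by fun_prop
      fun_prop)
    (fun x => Subtype.ext (Subtype.ext (funext fun l => by simp [H])))
    ⟨vertexPt j, by
      obtain ⟨i, hi⟩ := exists_ne j
      exact ⟨i, hi, by simp [vertexPt, hi]⟩⟩
    (fun x => Subtype.ext (Subtype.ext (funext fun l => by simp [H]))) hm e3.symm
  exact ⟨w, hw, by rw [← e]; abel⟩

/-- the circle `∂Δ²` parametrised -/
def gam : C(ℝ, TSimplex 2) where
  toFun t := ⟨![max 0 (1 - |t|), max 0 (1 - |t - 1|), 1 - max 0 (1 - |t|) - max 0 (1 - |t - 1|)], by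
    constructor
    · intro i
      fin_cases i
      · exact le_max_left _ _
      · exact le_max_left _ _
      · show 0 ≤ 1 - max 0 (1 - |t|) - max 0 (1 - |t - 1|)
        rcases max_cases 0 (1 - |t|) with h | h <;> rcases max_cases 0 (1 - |t - 1|) with h' | h' <;>
        rcases abs_cases t with h2 | h2 <;> rcases abs_cases (t - 1) with h3 | h3 <;> linarith
    · simp [Fin.sum_univ_three]⟩
  continuous_toFun := by
    apply Continuous.subtype_mk
    refine continuous_pi fun i => ?_
    fin_cases i
    · show Continuous fun t : ℝ => max 0 (1 - |t|)
      fun_prop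
    · show Continuous fun t : ℝ => max 0 (1 - |t - 1|)
      fun_prop
    · show Continuous fun t : ℝ => 1 - max 0 (1 - |t|) - max 0 (1 - |t - 1|)
      fun_prop

lemma gam_mem (t : ℝ) : ∃ i, (gam t).1 i = 0 := by
  rcases le_total t 0 with h | h
  · refine ⟨1, ?_⟩
    show max 0 (1 - |t - 1|) = 0
    rw [abs_of_nonpos (by linarith), max_eq_left (by linarith)]
  rcases le_total t 1 with h' | h'
  · refine ⟨2, ?_⟩
    show 1 - max 0 (1 - |t|) - max 0 (1 - |t - 1|) = 0
    rw [abs_of_nonneg h, abs_of_nonpos (by linarith : t - 1 ≤ 0), max_eq_right (by linarith),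
      max_eq_right (by linarith)]
    ring
  · refine ⟨0, ?_⟩
    show max 0 (1 - |t|) = 0
    rw [abs_of_nonneg h, max_eq_left (by linarith)]

lemma gam_ext {t : ℝ} {x : TSimplex 2} (h0 : max 0 (1 - |t|) = x.1 0) (h1 : max 0 (1 - |t - 1|) = x.1 1) :
    gam t = x := by
  apply Subtype.ext; funext i
  have := x.2.2
  rw [Fin.sum_univ_three] at this
  fin_cases i
  · exact h0
  · exact h1
  · show 1 - max 0 (1 - |t|) - max 0 (1 - |t - 1|) = x.1 2
    rw [h0, h1]; linarith

lemma TS1 (y : TSimplex 1) : y.1 0 = 1 - y.1 1 ∧ 0 ≤ y.1 1 ∧ y.1 1 ≤ 1 := by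
  have := y.2.2; rw [Fin.sum_univ_two] at this
  exact ⟨by linarith, y.2.1 1, by linarith [y.2.1 0]⟩

def lin (a b : ℝ) : C(TSimplex 1, ℝ) := ⟨fun y => a + b * y.1 1,
  continuous_const.add (continuous_const.mul ((continuous_apply 1).comp continuous_subtype_val))⟩
def lin2 (a b : ℝ) : C(TSimplex 2, ℝ) := ⟨fun y => a * y.1 1 + b * y.1 2,
  (continuous_const.mul ((continuous_apply 1).comp continuous_subtype_val)).add
    (continuous_const.mul ((continuous_apply 2).comp continuous_subtype_val))⟩

lemma lin2_f0 (a b : ℝ) : (lin2 a b).comp (faceMap (0 : Fin 3)) = lin a (b - a) := by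
  ext y
  show a * (faceMap 0 y).1 ((0 : Fin 3).succAbove 0) + b * (faceMap 0 y).1 ((0 : Fin 3).succAbove 1) = a + (b - a) * y.1 1
  rw [face_succ, face_succ, (TS1 y).1]; ring
lemma lin2_f1 (a b : ℝ) : (lin2 a b).comp (faceMap (1 : Fin 3)) = lin 0 b := by
  ext y
  show a * (faceMap 1 y).1 1 + b * (faceMap 1 y).1 ((1 : Fin 3).succAbove 1) = 0 + b * y.1 1
  rw [face_succ, face_same]; ring
lemma lin2_f2 (a b : ℝ) : (lin2 a b).comp (faceMap (2 : Fin 3)) = lin 0 a := by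
  ext y
  show a * (faceMap 2 y).1 ((2 : Fin 3).succAbove 1) + b * (faceMap 2 y).1 2 = 0 + a * y.1 1
  rw [face_succ, face_same]; ring

lemma gam_f0 : gam.comp (lin 1 1) = faceMap (0 : Fin 3) := by
  ext y
  obtain ⟨h0, h1, h2⟩ := TS1 y
  refine gam_ext (t := 1 + 1 * y.1 1) ?_ ?_
  · rw [face_same, abs_of_nonneg (by linarith), max_eq_left (by linarith)]
  · rw [show (faceMap 0 y).1 1 = y.1 0 from face_succ 0 y 0, abs_of_nonneg (by linarith),
      max_eq_right (by linarith)]; linarith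
lemma gam_f1 : gam.comp (lin 0 (-1)) = faceMap (1 : Fin 3) := by
  ext y
  obtain ⟨h0, h1, h2⟩ := TS1 y
  refine gam_ext (t := 0 + (-1) * y.1 1) ?_ ?_
  · rw [show (faceMap 1 y).1 0 = y.1 0 from face_succ 1 y 0, abs_of_nonpos (by linarith),
      max_eq_right (by linarith)]; linarith
  · rw [face_same, abs_of_nonpos (by linarith), max_eq_left (by linarith)]
lemma gam_f2 : gam.comp (lin 0 1) = faceMap (2 : Fin 3) := by
  ext y
  obtain ⟨h0, h1, h2⟩ := TS1 y
  refine gam_ext (t := 0 + 1 * y.1 1) ?_ ?_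
  · rw [show (faceMap 2 y).1 0 = y.1 0 from face_succ 2 y 0, abs_of_nonneg (by linarith),
      max_eq_right (by linarith)]; linarith
  · rw [show (faceMap 2 y).1 1 = y.1 1 from face_succ 2 y 1, abs_of_nonpos (by linarith),
      max_eq_right (by linarith)]; linarith

lemma circ_chain : ∃ w ∈ suppOn ℤ 2 {x : TSimplex 2 | ∃ i, x.1 i = 0},
    ∑ i : Fin 3, ((-1 : ℤ) ^ (i : ℕ)) • single (faceMap (n := 1) i) (1 : ℤ) =
      sbdry ℤ w + single (gam.comp (lin (-1) 3)) 1 := by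
  refine ⟨single (gam.comp (lin2 1 2)) 1 - single (gam.comp (lin2 (-1) 2)) 1, sub_mem
    (single_mem_suppOn (fun x => gam_mem _) _) (single_mem_suppOn (fun x => gam_mem _) _), ?_⟩
  have e : ∀ σ : SingSimplex 2 (TSimplex 2), sbdry ℤ (single σ 1) = single (σ.comp (faceMap (0 : Fin 3))) 1
      - single (σ.comp (faceMap (1 : Fin 3))) 1 + single (σ.comp (faceMap (2 : Fin 3))) 1 := by
    intro σ; rw [sbdry_single, Fin.sum_univ_three]; simp [sub_eq_add_neg]
  have e0 : ∀ a b, (gam.comp (lin2 a b)).comp (faceMap (0 : Fin 3)) = gam.comp (lin a (b - a)) :=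
    fun a b => by rw [← lin2_f0]; rfl
  have e1 : ∀ a b, (gam.comp (lin2 a b)).comp (faceMap (1 : Fin 3)) = gam.comp (lin 0 b) :=
    fun a b => by rw [← lin2_f1 a]; rfl
  have e2 : ∀ a b, (gam.comp (lin2 a b)).comp (faceMap (2 : Fin 3)) = gam.comp (lin 0 a) :=
    fun a b => by rw [← lin2_f2 a b]; rfl
  rw [map_sub, e, e, Fin.sum_univ_three, e0, e0, e1, e1, e2, e2]
  rw [show (2 - 1 : ℝ) = 1 by norm_num, show (2 - (-1) : ℝ) = 3 by norm_num, gam_f0, gam_f1, gam_f2]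
  simp
  abel

end

section
open Topology
variable {X Y B : Type} [TopologicalSpace X] [TopologicalSpace Y] [TopologicalSpace B] {k m n i : ℕ}
  {A : Set X}

lemma face_surj {i : Fin (m + 2)} {x : TSimplex (m + 1)} (h : x.1 i = 0) : ∃ y, faceMap i y = x := by
  let y : TSimplex m := ⟨fun l => x.1 (i.succAbove l), fun l => x.2.1 _, by
    have := x.2.2
    rwa [Fin.sum_univ_succAbove _ i, h, zero_add] at this⟩
  refine ⟨y, Subtype.ext ?_⟩
  refine funext (Fin.forall_iff_succAbove i |>.2 ⟨?_, fun l => ?_⟩)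
  · exact (face_same i y).trans h.symm
  · exact face_succ i y l

open Classical in
def prj (A : Set X) : SChain ℝ k X →ₗ[ℝ] SChain ℝ k X :=
  lc fun σ => if Set.range σ ⊆ A then single σ 1 else 0

lemma prj_single (σ : SingSimplex k X) (h : Set.range σ ⊆ A) : prj A (single σ 1) = single σ 1 := by
  classical
  rw [prj, lc_single, if_pos h]
lemma prj_single' (σ : SingSimplex k X) (h : ¬ Set.range σ ⊆ A) : prj A (single σ 1) = 0 := by
  classical
  rw [prj, lc_single, if_neg h]

lemma prj_id {z : SChain ℝ k X} (hz : z ∈ suppOn ℝ k A) : prj A z = z := by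
  classical
  conv_rhs => rw [← Finsupp.sum_single z]
  rw [prj, lc, Finsupp.linearCombination_apply]
  refine Finset.sum_congr rfl fun σ hσ => ?_
  have h : Set.range σ ⊆ A := (Finsupp.mem_supported ℝ z).1 hz hσ
  show z σ • (if Set.range σ ⊆ A then single σ (1 : ℝ) else 0) = single σ (z σ)
  rw [if_pos h, Finsupp.smul_single, smul_eq_mul, mul_one]

lemma nrm_sgn (σ : SingSimplex k X) (i : ℕ) : nrm (((-1 : ℤ) ^ i) • single σ (1 : ℝ)) = 1 := by
  rcases neg_one_pow_eq_or ℤ i with h | h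
  · rw [h, one_smul, nrm, wt_single]; simp
  · rw [h, neg_smul, one_smul, ← Finsupp.single_neg, nrm, wt_single]; simp

def fs (σ : SingSimplex (k + 1) X) (s : Finset (Fin (k + 2))) : SChain ℝ k X :=
  ∑ i ∈ s, ((-1 : ℤ) ^ (i : ℕ)) • single (σ.comp (faceMap i)) (1 : ℝ)

lemma fs_eq (σ : SingSimplex (k + 1) X) (s) : fs σ s = push σ (itr (∑ i ∈ s, ((-1 : ℤ) ^ (i : ℕ)) •
    single (faceMap (n := k) i) (1 : ℤ))) := by
  rw [fs, map_sum, map_sum]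
  refine Finset.sum_congr rfl fun i _ => ?_
  rw [map_zsmul, map_zsmul, itr_single, push_single, Int.cast_one]

lemma fs_nrm (σ : SingSimplex (k + 1) X) (s) : nrm (fs σ s) ≤ s.card := by
  refine (wt_sum (fun _ => zero_le_one) _ _).trans (le_of_eq ?_)
  rw [Finset.sum_congr rfl fun i _ => show wt (fun _ => 1) _ = 1 from nrm_sgn _ _]
  simp

lemma fs_mem {σ : SingSimplex (k + 1) X} {s} (h : ∀ i ∈ s, Set.range (σ.comp (faceMap i)) ⊆ A) :
    fs σ s ∈ suppOn ℝ k A :=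
  Submodule.sum_mem _ fun i hi => zsmul_mem (single_mem_suppOn (fun x => h i hi ⟨x, rfl⟩) _) _

lemma fs_horn {σ : SingSimplex (m + 2) X} {j} (h : ∀ i ≠ j, Set.range (σ.comp (faceMap i)) ⊆ A) :
    (∀ x ∈ horn j, σ x ∈ A) ∧ ∃ w ∈ suppOn ℝ (m + 2) A, fs σ (Finset.univ.erase j) =
      sbdry ℝ w - ((-1 : ℤ) ^ (j : ℕ)) • single (σ.comp (gj j)) (1 : ℝ) := by
  have h1 : ∀ x ∈ horn j, σ x ∈ A := by
    rintro x ⟨i, hi, h'⟩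
    obtain ⟨y, rfl⟩ := face_surj h'
    exact h i hi ⟨y, rfl⟩
  obtain ⟨w, hw, e⟩ := horn_chain j
  refine ⟨h1, push σ (itr w), push_mem h1 (itr_supp hw), ?_⟩
  rw [fs_eq, e, map_sub, map_sub, itr_sbdry, push_sbdry, map_zsmul, map_zsmul, itr_single, push_single,
    Int.cast_one]

open Classical in
lemma simp_norm (A : Set X) (σ : SingSimplex (m + 2) X) : ∃ r ∈ suppOn ℝ (m + 1) A, ∃ w ∈ suppOn ℝ (m + 2) A,
    r = prj A (sbdry ℝ (single σ 1)) + sbdry ℝ w ∧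
    nrm r ≤ (m + 1) * (if Set.range σ ⊆ A then 0 else 1) := by
  by_cases hσ : Set.range σ ⊆ A
  · have hm : single σ (1 : ℝ) ∈ suppOn ℝ (m + 2) A := single_mem_suppOn (fun x => hσ ⟨x, rfl⟩) _
    refine ⟨0, zero_mem _, - single σ 1, neg_mem hm, ?_, ?_⟩
    · rw [prj_id (sbdry_mem hm), map_neg, add_neg_cancel]
    · rw [nrm, wt_zero, if_pos hσ, mul_zero]
  rw [if_neg hσ, mul_one]
  let P : Fin (m + 3) → Prop := fun i => Set.range (σ.comp (faceMap i)) ⊆ A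
  have e0 : prj A (sbdry ℝ (single σ 1)) = fs σ (Finset.univ.filter P) := by
    rw [sbdry_single, map_sum, fs, Finset.sum_filter]
    refine Finset.sum_congr rfl fun i _ => ?_
    rw [map_zsmul]
    split_ifs with h
    · rw [prj_single _ h]
    · rw [prj_single' _ h, smul_zero]
  rw [e0]
  by_cases h0 : ∃ j, ∀ i ≠ j, P i
  · obtain ⟨j, hj⟩ := h0
    obtain ⟨h1, w, hw, e⟩ := fs_horn hj
    have hg : ((-1 : ℤ) ^ (j : ℕ)) • single (σ.comp (gj j)) (1 : ℝ) ∈ suppOn ℝ (m + 1) A :=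
      zsmul_mem (show single (σ.comp (gj j)) (1 : ℝ) ∈ suppOn ℝ (m + 1) A from
        single_mem_suppOn (fun x => h1 (gj j x) (gj_horn j x)) _) _
    have hn := nrm_sgn (σ.comp (gj j)) j
    set g := ((-1 : ℤ) ^ (j : ℕ)) • single (σ.comp (gj j)) (1 : ℝ)
    have hn' : nrm (-g) = 1 := by
      rw [← neg_one_smul ℝ g, nrm, wt_smul, show wt (fun _ => 1) g = 1 from hn]; simp
    by_cases hjj : P j
    · have hs : Finset.univ.filter P = Finset.univ := by
        rw [Finset.filter_true_of_mem]
        intro i _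
        by_cases hi : i = j
        · rw [hi]; exact hjj
        · exact hj i hi
      rw [hs]
      cases m with
      | zero =>
        obtain ⟨w, hw, e⟩ := circ_chain
        have h2 : ∀ x ∈ {x : TSimplex 2 | ∃ i, x.1 i = 0}, σ x ∈ A := by
          rintro x ⟨i, h'⟩
          obtain ⟨y, rfl⟩ := face_surj h'
          have : i ∈ Finset.univ.filter P := by rw [hs]; exact Finset.mem_univ _
          exact (Finset.mem_filter.1 this).2 ⟨y, rfl⟩
        refine ⟨single (σ.comp (gam.comp (lin (-1) 3))) 1,
          show single (σ.comp (gam.comp (lin (-1) 3))) (1 : ℝ) ∈ suppOn ℝ 1 A from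
            single_mem_suppOn (fun x => h2 (gam (lin (-1) 3 x)) (gam_mem _)) _,
          - push σ (itr w), neg_mem (push_mem h2 (itr_supp hw)), ?_, ?_⟩
        · rw [fs_eq, e, map_add, map_add, itr_sbdry, itr_single, push_single,
            Int.cast_one, map_neg]
          have h5 : sbdry ℝ (push σ (itr w)) = push σ (sbdry ℝ (itr w)) := push_sbdry _ _
          rw [← h5]
          abel
        · rw [nrm, wt_single]; simp
      | succ m =>
        have e1 : fs σ Finset.univ = fs σ (Finset.univ.erase j) + fs σ {j} := by
          rw [fs, fs, fs, Finset.sum_singleton, Finset.sum_erase_add _ _ (Finset.mem_univ j)]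
        refine ⟨-g + fs σ {j}, add_mem (neg_mem hg) (fs_mem fun i hi => ?_), -w, neg_mem hw, ?_, ?_⟩
        · rw [Finset.mem_singleton.1 hi]; exact hjj
        · rw [e1, e, map_neg]; abel
        · have h3 := fs_nrm σ {j}
          have h4 : nrm (-g + fs σ {j}) ≤ nrm (-g) + nrm (fs σ {j}) := wt_add (fun _ => zero_le_one) _ _
          rw [Finset.card_singleton] at h3
          push_cast at *
          have : (0 : ℝ) ≤ m := Nat.cast_nonneg _
          linarith
    · have hs : Finset.univ.filter P = Finset.univ.erase j := by
        ext i
        rw [Finset.mem_filter, Finset.mem_erase]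
        refine ⟨fun h => ⟨fun h' => hjj (h' ▸ h.2), h.1⟩, fun h => ⟨h.2, hj i h.1⟩⟩
      rw [hs]
      refine ⟨-g, neg_mem hg, -w, neg_mem hw, by rw [e, map_neg]; abel, ?_⟩
      rw [hn']
      have : (0 : ℝ) ≤ m := Nat.cast_nonneg _
      linarith
  · refine ⟨_, fs_mem fun i hi => (Finset.mem_filter.1 hi).2, 0, zero_mem _, by rw [map_zero, add_zero], ?_⟩
    refine (fs_nrm _ _).trans ?_
    push Not at h0
    obtain ⟨a, -, ha⟩ := h0 0
    obtain ⟨b, hb, hb'⟩ := h0 a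
    have : Finset.univ.filter P ⊆ (Finset.univ.erase a).erase b := by
      intro i hi
      have := (Finset.mem_filter.1 hi).2
      refine Finset.mem_erase.2 ⟨fun h => hb' (h ▸ this), Finset.mem_erase.2 ⟨fun h => ha (h ▸ this), Finset.mem_univ _⟩⟩
    have h2 := Finset.card_le_card this
    rw [Finset.card_erase_of_mem (Finset.mem_erase.2 ⟨hb, Finset.mem_univ _⟩),
      Finset.card_erase_of_mem (Finset.mem_univ _), Finset.card_univ, Fintype.card_fin] at h2
    exact_mod_cast h2

theorem norm_lemma {z : SChain ℝ (m + 2) X} (hz : sbdry ℝ z ∈ suppOn ℝ (m + 1) A) :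
    ∃ e ∈ suppOn ℝ (m + 1) A, ∃ w ∈ suppOn ℝ (m + 2) A, e = sbdry ℝ z + sbdry ℝ w ∧
      nrm e ≤ (m + 1) * relNorm A z := by
  classical
  choose r hr w hw h1 h2 using simp_norm (m := m) A
  refine ⟨lc r z, lc_mem (A := Set.univ) (fun σ _ => hr σ) (mem_suppOn_univ z),
    lc w z, lc_mem (A := Set.univ) (fun σ _ => hw σ) (mem_suppOn_univ z), ?_, ?_⟩
  · rw [← prj_id hz]
    exact lcongr (f := lc r) (g := prj A ∘ₗ sbdry ℝ + sbdry ℝ ∘ₗ lc w) z fun σ => by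
      rw [LinearMap.add_apply, LinearMap.comp_apply, LinearMap.comp_apply, lc_single, lc_single, h1]
  · refine (wt_lc (fun _ => zero_le_one) _ _).trans ((wt_mono _ h2).trans (le_of_eq ?_))
    rw [relNorm_eq, wt, wt, Finsupp.mul_sum]
    refine Finset.sum_congr rfl fun σ _ => ?_
    ring_nf

end

/-! the connected case -/
section
open Topology
variable {X Y B D : Type} [TopologicalSpace X] [TopologicalSpace Y] [TopologicalSpace B]
  [TopologicalSpace D] {k m n i : ℕ} {A : Set X} {β : C(B, X)}

lemma svOr_le {z : SChain ℝ k X} {c : SChain ℤ k X} (hc : IsFundCycle k A c)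
    (hz : z - itr c ∈ relBd ℝ k A) : simVolOr k X A ≤ relNorm A z := by
  refine csInf_le ⟨0, ?_⟩ ⟨z, ⟨c, hc, relHom_iff.2 hz⟩, rfl⟩
  rintro _ ⟨z, -, rfl⟩; exact relNorm_nonneg z

lemma svOr_nonneg : 0 ≤ simVolOr k X A := by
  refine Real.sInf_nonneg ?_
  rintro _ ⟨z, -, rfl⟩; exact relNorm_nonneg z

lemma svConn_or (h : HomOrientable k X A) : simVolConn k X A = simVolOr k X A := if_pos h
lemma svConn_non (h : ¬ HomOrientable k X A) : simVolConn k X A =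
    (1 / 2) * sInf {r : ℝ | ∃ (Y : TopCat.{0}) (p : ↥Y → X), IsDoubleCover p ∧
      HomOrientable k ↥Y (p ⁻¹' A) ∧ r = simVolOr k ↥Y (p ⁻¹' A)} := if_neg h

lemma svConn_nonneg : 0 ≤ simVolConn k X A := by
  by_cases h : HomOrientable k X A
  · rw [svConn_or h]; exact svOr_nonneg
  · rw [svConn_non h]
    refine mul_nonneg (by norm_num) (Real.sInf_nonneg ?_)
    rintro _ ⟨Y, p, -, -, rfl⟩; exact svOr_nonneg

lemma sv_scale (hB : EZ k (∅ : Set B)) {b : SChain ℤ k B} (hb : b ∈ relCyc ℤ k (∅ : Set B))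
    (hb' : b ∉ relBd ℤ k (∅ : Set B)) {e : SChain ℝ k B} (he : e - itr b ∈ relBd ℝ k (∅ : Set B)) :
    HomOrientable k B ∅ ∧ simVolOr k B ∅ ≤ nrm e := by
  refine ⟨hB.orientable hb hb', ?_⟩
  obtain ⟨c, hc⟩ := hB.cyclic
  obtain ⟨l, hl⟩ := hc.2 b hb
  rw [relHom_iff] at hl
  have hl0 : l ≠ 0 := by
    rintro rfl
    rw [zero_smul, sub_zero] at hl; exact hb' hl
  have hlr : (l : ℝ) ≠ 0 := Int.cast_ne_zero.2 hl0
  have h1 := (relBd ℝ k (∅ : Set B)).smul_mem ((l : ℝ)⁻¹) (add_mem he (itr_relBd hl))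
  have h2 : (l : ℝ)⁻¹ • (e - itr b + itr (b - l • c)) = (l : ℝ)⁻¹ • e - itr c := by
    rw [map_sub, map_zsmul, sub_add_sub_cancel, smul_sub, ← Int.cast_smul_eq_zsmul ℝ, smul_smul,
      inv_mul_cancel₀ hlr, one_smul]
  rw [h2] at h1
  refine (svOr_le hc h1).trans ?_
  rw [relNorm_empty, nrm, wt_smul, abs_inv]
  have h3 : (1 : ℝ) ≤ |(l : ℝ)| := by exact_mod_cast Int.one_le_abs hl0
  exact mul_le_of_le_one_left (wt_nonneg (fun _ => zero_le_one) _) (inv_le_one_of_one_le₀ h3)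

def Bdc (A : Set X) (c : SChain ℤ (k + 1) X) (e : SChain ℝ k X) : Prop :=
  ∃ y ∈ suppOn ℝ (k + 1) A, e - itr (sbdry ℤ c) = sbdry ℝ y

lemma bd_class {c : SChain ℤ (m + 2) X} {z : SChain ℝ (m + 2) X} (hc : c ∈ relCyc ℤ (m + 2) A)
    (hz : z - itr c ∈ relBd ℝ (m + 2) A) : ∃ e, Bdc A c e ∧ nrm e ≤ (m + 1) * relNorm A z := by
  obtain ⟨v, u, hu, e1⟩ := mem_relBd.1 hz
  have e2 : sbdry ℝ z = itr (sbdry ℤ c) + sbdry ℝ u := by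
    rw [itr_sbdry, show z = itr c + (sbdry ℝ v + u) by rw [← e1]; abel, map_add, map_add, sbdry_sbdry,
      zero_add]
  have hc' : sbdry ℤ c ∈ suppOn ℤ (m + 1) A := hc
  obtain ⟨e, he, w, hw, e3, hn⟩ := norm_lemma (A := A) (z := z) (by
    rw [e2]; exact add_mem (itr_supp hc') (sbdry_mem hu))
  refine ⟨e, ⟨u + w, add_mem hu hw, ?_⟩, hn⟩
  rw [e3, e2, map_add]; abel

lemma Bdc.pull {c : SChain ℤ (k + 1) X} {e : SChain ℝ k X} (h : Bdc A c e) (hβ : Pc A β) :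
    SV.pull ℝ β e - itr (SV.pull ℤ β (sbdry ℤ c)) ∈ relBd ℝ k (∅ : Set B) := by
  obtain ⟨y, hy, h⟩ := h
  rw [itr_pull, ← map_sub, h, pull_sbdry hβ.emb hβ.piece hy]
  exact sbdry_relBd _ _

lemma pull_bd_cyc {c : SChain ℤ (k + 1) X} (hc : c ∈ relCyc ℤ (k + 1) A) (hβ : Pc A β) :
    pull ℤ β (sbdry ℤ c) ∈ relCyc ℤ k (∅ : Set B) := by
  refine relCyc_empty.2 ?_
  rw [← pull_sbdryN hβ.emb hβ.piece (show sbdry ℤ c ∈ suppOn ℤ k A from hc), sbdryN_sbdry, map_zero]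

lemma step (hA : Pair (k + 1) A) [PreconnectedSpace X] {c : SChain ℤ (k + 1) X}
    (hc : c ∈ relCyc ℤ (k + 1) A) (hc' : c ∉ relBd ℤ (k + 1) A) (hβ : Pc A β) [Nonempty B]
    [PreconnectedSpace B] {e : SChain ℝ k X} (he : Bdc A c e) :
    HomOrientable k B ∅ ∧ simVolOr k B ∅ ≤ nrm (pull ℝ β e) :=
  sv_scale (EZ_piece hA hβ) (pull_bd_cyc hc hβ) (nonvanish hA hβ hc hc') (he.pull hβ)

lemma fund_ne (ho : HomOrientable k X A) {c : SChain ℤ k X} (hc : IsFundCycle k A c) :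
    c ∉ relBd ℤ k A := by
  intro h
  obtain ⟨b, hb, hb'⟩ := ho
  obtain ⟨l, hl⟩ := hc.2 b hb.1
  rw [relHom_iff] at hl
  refine hb' (relHom_iff.2 ?_)
  rw [sub_zero]
  have := add_mem hl (zsmul_mem h l)
  rwa [sub_add_cancel] at this

lemma svOr_ge (ho : HomOrientable k X A) {r : ℝ} (h : ∀ z : SChain ℝ k X, ∀ c : SChain ℤ k X,
    c ∈ relCyc ℤ k A → c ∉ relBd ℤ k A → z - itr c ∈ relBd ℝ k A → r ≤ relNorm A z) :
    r ≤ simVolOr k X A := by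
  refine le_csInf ?_ ?_
  · obtain ⟨c, hc, -⟩ := ho
    exact ⟨_, itr c, ⟨c, hc, relHom_iff.2 (by rw [itr_eq, sub_self]; exact zero_mem _)⟩, rfl⟩
  · rintro _ ⟨z, ⟨c, hc, hz⟩, rfl⟩
    exact h z c hc.1 (fund_ne ho hc) (relHom_iff.1 hz)

lemma Pc.comp (h : Pc A β) {s : C(D, B)} (hs : IsEmbedding s) (hc : IsClopen (Set.range s)) :
    Pc A (β.comp s) := by
  have hcl : IsClosedEmbedding β := ⟨h.emb, h.cl⟩
  have hr : Set.range (β.comp s) = β '' Set.range s := by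
    rw [ContinuousMap.coe_comp, Set.range_comp]
  refine ⟨h.emb.comp hs, fun d => h.sub _, ?_, ?_⟩
  · rw [hr]; exact hcl.isClosedMap _ hc.1
  · have : A \ Set.range (β.comp s) = (A \ Set.range β) ∪ β '' (Set.range s)ᶜ := by
      rw [hr, Set.image_compl_eq_range_diff_image h.emb.injective]
      ext x
      constructor
      · rintro ⟨h1, h2⟩
        by_cases hx : x ∈ Set.range β
        · exact Or.inr ⟨hx, h2⟩
        · exact Or.inl ⟨h1, hx⟩
      · rintro (⟨h1, h2⟩ | ⟨⟨b, rfl⟩, h2⟩)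
        · refine ⟨h1, fun h3 => h2 (Set.image_subset_range _ _ h3)⟩
        · exact ⟨h.sub b, h2⟩
    rw [this]
    exact h.cl'.union (hcl.isClosedMap _ hc.compl.1)

section cover
variable (p : C(Y, X)) (β)
abbrev Bt : Type := ↥(p ⁻¹' Set.range β)
def bi : C(Bt β p, Y) := ⟨Subtype.val, continuous_subtype_val⟩
def bp (hβ : IsEmbedding β) : C(Bt β p, B) :=
  ⟨hβ.toHomeomorph.symm ∘ (Set.range β).restrictPreimage p, by
    refine hβ.toHomeomorph.symm.continuous.comp ?_
    exact p.continuous.restrictPreimage⟩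
variable {p β}
lemma bp_spec (hβ : IsEmbedding β) (y : Bt β p) : β (bp β p hβ y) = p y.1 := by
  have := hβ.toHomeomorph.apply_symm_apply ((Set.range β).restrictPreimage p y)
  exact congrArg Subtype.val this
lemma bi_range : Set.range (bi β p) = p ⁻¹' Set.range β := Subtype.range_coe
lemma bp_dc (hp : IsDoubleCover p) (hβ : IsEmbedding β) : IsDoubleCover (bp β p hβ) := by
  refine ⟨(hp.1.restrictPreimage _).homeomorph_comp hβ.toHomeomorph.symm, fun b => ?_⟩
  rw [← hp.2 (β b)]
  refine Nat.card_congr ⟨fun y => ⟨y.1.1, ?_⟩, fun y => ⟨⟨y.1, b, ?_⟩, ?_⟩, fun y => rfl, fun y => rfl⟩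
  · show p y.1.1 = β b
    rw [← bp_spec hβ, show bp β p hβ y.1 = b from y.2]
  · exact (show p y.1 = β b from y.2).symm
  · refine hβ.injective ?_
    rw [bp_spec]
    exact y.2
lemma bi_pc (hβ : Pc A β) : Pc (p ⁻¹' A) (bi β p) := by
  refine ⟨IsEmbedding.subtypeVal, ?_, ?_, ?_⟩
  · rintro ⟨y, b, hb⟩
    show p y ∈ A
    rw [← hb]; exact hβ.sub b
  · rw [bi_range]; exact hβ.cl.preimage p.continuous
  · rw [bi_range, ← Set.preimage_diff]; exact hβ.cl'.preimage p.continuous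

lemma step_non (hA : Pair (k + 1) A) [PreconnectedSpace X] [Nonempty X] [PreconnectedSpace Y]
    (ho : ¬ HomOrientable (k + 1) X A)
    (hp : IsDoubleCover p) {c : SChain ℤ (k + 1) Y}
    (hc : c ∈ relCyc ℤ (k + 1) (p ⁻¹' A)) (hc' : c ∉ relBd ℤ (k + 1) (p ⁻¹' A)) (hβ : Pc A β) [Nonempty B]
    [PreconnectedSpace B] {e : SChain ℝ k Y} (he : Bdc (p ⁻¹' A) c e) :
    simVolConn k B ∅ ≤ 1 / 2 * ms (p ⁻¹' Set.range β) e := by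
  have hA' := dc_pair hp hA
  have hi := bi_pc (p := p) hβ
  have hq := bp_dc hp hβ.emb
  have := hA.cpt; have := hA.t2
  have : CompactSpace B := isCompact_univ_iff.1 (hβ.emb.isCompact_iff.2 (by rw [Set.image_univ]; exact hβ.cl.isCompact))
  have : T2Space B := hβ.emb.t2Space
  have hne : Nonempty (Bt β p) := by
    let b := Classical.arbitrary B
    have : Nonempty (bp β p hβ.emb ⁻¹' {b}) := (Nat.card_pos_iff.1 (by rw [hq.2 b]; norm_num)).1
    exact ⟨this.some.1⟩
  by_cases hcon : PreconnectedSpace (Bt β p)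
  · obtain ⟨h1, h2⟩ := step hA' hc hc' hi he
    by_cases hB : HomOrientable k B ∅
    · exfalso
      refine dc_deg hq (EZ_piece hA hβ) hB (EZ_piece hA' hi) (pull_bd_cyc hc hi)
        (nonvanish hA' hi hc hc') ?_
      have hpc : push p c ∈ relBd ℤ (k + 1) A :=
        (EZ_pair hA).zero ho (push_relCyc (f := p) (A := p ⁻¹' A) (B := A) (fun x hx => hx) hc)
      obtain ⟨w, u, hu, e1⟩ := mem_relBd.1 hpc
      obtain ⟨v, hv, e2⟩ := pull_split hi.emb hi.piece (show sbdry ℤ c ∈ suppOn ℤ k (p ⁻¹' A) from hc)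
      have e3 : pull ℤ β (sbdry ℤ (push p c)) = sbdry ℤ (pull ℤ β u) := by
        rw [e1, map_add, sbdry_sbdry, zero_add, pull_sbdry hβ.emb hβ.piece hu]
      have e4 : p.comp (bi β p) = β.comp (bp β p hβ.emb) := by
        ext y; exact (bp_spec hβ.emb y).symm
      rw [push_sbdry, e2, map_add, push_push, e4, ← push_push, map_add, pull_push hβ.emb.injective,
        pull_zero (z := push p v), add_zero] at e3
      · rw [e3]; exact sbdry_relBd _ _
      · refine push_mem (f := p) (A := p ⁻¹' A \ Set.range (bi β p)) (B := (Set.range β)ᶜ)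
          (fun x hx (hx' : p x ∈ Set.range β) => hx.2 ⟨⟨x, hx'⟩, rfl⟩) hv
    · rw [svConn_non hB]
      refine mul_le_mul_of_nonneg_left ?_ (by norm_num)
      refine le_trans ?_ (h2.trans (nrm_pull (by rw [bi_range]) e))
      refine csInf_le ⟨0, ?_⟩ ⟨TopCat.of (Bt β p), bp β p hβ.emb, hq, h1, rfl⟩
      rintro _ ⟨Y, p, -, -, rfl⟩; exact svOr_nonneg
  · obtain ⟨s, t, hs, ht, hr, hrt⟩ := dc_split hq hcon
    have hs' := hi.comp (sec_emb hs) hr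
    have ht' := hi.comp (sec_emb ht) (by rw [hrt]; exact hr.compl)
    obtain ⟨h1, h2⟩ := step hA' hc hc' hs' he
    obtain ⟨-, h3⟩ := step hA' hc hc' ht' he
    rw [svConn_or h1]
    have h4 := ms_sum (Finset.univ : Finset Bool) (S := fun b => cond b
      (Set.range ((bi β p).comp s)) (Set.range ((bi β p).comp t))) (T := p ⁻¹' Set.range β) ?_ ?_ e
    · rw [Fintype.sum_bool] at h4
      have h5 := h2.trans (nrm_pull subset_rfl e)
      have h6 := h3.trans (nrm_pull subset_rfl e)
      dsimp only [cond] at h4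
      linarith
    · rintro (_ | _) - _ ⟨y, rfl⟩
      · exact (t y).2
      · exact (s y).2
    · have hd : ∀ x ∈ Set.range ((bi β p).comp s), x ∉ Set.range ((bi β p).comp t) := by
        rintro _ ⟨y, rfl⟩ ⟨y', h⟩
        have h7 : t y' = s y := hi.emb.injective h
        have : t y' ∈ (Set.range s)ᶜ := by rw [← hrt]; exact ⟨_, rfl⟩
        exact this ⟨y, h7.symm⟩
      rintro (_ | _) - (_ | _) - h
      · exact absurd rfl h
      · exact Set.disjoint_left.2 fun x hx hx' => hd x hx' hx
      · exact Set.disjoint_left.2 hd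
      · exact absurd rfl h
end cover

theorem main_conn (hA : Pair (m + 2) A) [PreconnectedSpace X] [Nonempty X] (hx : ∃ x, x ∉ A)
    {ι : Type} (s : Finset ι) (B : ι → Type) [∀ i, TopologicalSpace (B i)] (β : ∀ i, C(B i, X))
    (hβ : ∀ i, Pc A (β i)) (hne : ∀ i, Nonempty (B i)) (hco : ∀ i, PreconnectedSpace (B i))
    (hd : ∀ i ∈ s, ∀ j ∈ s, i ≠ j → Disjoint (Set.range (β i)) (Set.range (β j))) :
    ∑ i ∈ s, simVolConn (m + 1) (B i) ∅ ≤ (m + 1) * simVolConn (m + 2) X A := by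
  have hm : (0 : ℝ) < m + 1 := by positivity
  rw [← div_le_iff₀' hm]
  by_cases ho : HomOrientable (m + 2) X A
  · rw [svConn_or ho]
    refine svOr_ge ho fun z c hc hc' hz => ?_
    obtain ⟨e, he, hn⟩ := bd_class hc hz
    rw [div_le_iff₀' hm]
    refine le_trans ?_ hn
    refine le_trans (Finset.sum_le_sum fun i _ => ?_) ((ms_sum s (S := fun i => Set.range (β i))
      (T := Set.univ) (fun _ _ => Set.subset_univ _) hd e).trans (ms_le _ e))
    have := hne i; have := hco i
    obtain ⟨h1, h2⟩ := step hA hc hc' (hβ i) he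
    rw [svConn_or h1]
    exact h2.trans (nrm_pull subset_rfl e)
  · rw [svConn_non ho, ← div_le_iff₀' (by norm_num)]
    refine le_csInf ?_ ?_
    · obtain ⟨Y, p, h1, h2⟩ := or_cover hA hx ho
      exact ⟨_, Y, p, h1, h2, rfl⟩
    · rintro _ ⟨Y, p', hp, hY, rfl⟩
      let p : C(Y, X) := ⟨p', hp.1.continuous⟩
      refine svOr_ge hY fun z c hc hc' hz => ?_
      have := dc_conn (p := p) hA hp ho hc hc'
      obtain ⟨e, he, hn⟩ := bd_class hc hz
      rw [div_le_iff₀' (by norm_num), div_le_iff₀' hm]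
      have h3 := (ms_sum s (S := fun i => p ⁻¹' Set.range (β i))
        (T := Set.univ) (fun _ _ => Set.subset_univ _)
        (fun i hi j hj hij => (hd i hi j hj hij).preimage p) e).trans (ms_le _ e)
      have h4 : ∑ i ∈ s, simVolConn (m + 1) (B i) ∅ ≤
          ∑ i ∈ s, 1 / 2 * ms (p ⁻¹' Set.range (β i)) e := Finset.sum_le_sum fun i _ => by
        have := hne i; have := hco i
        exact step_non (p := p) hA ho hp hc hc' (hβ i) he
      rw [← Finset.mul_sum] at h4
      change nrm e ≤ (m + 1) * relNorm (p' ⁻¹' A) z at hn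
      nlinarith

end

/-! manifolds with boundary -/
section
open Topology
variable {X Y N M D : Type} [TopologicalSpace X] [TopologicalSpace Y] [TopologicalSpace N]
  [TopologicalSpace M] [TopologicalSpace D] {k m n i : ℕ}

def ell : C(E n, ℝ) := ⟨fun v => ∑ i, v i, by fun_prop⟩
lemma ell_add (v w : E n) : ell (v + w) = ell v + ell w := by
  show ∑ i, (v i + w i) = ∑ i, v i + ∑ i, w i
  exact Finset.sum_add_distrib
lemma ell_smul (r : ℝ) (v : E n) : ell (r • v) = r * ell v := by
  show ∑ i, r * v i = r * ∑ i, v i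
  rw [Finset.mul_sum]
def nu : E (m + 1) := Pi.single 0 1
lemma ell_nu : ell (nu : E (m + 1)) = 1 := by
  show ∑ i, nu i = (1 : ℝ)
  rw [nu, Finset.sum_pi_single']; simp

abbrev HS (n : ℕ) : Type := {y : E n // 0 ≤ ell y}

def HS.sh (y : HS (m + 1)) (t : ℝ) : HS (m + 1) := ⟨y.1 + max 0 t • nu, by
  rw [ell_add, ell_smul, ell_nu, mul_one]; exact add_nonneg y.2 (le_max_left _ _)⟩
lemma HS.ell_sh (y : HS (m + 1)) (t : ℝ) : ell (y.sh t).1 = ell y.1 + max 0 t := by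
  show ell (y.1 + max 0 t • nu) = _
  rw [ell_add, ell_smul, ell_nu, mul_one]

lemma HS_Hz (x : HS (m + 1)) (hx : ell x.1 = 0) (i : ℕ) : Hz i ({x}ᶜ : Set (HS (m + 1))) := by
  intro z hz
  let g : C(HS (m + 1), HS (m + 1)) := ⟨fun y => y.sh 1, by unfold HS.sh; fun_prop⟩
  have h1 := homot' (f := ContinuousMap.id _) (g := g) (A := {x}ᶜ) (B := {x}ᶜ) HS.sh (by
      apply Continuous.subtype_mk
      fun_prop)
    (fun y => Subtype.ext (by show y.1 + max 0 (0 : ℝ) • nu = y.1; simp)) (fun y => rfl)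
    (fun y (hy : y ∈ ({x}ᶜ : Set (HS (m + 1)))) t h0 _ h => hy ?_) hz
  · rw [push_id] at h1
    have h2 : push g z ∈ suppOn ℤ i ({x}ᶜ : Set (HS (m + 1))) := push_range (f := g) (fun y => show g y ∈ ({x}ᶜ : Set (HS (m + 1))) from fun hy => by
      have h3 : ell (y.sh 1).1 = ell x.1 := congrArg (fun q : HS (m + 1) => ell q.1) hy
      rw [HS.ell_sh, hx] at h3
      have := y.2
      have h4 : max 0 (1 : ℝ) = 1 := max_eq_right zero_le_one
      linarith) z
    have := sub_mem (supp_relBd h2) h1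
    rwa [sub_sub_cancel] at this
  · have h3 : ell (y.sh t).1 = ell x.1 := congrArg (fun q : HS (m + 1) => ell q.1) h
    rw [HS.ell_sh, hx, max_eq_right h0] at h3
    have h4 : t = 0 := by have := y.2; linarith
    have h5 : y.sh t = y := Subtype.ext (by show y.1 + max 0 t • nu = y.1; rw [h4]; simp)
    rw [← h, h5]; rfl

lemma ib_iff {x : M} : x ∉ intBoundary n M ↔ ∃ ψ : C(E n, M), IsOpenEmbedding ψ ∧ ψ 0 = x := by
  constructor
  · intro h
    obtain ⟨U, hx, hU, ⟨e⟩⟩ := not_not.1 h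
    let e' : U ≃ₜ E n := e.trans (EuclideanSpace.equiv (Fin n) ℝ).toHomeomorph
    let f : E n ≃ₜ U := (Homeomorph.addRight (e' ⟨x, hx⟩)).trans e'.symm
    refine ⟨⟨fun v => (f v).1, by fun_prop⟩, hU.isOpenEmbedding_subtypeVal.comp f.isOpenEmbedding, ?_⟩
    show (e'.symm (0 + e' ⟨x, hx⟩)).1 = x
    rw [zero_add, Homeomorph.symm_apply_apply]
  · rintro ⟨ψ, h, h0⟩
    refine not_not.2 ⟨Set.range ψ, ⟨0, h0⟩, h.isOpen_range, ⟨?_⟩⟩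
    exact h.isEmbedding.toHomeomorph.symm.trans (EuclideanSpace.equiv (Fin n) ℝ).symm.toHomeomorph

lemma ib_range {ψ : C(E n, M)} (h : IsOpenEmbedding ψ) (v) : ψ v ∉ intBoundary n M :=
  ib_iff.2 ⟨⟨fun w => ψ (w + v), by fun_prop⟩, h.comp (Homeomorph.addRight v).isOpenEmbedding, by simp⟩

lemma ib_closed : IsClosed (intBoundary n M) := by
  rw [← isOpen_compl_iff, isOpen_iff_mem_nhds]
  intro x hx
  obtain ⟨ψ, h, rfl⟩ := ib_iff.1 hx
  exact Filter.mem_of_superset (h.isOpen_range.mem_nhds ⟨0, rfl⟩) (by rintro _ ⟨v, rfl⟩; exact ib_range h v)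

lemma hs_ib [T2Space M] {φ : C(HS (m + 1), M)} (hφ : IsOpenEmbedding φ) (y : HS (m + 1)) :
    φ y ∈ intBoundary (m + 1) M ↔ ell y.1 = 0 := by
  constructor
  · intro h
    by_contra h0
    have hy : 0 < ell y.1 := lt_of_le_of_ne y.2 (Ne.symm h0)
    obtain ⟨θ, h1, h2, h3⟩ := sub_chart (V := {v : E (m + 1) | 0 < ell v})
      (isOpen_lt continuous_const ell.continuous) hy
    let θ' : C(E (m + 1), HS (m + 1)) := ⟨fun v => ⟨θ v, (h3 ⟨v, rfl⟩ : 0 < ell (θ v)).le⟩, by fun_prop⟩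
    have h4 : IsOpenEmbedding θ' := by
      refine ⟨.of_comp θ'.continuous continuous_subtype_val h1.isEmbedding, ?_⟩
      have : Set.range θ' = Subtype.val ⁻¹' Set.range θ := by
        ext z; constructor
        · rintro ⟨v, rfl⟩; exact ⟨v, rfl⟩
        · rintro ⟨v, hv⟩; exact ⟨v, Subtype.ext hv⟩
      rw [this]; exact h1.isOpen_range.preimage continuous_subtype_val
    have h5 : θ' 0 = y := Subtype.ext h2
    exact ib_range (ψ := φ.comp θ') (hφ.comp h4) 0 (by
      show φ (θ' 0) ∈ _
      rw [h5]; exact h)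
  · intro h
    by_contra h0
    obtain ⟨ψ, h1, h2⟩ := ib_iff.1 h0
    have h3 := loc_Hg h1 (Gn_spec (m + 1))
    rw [h2] at h3
    have h4 := loc_Hz hφ (HS_Hz y h (m + 1)) _ h3.cyc
    have := h3.free 1 (by rwa [one_smul])
    omega

lemma hs_ex (hM : IsManifoldWithBoundary n M) {x : M} (hx : x ∈ intBoundary n M) :
    ∃ φ : C(HS n, M), IsOpenEmbedding φ ∧ ∃ y, φ y = x := by
  obtain ⟨U, hxU, hU, h⟩ := hM.2.2 x
  rcases h with h | ⟨⟨e⟩⟩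
  · exact absurd ⟨U, hxU, hU, h⟩ hx
  let L := (EuclideanSpace.equiv (Fin n) ℝ).toHomeomorph
  let e' : {y : EuclideanSpace ℝ (Fin n) // 0 ≤ ∑ i, y i} ≃ₜ HS n := L.subtype fun y => Iff.rfl
  let f : HS n ≃ₜ U := e'.symm.trans e.symm
  exact ⟨⟨fun v => (f v).1, by fun_prop⟩, hU.isOpenEmbedding_subtypeVal.comp f.isOpenEmbedding,
    f.symm ⟨x, hxU⟩, by show (f (f.symm _)).1 = x; rw [Homeomorph.apply_symm_apply]⟩

open Coll

lemma coll_chart {φ : C(D, M)} (hφ : IsOpenEmbedding φ) {A : Set M} (e : E n ≃ₜ Coll (φ ⁻¹' A))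
    {q : Coll A} (hq : ret q ∈ Set.range φ) : ∃ ψ : C(E n, Coll A), IsOpenEmbedding ψ ∧ ψ 0 = q := by
  obtain ⟨y, hy⟩ := hq
  have het : Et φ := ⟨φ.continuous, hφ.isOpenMap, hφ.injective.IsLocallyInjective⟩
  have hpc : IsOpenEmbedding (pc φ A) := .of_continuous_injective_isOpenMap (pc φ A).continuous
    (fun a b h => Coll.ext (hφ.injective (congrArg (ret (A := A)) h)) (congrArg (Coll.h (A := A)) h))
    het.coll.op
  let q' : Coll (φ ⁻¹' A) := ⟨(y, h q), h_nonneg q, q.2.2.imp id fun h => by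
    show φ y ∈ A
    rw [hy]; exact h⟩
  let f : E n ≃ₜ Coll (φ ⁻¹' A) := (Homeomorph.addRight (e.symm q')).trans e
  refine ⟨(pc φ A).comp ⟨f, f.continuous⟩, hpc.comp f.isOpenEmbedding, ?_⟩
  show pc φ A (e (0 + e.symm q')) = q
  rw [zero_add, Homeomorph.apply_symm_apply]
  exact Coll.ext hy rfl

def homE {A : Set (E n)} (hA : ∀ v, v ∉ A) : E n ≃ₜ Coll A where
  toFun := ι
  invFun := ret
  left_inv v := rfl
  right_inv q := Coll.ext rfl (q.2.2.resolve_right (hA _)).symm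
  continuous_toFun := by fun_prop
  continuous_invFun := by fun_prop

def homH {A : Set (HS (m + 1))} (hA : ∀ v, v ∈ A ↔ ell v.1 = 0) : E (m + 1) ≃ₜ Coll A where
  toFun v := ⟨(⟨v + max 0 (- ell v) • nu, by
      rw [ell_add, ell_smul, ell_nu, mul_one]
      linarith [le_max_right 0 (- ell v)]⟩, max 0 (- ell v)), le_max_left _ _, by
      rcases le_total (- ell v) 0 with h | h
      · exact Or.inl (max_eq_left h)
      · refine Or.inr ((hA _).2 ?_)
        show ell (v + max 0 (- ell v) • nu) = 0
        rw [ell_add, ell_smul, ell_nu, mul_one, max_eq_right h, add_neg_cancel]⟩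
  invFun q := (ret q).1 - h q • nu
  left_inv v := by
    show v + max 0 (- ell v) • nu - max 0 (- ell v) • nu = v
    rw [add_sub_cancel_right]
  right_inv q := by
    have key : max 0 (- ell ((ret q).1 - h q • nu)) = h q := by
      rw [sub_eq_add_neg, ← neg_smul, ell_add, ell_smul, ell_nu]
      have h1 := (ret q).2
      have h2 := h_nonneg q
      by_cases h0 : h q = 0
      · rw [h0, max_eq_left] ; linarith
      · have := (hA _).1 (mem_of_h h0)
        rw [this, max_eq_right] <;> linarith
    refine Coll.ext (Subtype.ext ?_) key
    show (ret q).1 - h q • nu + max 0 (- ell ((ret q).1 - h q • nu)) • nu = (ret q).1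
    rw [key, sub_add_cancel]
  continuous_toFun := by
    apply Continuous.subtype_mk
    refine Continuous.prodMk ?_ (by fun_prop)
    apply Continuous.subtype_mk
    fun_prop
  continuous_invFun := by
    have h1 : Continuous fun q : Coll A => (ret q).1 := continuous_subtype_val.comp ret.continuous
    have h2 : Continuous fun q : Coll A => h q := h.continuous
    fun_prop

lemma man_coll (hM : IsManifoldWithBoundary (m + 1) M) : Man (m + 1) (Coll (intBoundary (m + 1) M)) := by
  have := hM.1
  refine ⟨(inferInstance : T2Space {q : M × ℝ // 0 ≤ q.2 ∧ (q.2 = 0 ∨ q.1 ∈ intBoundary (m + 1) M)}),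
    fun q => ?_⟩
  by_cases hq : ret q ∈ intBoundary (m + 1) M
  · obtain ⟨φ, hφ, y, hy⟩ := hs_ex hM hq
    exact coll_chart hφ (homH (A := φ ⁻¹' intBoundary (m + 1) M) (hs_ib hφ)) ⟨y, hy⟩
  · obtain ⟨ψ, hψ, h0⟩ := ib_iff.1 hq
    exact coll_chart hψ (homE (A := ψ ⁻¹' intBoundary (m + 1) M) (ib_range hψ)) ⟨0, h0⟩

lemma convex_ell (r : Set ℝ) (hr : Convex ℝ r) : Convex ℝ {v : E n | ell v ∈ r} := by
  intro v hv w hw a b ha hb hab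
  show ell (a • v + b • w) ∈ r
  rw [ell_add, ell_smul, ell_smul]
  exact hr hv hw ha hb hab

instance : PreconnectedSpace (HS n) :=
  Subtype.preconnectedSpace (convex_ell (Set.Ici 0) (convex_Ici 0)).isPreconnected

lemma nbM (hM : IsManifoldWithBoundary (m + 1) M) (x : M) : ∃ U, IsOpen U ∧ x ∈ U ∧ IsPreconnected U ∧
    ∃ y ∈ U, y ∉ intBoundary (m + 1) M := by
  have := hM.1
  by_cases hx : x ∈ intBoundary (m + 1) M
  · obtain ⟨φ, hφ, y, hy⟩ := hs_ex hM hx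
    refine ⟨Set.range φ, hφ.isOpen_range, ⟨y, hy⟩, isPreconnected_range φ.continuous, φ (y.sh 1), ⟨_, rfl⟩, ?_⟩
    rw [hs_ib hφ, HS.ell_sh]
    have h4 : max 0 (1 : ℝ) = 1 := max_eq_right zero_le_one
    have := y.2
    intro h; linarith
  · obtain ⟨ψ, hψ, h0⟩ := ib_iff.1 hx
    exact ⟨Set.range ψ, hψ.isOpen_range, ⟨0, h0⟩, isPreconnected_range ψ.continuous, x, ⟨0, h0⟩, hx⟩

lemma nbA (hM : IsManifoldWithBoundary (m + 1) M) (x : intBoundary (m + 1) M) :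
    ∃ U, IsOpen U ∧ x ∈ U ∧ IsPreconnected U := by
  have := hM.1
  obtain ⟨φ, hφ, y, hy⟩ := hs_ex hM x.2
  let Z : Type := {v : E (m + 1) // ell v = 0}
  have : PreconnectedSpace Z :=
    Subtype.preconnectedSpace (convex_ell {0} (convex_singleton 0)).isPreconnected
  let f : Z → intBoundary (m + 1) M := fun v => ⟨φ ⟨v.1, v.2.ge⟩, (hs_ib hφ _).2 v.2⟩
  have hf : Continuous f := by
    apply Continuous.subtype_mk
    refine φ.continuous.comp ?_
    exact Continuous.subtype_mk continuous_subtype_val _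
  have hr : Set.range f = Subtype.val ⁻¹' Set.range φ := by
    ext a; constructor
    · rintro ⟨v, rfl⟩; exact ⟨_, rfl⟩
    · rintro ⟨v, hv⟩
      have : φ v ∈ intBoundary (m + 1) M := by rw [hv]; exact a.2
      exact ⟨⟨v.1, (hs_ib hφ v).1 this⟩, Subtype.ext hv⟩
  refine ⟨Set.range f, ?_, ?_, isPreconnected_range hf⟩
  · rw [hr]; exact hφ.isOpen_range.preimage continuous_subtype_val
  · rw [hr]; exact ⟨y, hy⟩

lemma mk_eq_of {U : Set X} (hU : IsPreconnected U) {x y : X} (hx : x ∈ U) (hy : y ∈ U) :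
    ConnectedComponents.mk x = ConnectedComponents.mk y :=
  ConnectedComponents.coe_eq_coe'.2 (hU.subset_connectedComponent hy hx)

lemma comp_clopen (h : ∀ x : X, ∃ U, IsOpen U ∧ x ∈ U ∧ IsPreconnected U) (s : Set (ConnectedComponents X)) :
    IsOpen (ConnectedComponents.mk ⁻¹' s) := by
  rw [isOpen_iff_mem_nhds]
  intro x hx
  obtain ⟨U, h1, h2, h3⟩ := h x
  refine Filter.mem_of_superset (h1.mem_nhds h2) fun y hy => ?_
  show ConnectedComponents.mk y ∈ s
  rw [mk_eq_of h3 hy h2]; exact hx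

lemma comp_fin [CompactSpace X] (h : ∀ x : X, ∃ U, IsOpen U ∧ x ∈ U ∧ IsPreconnected U) :
    Finite (ConnectedComponents X) := by
  have : DiscreteTopology (ConnectedComponents X) := by
    rw [discreteTopology_iff_forall_isOpen]
    intro s
    exact ConnectedComponents.isQuotientMap_coe.isOpen_preimage.1 (comp_clopen h s)
  have : CompactSpace (ConnectedComponents X) := by
    rw [← isCompact_univ_iff, ← ConnectedComponents.isQuotientMap_coe.surjective.range_eq]
    exact isCompact_range ConnectedComponents.isQuotientMap_coe.continuous
  exact finite_of_compact_of_discrete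

lemma comp_conn (c : ConnectedComponents X) : PreconnectedSpace {x : X // ConnectedComponents.mk x = c} := by
  obtain ⟨x, rfl⟩ := ConnectedComponents.surjective_coe c
  have : {y : X | ConnectedComponents.mk y = ConnectedComponents.mk x} = connectedComponent x := by
    ext y; exact ConnectedComponents.coe_eq_coe'
  have h := isPreconnected_connectedComponent (x := x)
  rw [← this] at h
  exact Subtype.preconnectedSpace h

lemma comp_ne (c : ConnectedComponents X) : Nonempty {x : X // ConnectedComponents.mk x = c} := by
  obtain ⟨x, hx⟩ := ConnectedComponents.surjective_coe c
  exact ⟨⟨x, hx⟩⟩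

theorem final [CompactSpace M] (hM : IsManifoldWithBoundary (m + 2) M) :
    SimVol (m + 1) ↥(intBoundary (m + 2) M) ∅ ≤ (m + 1) * SimVol (m + 2) M (intBoundary (m + 2) M) := by
  have := hM.1
  set A := intBoundary (m + 2) M with hA
  have hcl : IsClosed A := ib_closed
  have : CompactSpace A := isCompact_iff_compactSpace.1 hcl.isCompact
  have nM : ∀ x : M, ∃ U, IsOpen U ∧ x ∈ U ∧ IsPreconnected U := fun x => by
    obtain ⟨U, h1, h2, h3, -⟩ := nbM hM x
    exact ⟨U, h1, h2, h3⟩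
  have nA : ∀ x : A, ∃ U, IsOpen U ∧ x ∈ U ∧ IsPreconnected U := nbA hM
  have := comp_fin nM
  have := comp_fin nA
  have := Fintype.ofFinite (ConnectedComponents M)
  have := Fintype.ofFinite (ConnectedComponents A)
  classical
  let cm : ConnectedComponents A → ConnectedComponents M :=
    Continuous.connectedComponentsMap (f := (Subtype.val : A → M)) continuous_subtype_val
  rw [SimVol, SimVol, finsum_eq_sum_of_fintype, finsum_eq_sum_of_fintype, ← Fintype.sum_fiberwise cm,
    Finset.mul_sum]
  refine Finset.sum_le_sum fun c _ => ?_
  let X : Type := {x : M // ConnectedComponents.mk x = c}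
  have hop : IsOpen {x : M | ConnectedComponents.mk x = c} := comp_clopen nM {c}
  have hcl' : IsClosed {x : M | ConnectedComponents.mk x = c} := by
    rw [← isOpen_compl_iff]; exact comp_clopen nM {c}ᶜ
  let v : C(X, M) := ⟨Subtype.val, continuous_subtype_val⟩
  have hP : Pair (m + 2) (v ⁻¹' A) := by
    have t2 : T2Space X := inferInstanceAs (T2Space {x : M // ConnectedComponents.mk x = c})
    refine ⟨isCompact_iff_compactSpace.1 hcl'.isCompact, t2, hcl.preimage v.continuous, ?_⟩
    have het : Et v := ⟨v.continuous, hop.isOpenMap_subtype_val, Subtype.val_injective.IsLocallyInjective⟩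
    exact het.coll.man (man_coll hM)
      (inferInstance : T2Space {q : X × ℝ // 0 ≤ q.2 ∧ (q.2 = 0 ∨ q.1 ∈ v ⁻¹' A)})
  have : PreconnectedSpace X := comp_conn c
  have hne : Nonempty X := comp_ne c
  have hx : ∃ x : X, x ∉ v ⁻¹' A := by
    obtain ⟨x⟩ := hne
    obtain ⟨U, h1, h2, h3, y, h4, h5⟩ := nbM hM x.1
    exact ⟨⟨y, (mk_eq_of h3 h4 h2).trans x.2⟩, h5⟩
  let B : {d // cm d = c} → Type := fun d => {a : A // ConnectedComponents.mk a = d.1}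
  have hB : ∀ d : {d // cm d = c}, ∀ a : B d, ConnectedComponents.mk (a.1.1 : M) = c := fun d a =>
    (congrArg cm a.2).trans d.2
  let β : ∀ d, C(B d, X) := fun d => ⟨fun a => ⟨a.1.1, hB d a⟩, by
    apply Continuous.subtype_mk
    exact continuous_subtype_val.comp continuous_subtype_val⟩
  have hr : ∀ d, Set.range (β d) = v ⁻¹' (Subtype.val '' {a : A | ConnectedComponents.mk a = d.1}) := by
    intro d; ext x; constructor
    · rintro ⟨a, rfl⟩; exact ⟨a.1, a.2, rfl⟩
    · rintro ⟨a, ha, e⟩; exact ⟨⟨a, ha⟩, Subtype.ext e⟩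
  have hcs : ∀ s : Set (ConnectedComponents A),
      IsClosed (v ⁻¹' (Subtype.val '' (ConnectedComponents.mk ⁻¹' s : Set A))) := by
    intro s
    refine IsClosed.preimage v.continuous (hcl.isClosedEmbedding_subtypeVal.isClosedMap _ ?_)
    rw [← isOpen_compl_iff]; exact comp_clopen nA sᶜ
  refine main_conn hP hx Finset.univ B β (fun d => ⟨?_, fun a => a.1.2, ?_, ?_⟩) (fun d => comp_ne d.1)
    (fun d => comp_conn d.1) ?_
  · exact .of_comp (β d).continuous v.continuous
      ((IsEmbedding.subtypeVal (p := fun x => x ∈ A)).comp IsEmbedding.subtypeVal)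
  · rw [hr]; exact hcs {d.1}
  · convert hcs {d.1}ᶜ using 1
    rw [hr]
    ext x; constructor
    · rintro ⟨h1, h2⟩
      exact ⟨⟨x.1, h1⟩, fun h => h2 ⟨⟨x.1, h1⟩, h, rfl⟩, rfl⟩
    · rintro ⟨a, ha, e⟩
      refine ⟨?_, ?_⟩
      · show v x ∈ A
        rw [← e]; exact a.2
      · rintro ⟨b, hb, e'⟩
        have : b = a := Subtype.ext (e'.trans e.symm)
        exact ha (this ▸ hb)
  · intro d _ d' _ hdd
    rw [Set.disjoint_left]
    rintro _ ⟨a, rfl⟩ ⟨b, hb⟩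
    have : b.1 = a.1 := Subtype.ext (congrArg (fun x : X => x.1) hb)
    exact hdd (Subtype.ext (by rw [← a.2, ← b.2, this]))

end

end SV

/-- **Statement 11.**  Every compact `n`-manifold `M`, `n ≥ 2`, satisfies
`‖M, ∂M‖ ≥ ‖∂M‖ / (n - 1)`. -/
theorem simvol_boundary_bound (n : ℕ) (hn : 2 ≤ n) (M : Type) [TopologicalSpace M]
    [CompactSpace M] (hM : IsManifoldWithBoundary n M) :
    SimVol (n - 1) ↥(intBoundary n M) (∅ : Set ↥(intBoundary n M)) / ((n : ℝ) - 1) ≤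
      SimVol n M (intBoundary n M) := by
  obtain ⟨m, rfl⟩ := Nat.exists_eq_add_of_le' hn
  have h := SV.final (m := m) hM
  have e : ((m + 2 : ℕ) : ℝ) - 1 = m + 1 := by push_cast; ring
  have hp : (0 : ℝ) < m + 1 := by positivity
  rw [e, div_le_iff₀' hp]
  exact h

end
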